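/- Let N be a positive definite integral lattice of rank n. Then {cls(N)} is an n-exceptional set (i.e., there exists an integral lattice L whose set of non-represented rank-n classes is exactly {cls(N)}) if and only if every Φ_n-universality criterion set contains cls(N). -/

import Mathlib

open Matrix

/-- Square integer matrices of size `n`, used as Gram matrices of lattices. -/
abbrev Mat (n : ℕ) := Matrix (Fin n) (Fin n) ℤ

/-- `G` is the Gram matrix of a positive definite integral lattice:
it is symmetric and `vᵀ G v > 0` for every nonzero integer vector `v`. -/
def PosDefInt {n : ℕ} (G : Mat n) : Prop :=
  G.IsSymm ∧ ∀ v : Fin n → ℤ, v ≠ 0 → 0 < v ⬝ᵥ G.mulVec v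

/-- The lattice with Gram matrix `L` represents the lattice with Gram matrix `N`:
there is an integral matrix `T` (whose rows are the coordinates of the images of
the basis vectors) with `T L Tᵀ = N`. -/
def Represents {m n : ℕ} (L : Mat m) (N : Mat n) : Prop :=
  ∃ T : Matrix (Fin n) (Fin m) ℤ, T * L * T.transpose = N

/-- Isometry of (positive definite) lattices, expressed as mutual representation. -/
def Isom {m n : ℕ} (A : Mat m) (B : Mat n) : Prop :=
  Represents A B ∧ Represents B A

theorem Represents.rfl' {n : ℕ} (A : Mat n) : Represents A A :=
  ⟨1, by simp⟩

theorem Represents.trans' {a b c : ℕ} {A : Mat a} {B : Mat b} {C : Mat c}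
    (h1 : Represents A B) (h2 : Represents B C) : Represents A C := by
  obtain ⟨T1, h1⟩ := h1
  obtain ⟨T2, h2⟩ := h2
  refine ⟨T2 * T1, ?_⟩
  rw [← h2, ← h1]
  simp [Matrix.mul_assoc, Matrix.transpose_mul]

/-- A positive definite integral lattice of rank `n`, given by a Gram matrix. -/
def QLat (n : ℕ) := {G : Mat n // PosDefInt G}

instance latSetoid (n : ℕ) : Setoid (QLat n) where
  r A B := Isom A.1 B.1
  iseqv := ⟨fun A => ⟨Represents.rfl' _, Represents.rfl' _⟩,
    fun h => ⟨h.2, h.1⟩,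
    fun h1 h2 => ⟨h1.1.trans' h2.1, h2.2.trans' h1.2⟩⟩

/-- Isometry classes of positive definite integral lattices of rank `n` (`Φ_n`). -/
def Cls (n : ℕ) := Quotient (latSetoid n)

/-- The isometry class of a lattice. -/
def cls {n : ℕ} (L : QLat n) : Cls n := Quotient.mk _ L

/-- A lattice represents an isometry class. -/
def RepCls {m n : ℕ} (L : QLat m) (c : Cls n) : Prop :=
  ∃ N : QLat n, cls N = c ∧ Represents L.1 N.1

/-- The `n`-exceptional set of `L`: the classes of rank-`n` positive definite
integral lattices not represented by `L`. -/
def ExcSet (n : ℕ) {m : ℕ} (L : QLat m) : Set (Cls n) :=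
  {c : Cls n | ¬ RepCls L c}

/-- `X` is a `Φ_n`-universality criterion set: a finite set of classes such that
any integral lattice representing all classes in `X` represents all classes in `Φ_n`. -/
def CritSet (n : ℕ) (X : Set (Cls n)) : Prop :=
  X.Finite ∧ ∀ (r : ℕ) (L : QLat r), (∀ c ∈ X, RepCls L c) → ∀ c : Cls n, RepCls L c

set_option linter.unusedVariables false
set_option linter.unusedSimpArgs false
set_option maxHeartbeats 400000

lemma energy_ker (q : ℕ) [NeZero q] (α : Fin 3 → ℤ) :
    ∃ d ∈ q.divisors, (∀ i, (d:ℤ) ∣ α i) ∧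
      (Finset.univ.filter (fun w : Fin 3 → ZMod q => ∑ i, (α i : ZMod q) * w i = 0)).card ≤ q^2 * d := by
  classical
  let f : (Fin 3 → ZMod q) →+ ZMod q :=
    { toFun := fun w => ∑ i, (α i : ZMod q) * w i
      map_zero' := by simp
      map_add' := by intro x y; simp [mul_add, Finset.sum_add_distrib] }
  have hq : 0 < q := Nat.pos_of_ne_zero (NeZero.ne q)
  have h1 : Nat.card f.ker * Nat.card f.range = q^3 := by
    have := AddSubgroup.card_eq_card_quotient_mul_card_addSubgroup f.ker
    rw [Nat.card_congr (QuotientAddGroup.quotientKerEquivRange f).toEquiv] at this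
    rw [mul_comm, ← this]
    simp [Nat.card_eq_fintype_card, ZMod.card]
  have h2 : Nat.card f.range ∣ q := by
    have := AddSubgroup.card_addSubgroup_dvd_card f.range
    simpa [Nat.card_eq_fintype_card, ZMod.card] using this
  obtain ⟨d, hd⟩ := h2
  set r := Nat.card f.range with hr
  have hr0 : 0 < r := Nat.pos_of_ne_zero (by rintro h; rw [h] at hd; omega)
  refine ⟨d, by rw [Nat.mem_divisors]; exact ⟨⟨r, by rw [hd]; ring⟩, hq.ne'⟩, ?_, ?_⟩
  · intro i
    have hm : (α i : ZMod q) ∈ f.range := by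
      refine ⟨Pi.single i 1, ?_⟩
      show ∑ j, (α j : ZMod q) * (Pi.single i 1 : Fin 3 → ZMod q) j = _
      simp [Pi.single_apply]
    have h3 : r • (⟨_, hm⟩ : f.range) = 0 := by
      rw [hr, Nat.card_eq_fintype_card]; exact card_nsmul_eq_zero
    have h4 : ((r * α i : ℤ) : ZMod q) = 0 := by
      have := congrArg Subtype.val h3
      simpa using this
    rw [ZMod.intCast_zmod_eq_zero_iff_dvd] at h4
    have : ((r:ℤ) * d) ∣ r * α i := by
      have h5 : (q:ℤ) = r * d := by exact_mod_cast hd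
      rwa [h5] at h4
    exact Int.dvd_of_mul_dvd_mul_left (by exact_mod_cast hr0.ne') this
  · have h5 : (Finset.univ.filter (fun w : Fin 3 → ZMod q => ∑ i, (α i : ZMod q) * w i = 0)).card = Nat.card f.ker := by
      rw [Nat.card_eq_fintype_card, ← Fintype.card_coe]
      apply Fintype.card_congr
      exact Equiv.subtypeEquivRight (fun w => by simp [AddMonoidHom.mem_ker]; rfl)
    rw [h5]
    have : r * Nat.card f.ker = r * (q^2 * d) := by
      rw [mul_comm, h1]; calc q^3 = q^2 * q := by ring
        _ = q^2 * (r * d) := by rw [← hd]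
        _ = _ := by ring
    exact (Nat.eq_of_mul_eq_mul_left hr0 this).le

lemma energy_box (q s : ℕ) (hq : 0 < q) (hs : q ≤ s) (α : Fin 3 → ℤ) :
    q * ((Fintype.piFinset (fun _ : Fin 3 => Finset.range (2*s))).filter
      (fun w => (q:ℤ) ∣ ∑ i, α i * w i)).card
     ≤ ∑ d ∈ q.divisors.filter (fun d : ℕ => ∀ i, (d:ℤ) ∣ α i), 27 * s^3 * d := by
  classical
  have : NeZero q := ⟨hq.ne'⟩
  obtain ⟨d, hd, hda, hk⟩ := energy_ker q α
  set K := (Finset.univ.filter (fun w : Fin 3 → ZMod q => ∑ i, (α i : ZMod q) * w i = 0)) with hK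
  set L := 2*s/q+1 with hL
  have hLq : L * q ≤ 3 * s := by
    have := Nat.div_mul_le_self (2*s) q
    rw [hL]; nlinarith
  have h1 : ((Fintype.piFinset (fun _ : Fin 3 => Finset.range (2*s))).filter
      (fun w => (q:ℤ) ∣ ∑ i, α i * w i)).card ≤
      ((Fintype.piFinset (fun _ : Fin 3 => Finset.range L)) ×ˢ K).card := by
    apply Finset.card_le_card_of_injOn (fun w => (fun i => w i / q, fun i => (w i : ZMod q)))
    · intro w hw
      simp only [Finset.mem_coe, Finset.mem_filter, Fintype.mem_piFinset, Finset.mem_range] at hw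
      simp only [Finset.coe_product, Set.mem_prod, Finset.mem_coe, Fintype.mem_piFinset, Finset.mem_range, hK, Finset.mem_filter, Finset.mem_univ, true_and]
      constructor
      · intro i
        have := Nat.div_le_div_right (c := q) (hw.1 i).le
        omega
      · have := (ZMod.intCast_zmod_eq_zero_iff_dvd _ q).2 hw.2
        simpa using this
    · intro w _ w' _ h
      simp only [Prod.mk.injEq] at h
      funext i
      have e1 := congrFun h.1 i
      have e2 := congrFun h.2 i
      beta_reduce at e1 e2
      rw [ZMod.natCast_eq_natCast_iff] at e2
      have e3 : w i % q = w' i % q := e2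
      rw [← Nat.div_add_mod (w i) q, ← Nat.div_add_mod (w' i) q, e1, e3]
  rw [Finset.card_product] at h1
  simp only [Fintype.card_piFinset, Finset.card_range, Finset.prod_const, Finset.card_univ, Fintype.card_fin] at h1
  calc _ ≤ q * (L^3 * (q^2*d)) := by gcongr; exact h1.trans (by gcongr)
    _ = (L*q)^3 * d := by ring
    _ ≤ (3*s)^3 * d := by gcongr
    _ = 27 * s^3 * d := by ring
    _ ≤ _ := Finset.single_le_sum (f := fun d => 27 * s^3 * d) (fun _ _ => Nat.zero_le _) (by simp [Finset.mem_filter] at hd ⊢; exact ⟨hd, hda⟩)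

lemma sum_inv_sq_le (q : ℕ) (hq : 0 < q) : ∑ d ∈ q.divisors, (1:ℝ)/(d:ℝ)^2 ≤ 2 := by
  have h : ∀ n : ℕ, 0 < n → ∑ d ∈ Finset.Icc 1 n, (1:ℝ)/(d:ℝ)^2 ≤ 2 - 1/n := by
    intro n hn
    induction n, hn using Nat.le_induction with
    | base => norm_num
    | succ n hn ih =>
      rw [Finset.sum_Icc_succ_top (by omega)]
      have hn' : (0:ℝ) < n := by exact_mod_cast hn
      have : (1:ℝ)/((n+1:ℕ):ℝ)^2 ≤ 1/n - 1/((n+1:ℕ):ℝ) := by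
        push_cast
        rw [div_sub_div _ _ (by positivity) (by positivity), div_le_div_iff₀ (by positivity) (by positivity)]
        nlinarith
      linarith
  have h2 : q.divisors ⊆ Finset.Icc 1 q := by
    intro d hd
    have := Nat.divisor_le hd
    have := Nat.pos_of_mem_divisors hd
    simp; omega
  calc _ ≤ ∑ d ∈ Finset.Icc 1 q, (1:ℝ)/(d:ℝ)^2 := Finset.sum_le_sum_of_subset_of_nonneg h2 (fun _ _ _ => by positivity)
    _ ≤ 2 - 1/q := h q hq
    _ ≤ 2 := by have : (0:ℝ) ≤ 1/q := by positivity
                linarith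

lemma count_dvd (A q d : ℕ) (hA : 0 < A) (hd : d ∣ q) (hq : 0 < q) :
   ((Finset.Icc (-(q:ℤ)) q).filter (fun u => (d:ℤ) ∣ A * u)).card ≤ 3 * (A * (q / d)) := by
  obtain ⟨e, rfl⟩ := hd
  have hd0 : 0 < d := Nat.pos_of_mul_pos_right hq
  have he0 : 0 < e := Nat.pos_of_mul_pos_left hq
  rw [Nat.mul_div_cancel_left _ hd0]
  have : ((Finset.Icc (-((d*e:ℕ):ℤ)) (d*e:ℕ)).filter (fun u => (d:ℤ) ∣ A * u)).card ≤ (Finset.Icc (-((A*e:ℕ):ℤ)) (A*e:ℕ)).card := by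
    apply Finset.card_le_card_of_injOn (fun u : ℤ => (A:ℤ) * u / (d:ℤ))
    · intro u hu
      simp only [Finset.mem_coe, Finset.mem_filter, Finset.mem_Icc] at hu
      obtain ⟨⟨h1, h2⟩, k, hk⟩ := hu
      have hdz : (0:ℤ) < d := by exact_mod_cast hd0
      have hAz : (0:ℤ) < A := by exact_mod_cast hA
      simp only [hk]
      rw [Int.mul_ediv_cancel_left _ hdz.ne']
      simp only [Finset.coe_Icc, Set.mem_Icc]
      push_cast at *
      constructor
      · by_contra hc
        push Not at hc
        nlinarith
      · by_contra hc
        push Not at hc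
        nlinarith
    · intro u hu v hv h
      simp only [Finset.mem_coe, Finset.mem_filter, Finset.mem_Icc] at hu hv
      have hAz : (A:ℤ) ≠ 0 := by exact_mod_cast hA.ne'
      have := Int.ediv_left_inj hu.2 hv.2 |>.1 h
      exact mul_left_cancel₀ hAz this
  refine this.trans ?_
  rw [Int.card_Icc]
  have : 0 < A * e := by positivity
  omega

lemma energy_uw (a : Fin 3 → ℕ) (A : ℕ) (hA : 0 < A) (haA : ∀ i, a i ∣ A) (q s : ℕ) (hq : 0 < q) (hs : q ≤ s) :
   (((Fintype.piFinset (fun _ : Fin 3 => Finset.Icc (-(q:ℤ)) q)) ×ˢ (Fintype.piFinset (fun _ : Fin 3 => Finset.range (2*s)))).filter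
      (fun p => (q:ℤ) ∣ ∑ i, a i * p.1 i * p.2 i)).card ≤ 1458 * A^3 * s^3 * q^2 := by
  classical
  set X := (Fintype.piFinset (fun _ : Fin 3 => Finset.Icc (-(q:ℤ)) q)) with hX
  set Y := (Fintype.piFinset (fun _ : Fin 3 => Finset.range (2*s))) with hY
  have h1 : ((X ×ˢ Y).filter (fun p => (q:ℤ) ∣ ∑ i, a i * p.1 i * p.2 i)).card
     = ∑ u ∈ X, (Y.filter (fun w => (q:ℤ) ∣ ∑ i, (a i * u i) * w i)).card := by
    rw [Finset.card_filter, Finset.sum_product]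
    apply Finset.sum_congr rfl; intro u _; rw [Finset.card_filter]
  have h2 : q * ∑ u ∈ X, (Y.filter (fun w => (q:ℤ) ∣ ∑ i, (a i * u i) * w i)).card ≤
      ∑ d ∈ q.divisors, 27 * s^3 * d * (3 * (A * (q/d)))^3 := by
    rw [Finset.mul_sum]
    calc _ ≤ ∑ u ∈ X, ∑ d ∈ q.divisors.filter (fun d : ℕ => ∀ i, (d:ℤ) ∣ a i * u i), 27 * s^3 * d :=
          Finset.sum_le_sum (fun u _ => energy_box q s hq hs (fun i => a i * u i))
      _ = ∑ d ∈ q.divisors, ∑ u ∈ X.filter (fun u => ∀ i, (d:ℤ) ∣ a i * u i), 27 * s^3 * d := by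
          apply Finset.sum_comm'
          intro x y; simp only [Finset.mem_filter]; tauto
      _ ≤ _ := by
          apply Finset.sum_le_sum
          intro d hd
          rw [Finset.sum_const, smul_eq_mul, mul_comm]
          gcongr
          have : X.filter (fun u => ∀ i, (d:ℤ) ∣ a i * u i) ⊆ Fintype.piFinset (fun _ : Fin 3 => (Finset.Icc (-(q:ℤ)) q).filter (fun u => (d:ℤ) ∣ A * u)) := by
            intro u hu
            simp only [hX, Finset.mem_filter, Fintype.mem_piFinset] at hu ⊢
            intro i
            refine ⟨hu.1 i, (hu.2 i).trans ?_⟩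
            exact mul_dvd_mul_right (by exact_mod_cast haA i) _
          refine (Finset.card_le_card this).trans ?_
          rw [Fintype.card_piFinset]
          simp only [Finset.prod_const, Finset.card_univ, Fintype.card_fin]
          gcongr
          exact count_dvd A q d hA (Nat.dvd_of_mem_divisors hd) hq
  rw [h1]
  set S := ∑ u ∈ X, (Y.filter (fun w => (q:ℤ) ∣ ∑ i, (a i * u i) * w i)).card with hS
  have h3 : ((q * S : ℕ):ℝ) ≤ 1458 * A^3 * s^3 * q^3 := by
    calc ((q * S : ℕ):ℝ) ≤ ((∑ d ∈ q.divisors, 27 * s^3 * d * (3 * (A * (q/d)))^3 : ℕ):ℝ) := by exact_mod_cast h2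
      _ = ∑ d ∈ q.divisors, 729 * A^3 * s^3 * q^3 * (1/(d:ℝ)^2) := by
          push_cast
          apply Finset.sum_congr rfl
          intro d hd
          have hd0 : (d:ℝ) ≠ 0 := by exact_mod_cast (Nat.pos_of_mem_divisors hd).ne'
          rw [Nat.cast_div (Nat.dvd_of_mem_divisors hd) hd0]
          field_simp
          ring
      _ = 729 * A^3 * s^3 * q^3 * ∑ d ∈ q.divisors, (1/(d:ℝ)^2) := by rw [Finset.mul_sum]
      _ ≤ 729 * A^3 * s^3 * q^3 * 2 := by gcongr; exact sum_inv_sq_le q hq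
      _ = _ := by ring
  have h4 : q * S ≤ q * (1458 * A^3 * s^3 * q^2) := by
    have : q * S ≤ 1458 * A^3 * s^3 * q^3 := by exact_mod_cast h3
    calc _ ≤ _ := this
      _ = _ := by ring
  exact Nat.le_of_mul_le_mul_left h4 hq

lemma energy_part (a : Fin 4 → ℕ) (ha : ∀ i, 0 < a i) (s q : ℕ) (hq : 0 < q) (hs : q ≤ s) (i0 : Fin 4) :
  (((Fintype.piFinset (fun _ : Fin 4 => Finset.range s)) ×ˢ (Fintype.piFinset (fun _ : Fin 4 => Finset.range s))).filter
    (fun p : (Fin 4 → ℕ) × (Fin 4 → ℕ) => ∑ i, a i * (p.1 i)^2 = ∑ i, a i * (p.2 i)^2 ∧ |(p.1 i0:ℤ) - p.2 i0| = q ∧ ∀ i, |(p.1 i:ℤ) - p.2 i| ≤ q)).card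
   ≤ 2 * (1458 * (∏ i, a i)^3 * s^3 * q^2) := by
  classical
  have hA : 0 < ∏ i, a i := Finset.prod_pos (fun i _ => ha i)
  have h0 := energy_uw (fun i => a (i0.succAbove i)) (∏ i, a i) hA (fun i => Finset.dvd_prod_of_mem a (Finset.mem_univ _)) q s hq hs
  refine le_trans ?_ (Nat.mul_le_mul_left 2 h0)
  set Z := (((Fintype.piFinset (fun _ : Fin 3 => Finset.Icc (-(q:ℤ)) q)) ×ˢ (Fintype.piFinset (fun _ : Fin 3 => Finset.range (2*s)))).filter
      (fun p => (q:ℤ) ∣ ∑ i, (a (i0.succAbove i):ℤ) * p.1 i * p.2 i)) with hZ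
  have : 2 * Z.card = ((Finset.univ : Finset Bool) ×ˢ Z).card := by simp [Finset.card_product]
  rw [this]
  have key : ∀ p : (Fin 4 → ℕ) × (Fin 4 → ℕ), ∑ i, a i * (p.1 i)^2 = ∑ i, a i * (p.2 i)^2 →
     (a i0 : ℤ) * ((p.1 i0:ℤ) - p.2 i0) * ((p.1 i0:ℤ) + p.2 i0) + ∑ i, (a (i0.succAbove i):ℤ) * ((p.1 (i0.succAbove i):ℤ) - p.2 (i0.succAbove i)) * ((p.1 (i0.succAbove i)+p.2 (i0.succAbove i) : ℕ):ℤ) = 0 := by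
    intro p hp
    have e : ∑ i, ((a i:ℤ) * ((p.1 i:ℤ) - p.2 i) * ((p.1 i:ℤ) + p.2 i)) = 0 := by
      have : ((∑ i, a i * (p.1 i)^2 : ℕ):ℤ) = ((∑ i, a i * (p.2 i)^2 : ℕ):ℤ) := by rw [hp]
      push_cast at this
      rw [← sub_eq_zero, ← Finset.sum_sub_distrib] at this
      rw [← this]
      apply Finset.sum_congr rfl; intro i _; ring
    rw [Fin.sum_univ_succAbove _ i0] at e
    push_cast
    exact e
  apply Finset.card_le_card_of_injOn (fun p => (decide (p.1 i0 < p.2 i0), (fun i => (p.1 (i0.succAbove i):ℤ) - p.2 (i0.succAbove i), fun i => p.1 (i0.succAbove i) + p.2 (i0.succAbove i))))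
  · intro p hp
    simp only [Finset.mem_coe, Finset.mem_filter, Finset.mem_product, Fintype.mem_piFinset, Finset.mem_range] at hp
    simp only [hZ, Finset.mem_coe, Finset.mem_filter, Finset.mem_product, Fintype.mem_piFinset, Finset.mem_range, Finset.mem_univ, true_and, Finset.mem_Icc]
    obtain ⟨⟨h1, h2⟩, h3, h4, h5⟩ := hp
    refine ⟨⟨fun i => abs_le.1 (h5 _), fun i => ?_⟩, ?_⟩
    · have := h1 (i0.succAbove i); have := h2 (i0.succAbove i); omega
    · have e := key p h3
      have hd : (q:ℤ) ∣ (p.1 i0:ℤ) - p.2 i0 := by rw [← dvd_abs, h4]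
      have e2 : ∑ i, (a (i0.succAbove i):ℤ) * ((p.1 (i0.succAbove i):ℤ) - p.2 (i0.succAbove i)) * ((p.1 (i0.succAbove i)+p.2 (i0.succAbove i) : ℕ):ℤ)
        = ((p.1 i0:ℤ) - p.2 i0) * (-(a i0 : ℤ) * ((p.1 i0:ℤ) + p.2 i0)) := by linear_combination e
      rw [e2]
      exact Dvd.dvd.mul_right hd _
  · intro p hp p' hp' h
    simp only [Finset.mem_coe, Finset.mem_filter, Finset.mem_product, Fintype.mem_piFinset, Finset.mem_range] at hp hp'
    obtain ⟨-, h3, h4, h5⟩ := hp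
    obtain ⟨-, h3', h4', h5'⟩ := hp'
    simp only [Prod.mk.injEq, decide_eq_decide] at h
    obtain ⟨hb, hu, hw⟩ := h
    have hsame : ∀ i, p.1 (i0.succAbove i) = p'.1 (i0.succAbove i) ∧ p.2 (i0.succAbove i) = p'.2 (i0.succAbove i) := by
      intro i
      have e1 := congrFun hu i
      have e2 := congrFun hw i
      beta_reduce at e1 e2
      omega
    have hu0 : (p.1 i0:ℤ) - p.2 i0 = (p'.1 i0:ℤ) - p'.2 i0 := by
      rcases abs_cases ((p.1 i0:ℤ) - p.2 i0) with ⟨h, h'⟩ | ⟨h, h'⟩ <;>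
      rcases abs_cases ((p'.1 i0:ℤ) - p'.2 i0) with ⟨g, g'⟩ | ⟨g, g'⟩ <;> omega
    have hu1 : (p.1 i0:ℤ) - p.2 i0 ≠ 0 := by
      intro h; rw [h] at h4; simp at h4; omega
    have hw0 : (p.1 i0:ℤ) + p.2 i0 = (p'.1 i0:ℤ) + p'.2 i0 := by
      have e := key p h3
      have e' := key p' h3'
      simp only [hsame] at e
      rw [← hu0] at e'
      have h6 : (a i0 : ℤ) * ((p.1 i0:ℤ) - p.2 i0) ≠ 0 := mul_ne_zero (by exact_mod_cast (ha i0).ne') hu1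
      apply mul_left_cancel₀ h6
      linear_combination e - e'
    have h0 : p.1 i0 = p'.1 i0 ∧ p.2 i0 = p'.2 i0 := by omega
    have hall : ∀ j, p.1 j = p'.1 j ∧ p.2 j = p'.2 j := by
      intro j
      rcases Fin.eq_self_or_eq_succAbove i0 j with rfl | ⟨i, rfl⟩
      · exact h0
      · exact hsame i
    exact Prod.ext (funext fun j => (hall j).1) (funext fun j => (hall j).2)

lemma energy_total (a : Fin 4 → ℕ) (ha : ∀ i, 0 < a i) (s : ℕ) (hs : 0 < s) :
  (((Fintype.piFinset (fun _ : Fin 4 => Finset.range s)) ×ˢ (Fintype.piFinset (fun _ : Fin 4 => Finset.range s))).filter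
    (fun p : (Fin 4 → ℕ) × (Fin 4 → ℕ) => ∑ i, a i * (p.1 i)^2 = ∑ i, a i * (p.2 i)^2)).card
   ≤ (1 + 8 * (1458 * (∏ i, a i)^3)) * s^6 := by
  classical
  set X := Fintype.piFinset (fun _ : Fin 4 => Finset.range s) with hX
  let P : Fin 4 → ℕ → Finset ((Fin 4 → ℕ) × (Fin 4 → ℕ)) := fun i0 q => (X ×ˢ X).filter
    (fun p : (Fin 4 → ℕ) × (Fin 4 → ℕ) => ∑ i, a i * (p.1 i)^2 = ∑ i, a i * (p.2 i)^2 ∧ |(p.1 i0:ℤ) - p.2 i0| = q ∧ ∀ i, |(p.1 i:ℤ) - p.2 i| ≤ q)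
  have hsub : ((X ×ˢ X).filter
    (fun p : (Fin 4 → ℕ) × (Fin 4 → ℕ) => ∑ i, a i * (p.1 i)^2 = ∑ i, a i * (p.2 i)^2)) ⊆
     (X.image (fun x => (x,x))) ∪ ((Finset.univ : Finset (Fin 4)).biUnion fun i0 => (Finset.Icc 1 s).biUnion (fun q => P i0 q)) := by
    intro p hp
    simp only [Finset.mem_filter, Finset.mem_product] at hp
    obtain ⟨⟨h1, h2⟩, h3⟩ := hp
    obtain ⟨i0, -, hi0⟩ := Finset.exists_max_image (Finset.univ : Finset (Fin 4)) (fun i => |(p.1 i:ℤ) - p.2 i|) ⟨0, Finset.mem_univ _⟩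
    rw [Finset.mem_union]
    by_cases h0 : |(p.1 i0:ℤ) - p.2 i0| = 0
    · left
      rw [Finset.mem_image]
      refine ⟨p.1, h1, ?_⟩
      refine Prod.ext (x := (p.1, p.1)) (y := p) rfl ?_
      funext i
      have := hi0 i (Finset.mem_univ _)
      rw [h0] at this
      have := abs_nonpos_iff.1 this
      show p.1 i = p.2 i
      omega
    · right
      simp only [Finset.mem_biUnion, Finset.mem_univ, true_and, Finset.mem_Icc]
      refine ⟨i0, (|(p.1 i0:ℤ) - p.2 i0|).toNat, ?_, ?_⟩
      · have h4 := abs_nonneg ((p.1 i0:ℤ) - p.2 i0)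
        have e1 := Fintype.mem_piFinset.1 h1 i0
        have e2 := Fintype.mem_piFinset.1 h2 i0
        simp only [Finset.mem_range] at e1 e2
        have : |(p.1 i0:ℤ) - p.2 i0| ≤ s := by rw [abs_le]; omega
        omega
      · have h5 : (((|(p.1 i0:ℤ) - p.2 i0|).toNat : ℕ):ℤ) = |(p.1 i0:ℤ) - p.2 i0| := Int.toNat_of_nonneg (abs_nonneg _)
        simp only [P, Finset.mem_filter, Finset.mem_product]
        refine ⟨⟨h1, h2⟩, h3, h5.symm, fun i => ?_⟩
        rw [h5]; exact hi0 i (Finset.mem_univ _)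
  have hP : ∀ i0, ∀ q ∈ Finset.Icc 1 s, (P i0 q).card ≤ 2 * (1458 * (∏ i, a i)^3 * s^5) := by
    intro i0 q hq
    rw [Finset.mem_Icc] at hq
    refine (energy_part a ha s q (by omega) hq.2 i0).trans ?_
    have : q^2 ≤ s^2 := Nat.pow_le_pow_left hq.2 2
    calc _ ≤ 2 * (1458 * (∏ i, a i)^3 * s^3 * s^2) := by gcongr
      _ = _ := by ring
  have hXc : X.card = s^4 := by simp [hX]
  calc _ ≤ _ := Finset.card_le_card hsub
    _ ≤ _ := Finset.card_union_le _ _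
    _ ≤ s^4 + ∑ i0 : Fin 4, ∑ q ∈ Finset.Icc 1 s, 2 * (1458 * (∏ i, a i)^3 * s^5) := by
        gcongr
        · rw [← hXc]; exact Finset.card_image_le
        · refine Finset.card_biUnion_le.trans (Finset.sum_le_sum fun i0 _ => ?_)
          exact Finset.card_biUnion_le.trans (Finset.sum_le_sum fun q hq => hP i0 q hq)
    _ = s^4 + 8 * (1458 * (∏ i, a i)^3) * s^6 := by
        simp; ring
    _ ≤ _ := by
        have : s^4 ≤ s^6 := Nat.pow_le_pow_right hs (by norm_num)
        nlinarith

/-- values of the diagonal form -/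
def vals (a : ℕ → ℕ) (I : Finset ℕ) : Set ℕ := {n | ∃ x : ℕ → ℕ, n = ∑ i ∈ I, a i * (x i)^2}

open Classical in
lemma dens4 (a : Fin 4 → ℕ) (ha : ∀ i, 0 < a i) : ∃ C : ℕ, 0 < C ∧ ∀ N : ℕ,
    N ≤ C * ((Finset.range N).filter (fun n => ∃ x : Fin 4 → ℕ, n = ∑ i, a i * (x i)^2)).card := by
  set K := 1 + 8 * (1458 * (∏ i, a i)^3) with hK
  set σ := ∑ i, a i with hσ
  have hσ0 : 0 < σ := Finset.sum_pos (fun i _ => ha i) ⟨0, Finset.mem_univ _⟩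
  refine ⟨K * (4 * σ), by positivity, ?_⟩
  intro N
  rcases Nat.eq_zero_or_pos N with rfl | hN
  · simp
  set W := ((Finset.range N).filter (fun n => ∃ x : Fin 4 → ℕ, n = ∑ i, a i * (x i)^2)) with hW
  set s := Nat.sqrt ((N-1)/σ) + 1 with hs
  have hs1 : σ * (s-1)^2 ≤ N - 1 := by
    have h1 : Nat.sqrt ((N-1)/σ)^2 ≤ (N-1)/σ := by rw [sq]; exact Nat.sqrt_le _
    have h2 := Nat.mul_div_le (N-1) σ
    calc _ ≤ σ * ((N-1)/σ) := by gcongr; simpa [hs] using h1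
      _ ≤ _ := h2
  have hs2 : N ≤ 4 * σ * s^2 := by
    have h1 : (N-1)/σ < s^2 := by rw [hs, sq]; exact Nat.lt_succ_sqrt _
    have h2 := Nat.lt_mul_div_succ (N-1) hσ0
    have h3 : σ * ((N-1)/σ + 1) ≤ σ * s^2 := by gcongr; omega
    have h4 : N - 1 < σ * s^2 := lt_of_lt_of_le h2 h3
    have h5 : σ * s^2 ≤ 4 * σ * s^2 := by nlinarith [Nat.zero_le (σ * s^2)]
    omega
  set X := Fintype.piFinset (fun _ : Fin 4 => Finset.range s) with hX
  have hXc : X.card = s^4 := by simp [hX]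
  let φ : (Fin 4 → ℕ) → ℕ := fun x => ∑ i, a i * (x i)^2
  have hmap : ∀ x ∈ X, φ x ∈ W := by
    intro x hx
    rw [hW, Finset.mem_filter, Finset.mem_range]
    refine ⟨?_, x, rfl⟩
    have : φ x ≤ σ * (s-1)^2 := by
      rw [hσ, Finset.sum_mul]
      apply Finset.sum_le_sum
      intro i _
      have := Finset.mem_range.1 (Fintype.mem_piFinset.1 hx i)
      gcongr
      omega
    omega
  have hE := energy_total a ha s (by omega)
  rw [← hX] at hE
  have h1 : X.card = ∑ n ∈ W, (X.filter (fun x => φ x = n)).card := Finset.card_eq_sum_card_fiberwise hmap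
  have h2 : ((X ×ˢ X).filter (fun p : (Fin 4 → ℕ) × (Fin 4 → ℕ) => φ p.1 = φ p.2)).card = ∑ n ∈ W, (X.filter (fun x => φ x = n)).card^2 := by
    rw [Finset.card_eq_sum_card_fiberwise (f := fun p => φ p.1) (t := W)]
    · apply Finset.sum_congr rfl
      intro n _
      rw [sq, ← Finset.card_product]
      congr 1
      ext p
      simp only [Finset.mem_filter, Finset.mem_product]
      constructor
      · rintro ⟨⟨⟨h1, h2⟩, h3⟩, h4⟩; exact ⟨⟨h1, h4⟩, h2, by rw [← h3, h4]⟩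
      · rintro ⟨⟨h1, h4⟩, h2, h3⟩; exact ⟨⟨⟨h1, h2⟩, by rw [h3, h4]⟩, h4⟩
    · intro p hp
      simp only [Finset.mem_coe, Finset.mem_filter, Finset.mem_product] at hp
      exact hmap _ hp.1.1
  have h3 : X.card^2 ≤ W.card * ∑ n ∈ W, (X.filter (fun x => φ x = n)).card^2 := by
    rw [h1]; exact sq_sum_le_card_mul_sum_sq
  rw [← h2, hXc] at h3
  have h4 : (s^4)^2 ≤ W.card * (K * s^6) := h3.trans (Nat.mul_le_mul_left _ hE)
  have h5 : s^2 * s^6 ≤ (K * W.card) * s^6 := by nlinarith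
  have h6 : s^2 ≤ K * W.card := Nat.le_of_mul_le_mul_right h5 (by positivity)
  calc N ≤ 4 * σ * s^2 := hs2
    _ ≤ 4 * σ * (K * W.card) := by gcongr
    _ = _ := by ring

open Classical in
/-- number of elements of `T` below `N` leaving `T` after a shift by `v`. -/
noncomputable def upc (T : Set ℕ) (N v : ℕ) : ℕ :=
  ((Finset.range N).filter (fun t => t ∈ T ∧ t + v < N ∧ t + v ∉ T)).card

open Classical in
lemma upc_add (T : Set ℕ) (N v w : ℕ) : upc T N (v + w) ≤ upc T N v + upc T N w := by
  unfold upc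
  have : ((Finset.range N).filter (fun t => t ∈ T ∧ t + (v+w) < N ∧ t + (v+w) ∉ T)) ⊆
    ((Finset.range N).filter (fun t => t ∈ T ∧ t + v < N ∧ t + v ∉ T)) ∪
    ((Finset.range N).filter (fun t => t + v < N ∧ t + v ∈ T ∧ t + v + w < N ∧ t + v + w ∉ T)) := by
    intro t ht
    simp only [Finset.mem_filter, Finset.mem_range, Finset.mem_union] at ht ⊢
    obtain ⟨h1, h2, h3, h4⟩ := ht
    by_cases h : t + v ∈ T
    · right; refine ⟨h1, by omega, h, by omega, by rwa [add_assoc]⟩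
    · left; exact ⟨h1, h2, by omega, h⟩
  refine (Finset.card_le_card this).trans ((Finset.card_union_le _ _).trans ?_)
  refine Nat.add_le_add_left ?_ _
  apply Finset.card_le_card_of_injOn (fun t => t + v)
  · intro t ht; simp only [Finset.mem_coe, Finset.mem_filter, Finset.mem_range] at ht ⊢; tauto
  · intro x _ y _ h; simpa using h

open Classical in
lemma upc_sub (T : Set ℕ) (N v w : ℕ) (h : w ≤ v) : upc T N (v - w) ≤ upc T N v + upc T N w + 2 * w := by
  -- the down count
  have hdown : ((Finset.range N).filter (fun t => t + w < N ∧ t ∉ T ∧ t + w ∈ T)).card ≤ upc T N w + w := by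
    unfold upc
    set A := (Finset.range (N-w)).filter (fun t => t ∈ T) with hA
    set B := (Finset.range (N-w)).filter (fun t => t + w ∈ T) with hB
    have h1 : ((Finset.range N).filter (fun t => t + w < N ∧ t ∉ T ∧ t + w ∈ T)) = B \ A := by
      ext t; simp only [hA, hB, Finset.mem_filter, Finset.mem_range, Finset.mem_sdiff]
      constructor
      · rintro ⟨_, h2, h3, h4⟩; exact ⟨⟨by omega, h4⟩, fun h => h3 h.2⟩
      · rintro ⟨⟨h1, h2⟩, h3⟩; exact ⟨by omega, by omega, fun h => h3 ⟨h1, h⟩, h2⟩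
    have h2 : ((Finset.range N).filter (fun t => t ∈ T ∧ t + w < N ∧ t + w ∉ T)) = A \ B := by
      ext t; simp only [hA, hB, Finset.mem_filter, Finset.mem_range, Finset.mem_sdiff]
      constructor
      · rintro ⟨_, h2, h3, h4⟩; exact ⟨⟨by omega, h2⟩, fun h => h4 h.2⟩
      · rintro ⟨⟨h1, h2⟩, h3⟩; exact ⟨by omega, h2, by omega, fun h => h3 ⟨h1, h⟩⟩
    rw [h1, h2]
    have h3 : B.card ≤ A.card + w := by
      have : B.image (fun t => t + w) ⊆ A ∪ Finset.Ico (N - w) N := by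
        intro t ht
        simp only [hA, hB, Finset.mem_image, Finset.mem_filter, Finset.mem_range, Finset.mem_union, Finset.mem_Ico] at ht ⊢
        obtain ⟨s, ⟨h1, h2⟩, rfl⟩ := ht
        by_cases h5 : s + w < N - w
        · left; exact ⟨h5, h2⟩
        · right; omega
      have h4 := (Finset.card_le_card this).trans (Finset.card_union_le _ _)
      rw [Finset.card_image_of_injective _ (fun a b h => by simpa using h), Nat.card_Ico] at h4
      omega
    have h5 := Finset.card_sdiff_add_card_inter B A
    have h6 := Finset.card_sdiff_add_card_inter A B
    rw [Finset.inter_comm] at h6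
    omega
  have hsub : ((Finset.range N).filter (fun t => t ∈ T ∧ t + (v-w) < N ∧ t + (v-w) ∉ T)) ⊆
     (((Finset.range N).filter (fun t => t ∈ T ∧ t + v < N ∧ t + v ∉ T)) ∪
      ((Finset.range N).filter (fun t => t + (v-w) < N ∧ t + (v-w) + w < N ∧ t + (v-w) ∉ T ∧ t + (v-w) + w ∈ T))) ∪
      Finset.Ico (N - v) (N - (v - w)) := by
    intro t ht
    simp only [Finset.mem_filter, Finset.mem_range, Finset.mem_union, Finset.mem_Ico] at ht ⊢
    obtain ⟨h1, h2, h3, h4⟩ := ht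
    by_cases h5 : t + v < N
    · left
      by_cases h6 : t + v ∈ T
      · right
        refine ⟨h1, h3, by omega, h4, ?_⟩
        have : t + (v - w) + w = t + v := by omega
        rwa [this]
      · left; exact ⟨h1, h2, h5, h6⟩
    · right; omega
  have hpre : ((Finset.range N).filter (fun t => t + (v-w) < N ∧ t + (v-w) + w < N ∧ t + (v-w) ∉ T ∧ t + (v-w) + w ∈ T)).card ≤ upc T N w + w := by
    refine le_trans ?_ hdown
    apply Finset.card_le_card_of_injOn (fun t => t + (v-w))
    · intro t ht; simp only [Finset.mem_coe, Finset.mem_filter, Finset.mem_range] at ht ⊢; tauto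
    · intro x _ y _ h; simpa using h
  have := (Finset.card_le_card hsub).trans ((Finset.card_union_le _ _).trans (Nat.add_le_add_right (Finset.card_union_le _ _) _))
  rw [Nat.card_Ico] at this
  unfold upc at *
  omega

open Classical in
lemma upc_mul (T : Set ℕ) (N a e : ℕ) (he : ∀ x, upc T N (a * x^2) ≤ e) (m : ℕ) (hm : m ≤ N) :
    upc T N (a * m) ≤ 5 * e + 8 * a * Nat.sqrt N := by
  have hr : ∀ r, upc T N (a * r) ≤ 3 * e + a * r^2 := by
    intro r
    have hodd : ∀ z, upc T N (a * (2*z+1)) ≤ 2 * e + 2 * (a * z^2) := by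
      intro z
      have := upc_sub T N (a * (z+1)^2) (a * z^2) (by gcongr; omega)
      have h2 : a * (z+1)^2 - a * z^2 = a * (2*z+1) := by
        rw [← Nat.mul_sub]; congr 1
        have : (z+1)^2 = z^2 + (2*z+1) := by ring
        omega
      rw [h2] at this
      have := he (z+1); have := he z
      omega
    have h0 : upc T N 0 = 0 := by
      unfold upc; rw [Finset.card_eq_zero, Finset.filter_eq_empty_iff]
      intro t _; simp; tauto
    rcases Nat.even_or_odd' r with ⟨k, rfl | rfl⟩
    · rcases k with _ | k
      · simp [h0]
      · have h1 : a * (2*(k+1)) = a * (2*k+1) + a * 1^2 := by ring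
        rw [h1]
        refine (upc_add _ _ _ _).trans ?_
        have := hodd k; have := he 1
        have : 2 * (a * k^2) ≤ a * (2*(k+1))^2 := by nlinarith [Nat.zero_le (a*k^2), Nat.zero_le (a*k)]
        omega
    · have := hodd k
      have : 2 * (a * k^2) ≤ a * (2*k+1)^2 := by nlinarith [Nat.zero_le (a*k^2), Nat.zero_le (a*k)]
      omega
  set x := Nat.sqrt m
  set m1 := m - x^2 with hm1
  have hx1 : x^2 ≤ m := by rw [sq]; exact Nat.sqrt_le m
  have hx2 : m < (x+1)^2 := by rw [sq]; exact Nat.lt_succ_sqrt m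
  set y := Nat.sqrt m1
  have hy1 : y^2 ≤ m1 := by rw [sq]; exact Nat.sqrt_le m1
  have hy2 : m1 < (y+1)^2 := by rw [sq]; exact Nat.lt_succ_sqrt m1
  set r := m1 - y^2 with hrr
  have e1 : a * m = a * x^2 + (a * y^2 + a * r) := by
    rw [← mul_add, ← mul_add]; congr 1; omega
  rw [e1]
  have h1 := upc_add T N (a*x^2) (a*y^2 + a*r)
  have h2 := upc_add T N (a*y^2) (a*r)
  have h3 := hr r
  have h4 := he x
  have h5 := he y
  have h6 : r ≤ 2 * y := by
    have : (y+1)^2 = y^2 + 2*y + 1 := by ring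
    omega
  have h7 : m1 ≤ 2 * x := by
    have : (x+1)^2 = x^2 + 2*x + 1 := by ring
    omega
  have h8 : x ≤ Nat.sqrt N := Nat.sqrt_le_sqrt hm
  have h9 : r^2 ≤ 8 * Nat.sqrt N := by
    have : r^2 ≤ (2*y)^2 := Nat.pow_le_pow_left h6 2
    nlinarith
  have h10 : a * r^2 ≤ 8 * a * Nat.sqrt N := by nlinarith
  omega

open Classical in
lemma card_class (a c M : ℕ) : ((Finset.range M).filter (fun z => z % a = c)).card ≤ M / a + 1 := by
  rw [← Finset.card_range (M/a+1)]
  apply Finset.card_le_card_of_injOn (fun z => z / a)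
  · intro z hz
    simp only [Finset.mem_coe, Finset.mem_filter, Finset.mem_range] at hz ⊢
    have := Nat.div_le_div_right (c := a) hz.1.le
    omega
  · intro z hz w hw h
    simp only [Finset.mem_coe, Finset.mem_filter, Finset.mem_range] at hz hw
    beta_reduce at h
    rw [← Nat.div_add_mod z a, ← Nat.div_add_mod w a, h, hz.2, hw.2]

open Classical in
lemma near_full (T : Set ℕ) (N a e C : ℕ) (ha : 0 < a) (hC : 0 < C)
    (he : ∀ x, upc T N (a * x^2) ≤ e)
    (hd : N/8 ≤ C * ((Finset.range (N/8)).filter (fun t => t ∈ T)).card)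
    (heN : 5120 * C * e ≤ N) (hN : (8193 * a * C)^2 ≤ N) :
    ∃ c < a, 4 * a * ((Finset.range N).filter (fun z => z % a = c ∧ z ∉ T)).card ≤ N := by
  by_contra hcon
  push Not at hcon
  set M := N/8 with hM
  set TM := (Finset.range M).filter (fun t => t ∈ T) with hTM
  let Z : ℕ → Finset ℕ := fun t => (Finset.range N).filter (fun z => M ≤ z ∧ z % a = t % a ∧ z ∉ T)
  have hZ : ∀ t, N ≤ 8 * a * (Z t).card + 8 * a := by
    intro t
    have h1 := hcon (t % a) (Nat.mod_lt _ ha)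
    have h2 : (Finset.range N).filter (fun z => z % a = t % a ∧ z ∉ T) ⊆ Z t ∪ (Finset.range M).filter (fun z => z % a = t % a) := by
      intro z hz
      simp only [Z, Finset.mem_filter, Finset.mem_range, Finset.mem_union] at hz ⊢
      by_cases h : M ≤ z
      · left; tauto
      · right; exact ⟨by omega, hz.2.1⟩
    have h3 := (Finset.card_le_card h2).trans (Finset.card_union_le _ _)
    have h4 := card_class a (t % a) M
    have h5 : ((Finset.range N).filter (fun z => z % a = t % a ∧ z ∉ T)).card ≤ (Z t).card + (M/a+1) := by omega
    have h6 : a * (M/a) ≤ M := Nat.mul_div_le M a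
    have h7 : 4 * a * ((Finset.range N).filter (fun z => z % a = t % a ∧ z ∉ T)).card ≤ 4 * a * ((Z t).card + (M/a+1)) := by gcongr
    have h8 : 8 * M ≤ N := Nat.mul_div_le N 8
    nlinarith
  have hpairs : ∑ t ∈ TM, (Z t).card ≤ ∑ m ∈ Finset.range (N/a+1), upc T N (a*m) := by
    unfold upc
    rw [← Finset.card_sigma, ← Finset.card_sigma]
    apply Finset.card_le_card_of_injOn (fun p : (_ : ℕ) × ℕ => (⟨(p.2 - p.1)/a, p.1⟩ : (_ : ℕ) × ℕ))
    · rintro ⟨t, z⟩ h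
      simp only [Z, hTM, Finset.mem_coe, Finset.mem_sigma, Finset.mem_filter, Finset.mem_range] at h ⊢
      obtain ⟨⟨h1, h2⟩, h3, h4, h5, h6⟩ := h
      have h7 : a * ((z - t)/a) = z - t := Nat.mul_div_cancel' ((Nat.modEq_iff_dvd' (by omega)).1 h5.symm)
      have h8 : (z-t)/a ≤ N/a := Nat.div_le_div_right (by omega)
      have h9 : t + (z - t) = z := by omega
      rw [h7, h9]
      exact ⟨by omega, by omega, h2, h3, h6⟩
    · rintro ⟨t, z⟩ h ⟨t', z'⟩ h' heq
      simp only [Z, hTM, Finset.mem_coe, Finset.mem_sigma, Finset.mem_filter, Finset.mem_range] at h h'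
      obtain ⟨⟨h1, h2⟩, h3, h4, h5, h6⟩ := h
      obtain ⟨⟨h1', h2'⟩, h3', h4', h5', h6'⟩ := h'
      have h7 : a * ((z - t)/a) = z - t := Nat.mul_div_cancel' ((Nat.modEq_iff_dvd' (by omega)).1 h5.symm)
      have h7' : a * ((z' - t')/a) = z' - t' := Nat.mul_div_cancel' ((Nat.modEq_iff_dvd' (by omega)).1 h5'.symm)
      simp only [Sigma.mk.injEq, heq_eq_eq] at heq ⊢
      obtain ⟨e1, e2⟩ := heq
      rw [e1] at h7
      subst e2
      exact ⟨rfl, by omega⟩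
  set s := Nat.sqrt N with hs
  have hub : ∑ m ∈ Finset.range (N/a+1), upc T N (a*m) ≤ (N/a+1) * (5*e + 8*a*s) := by
    calc _ ≤ ∑ m ∈ Finset.range (N/a+1), (5*e + 8*a*s) := by
          apply Finset.sum_le_sum
          intro m hm
          apply upc_mul T N a e he
          rw [Finset.mem_range] at hm
          have := Nat.div_le_self N a
          omega
      _ = _ := by simp
  have hss : s * s ≤ N := Nat.sqrt_le N
  have hsb : 8193 * a * C ≤ s := by rw [hs, Nat.le_sqrt, ← sq]; exact hN
  have haC : a ≤ a * C := Nat.le_mul_of_pos_right _ hC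
  have haN : 8193 * a ≤ N := by nlinarith
  have h1 : TM.card * (N - 8*a) ≤ 8 * a * ((N/a+1) * (5*e + 8*a*s)) := by
    calc TM.card * (N - 8*a) = ∑ t ∈ TM, (N - 8 * a) := by simp
      _ ≤ ∑ t ∈ TM, 8 * a * (Z t).card := Finset.sum_le_sum (fun t _ => by have := hZ t; omega)
      _ = 8 * a * ∑ t ∈ TM, (Z t).card := by rw [Finset.mul_sum]
      _ ≤ _ := Nat.mul_le_mul_left _ (hpairs.trans hub)
  have h2 : a * (N/a+1) ≤ 2 * N := by
    have := Nat.mul_div_le N a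
    nlinarith
  have h3 : TM.card * (N - 8*a) ≤ 16 * N * (5*e+8*a*s) := by
    calc _ ≤ _ := h1
      _ = 8 * (a * (N/a+1)) * (5*e+8*a*s) := by ring
      _ ≤ 8 * (2 * N) * (5*e+8*a*s) := by gcongr
      _ = _ := by ring
  have h4 : M * (N - 8*a) ≤ C * (16 * N * (5*e+8*a*s)) := by
    calc _ ≤ C * TM.card * (N - 8*a) := by gcongr
      _ = C * (TM.card * (N - 8*a)) := by ring
      _ ≤ _ := by gcongr
  have h5 : N ≤ 16 * M := by omega
  have h6 : N ≤ 2 * (N - 8 * a) := by omega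
  have h7 : N * N ≤ 32 * (C * (16 * N * (5*e+8*a*s))) := by
    calc N * N ≤ (16*M) * (2 * (N - 8*a)) := Nat.mul_le_mul h5 h6
      _ = 32 * (M * (N - 8 * a)) := by ring
      _ ≤ _ := by gcongr
  have hN0 : 0 < N := by omega
  have h8 : N ≤ 512 * C * (5*e+8*a*s) := by
    have : N * N ≤ N * (512 * C * (5*e+8*a*s)) := by
      calc _ ≤ _ := h7
        _ = _ := by ring
    exact Nat.le_of_mul_le_mul_left this hN0
  -- 2560 C e ≤ N/2 ; 4096 a C s < N/2
  have h9 : 8193 * a * C * s ≤ N := by nlinarith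
  have h10 : 0 < a * C * s := by
    have : 0 < s := lt_of_lt_of_le (by positivity) hsb
    positivity
  nlinarith

lemma binary_prime (p : ℕ) (hp : p.Prime) (hp2 : p ≠ 2) (u1 u2 c : ℤ) (h1 : ¬ (p:ℤ) ∣ u1) (h2 : ¬ (p:ℤ) ∣ u2) :
    ∃ x y : ℤ, (p:ℤ) ∣ u1 * x^2 + u2 * y^2 - c := by
  have : Fact p.Prime := ⟨hp⟩
  have e1 : (u1 : ZMod p) ≠ 0 := by rwa [Ne, ZMod.intCast_zmod_eq_zero_iff_dvd]
  have e2 : (u2 : ZMod p) ≠ 0 := by rwa [Ne, ZMod.intCast_zmod_eq_zero_iff_dvd]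
  obtain ⟨x, y, h⟩ := FiniteField.exists_root_sum_quadratic
    (f := Polynomial.C (u1 : ZMod p) * Polynomial.X^2 + Polynomial.C 0 * Polynomial.X + Polynomial.C 0)
    (g := Polynomial.C (u2 : ZMod p) * Polynomial.X^2 + Polynomial.C 0 * Polynomial.X + Polynomial.C (-(c : ZMod p)))
    (Polynomial.degree_quadratic e1) (Polynomial.degree_quadratic e2)
    (by rw [ZMod.card]; exact (hp.eq_two_or_odd).resolve_left hp2)
  obtain ⟨x', rfl⟩ := ZMod.intCast_surjective x
  obtain ⟨y', rfl⟩ := ZMod.intCast_surjective y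
  refine ⟨x', y', ?_⟩
  rw [← ZMod.intCast_zmod_eq_zero_iff_dvd]
  simp at h
  push_cast
  linear_combination h

lemma binary_primes (P : Finset ℕ) (hP : ∀ p ∈ P, p.Prime ∧ p ≠ 2) (u1 u2 c : ℤ) (h1 : ∀ p ∈ P, ¬ (p:ℤ) ∣ u1)
    (h2 : ∀ p ∈ P, ¬ (p:ℤ) ∣ u2) :
    ∃ x y : ℤ, ∀ p ∈ P, (p:ℤ) ∣ u1 * x^2 + u2 * y^2 - c := by
  classical
  induction P using Finset.induction_on with
  | empty => exact ⟨0, 0, by simp⟩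
  | insert p P hpP ih =>
    obtain ⟨x, y, hxy⟩ := ih (fun q hq => hP q (Finset.mem_insert_of_mem hq)) (fun q hq => h1 q (Finset.mem_insert_of_mem hq)) (fun q hq => h2 q (Finset.mem_insert_of_mem hq))
    have hp := hP p (Finset.mem_insert_self _ _)
    obtain ⟨x', y', hx'⟩ := binary_prime p hp.1 hp.2 u1 u2 c (h1 p (Finset.mem_insert_self _ _)) (h2 p (Finset.mem_insert_self _ _))
    have hcop : Nat.Coprime (∏ q ∈ P, q) p := by
      rw [Nat.coprime_prod_left_iff]
      intro q hq
      rw [Nat.coprime_primes (hP q (Finset.mem_insert_of_mem hq)).1 hp.1]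
      rintro rfl; exact hpP hq
    obtain ⟨b, b', hb⟩ : ∃ b b' : ℤ, b * (∏ q ∈ P, q : ℕ) + b' * p = 1 := by
      have := (Nat.isCoprime_iff_coprime.2 hcop)
      exact this
    set m : ℤ := ((∏ q ∈ P, q : ℕ) : ℤ) with hm
    refine ⟨x + b * m * (x' - x), y + b * m * (y' - y), ?_⟩
    intro q hq
    rcases Finset.mem_insert.1 hq with rfl | hq'
    · obtain ⟨k, hk⟩ := hx'
      have hbm : b * m = 1 - b' * q := by linarith
      rw [hbm]
      refine ⟨k + u1 * (-2 * x' * b' * (x'-x) + b'^2 * q * (x'-x)^2) + u2 * (-2 * y' * b' * (y'-y) + b'^2 * q * (y'-y)^2), ?_⟩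
      linear_combination hk
    · obtain ⟨k, hk⟩ := hxy q hq'
      obtain ⟨l, hl⟩ : (q:ℤ) ∣ m := by rw [hm]; exact_mod_cast Finset.dvd_prod_of_mem _ hq'
      rw [hl]
      refine ⟨k + u1 * (2 * x * b * l * (x'-x) + b^2 * l^2 * q * (x'-x)^2) + u2 * (2 * y * b * l * (y'-y) + b^2 * l^2 * q * (y'-y)^2), ?_⟩
      linear_combination hk

lemma pow_one_mod (D : ℕ) (a : ℤ) (h : ∀ p : ℕ, p.Prime → p ∣ D → (p:ℤ) ∣ a - 1) : (D:ℤ) ∣ a^D - 1 := by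
  have : D ∣ (a^D-1).natAbs := by
    rw [Nat.dvd_iff_prime_pow_dvd_dvd]
    intro p k hp hk
    rcases k with _ | k
    · simp
    rw [← Int.natCast_dvd]
    have h1 := dvd_sub_pow_of_dvd_sub (p := p) (h p hp ((dvd_pow_self p (by omega)).trans hk)) k
    have h2 : p^k ∣ D := (pow_dvd_pow p (by omega)).trans hk
    obtain ⟨m, hm⟩ := h2
    rw [hm, pow_mul]
    push_cast
    refine h1.trans ?_
    have := sub_dvd_pow_sub_pow (a^(p^k)) 1 m
    simpa using this
  exact Int.natCast_dvd.2 this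

lemma ternary (D : ℕ) (hD0 : 0 < D) (hD : Odd D) (u1 u2 u3 c : ℤ) (h1 : IsCoprime u1 D) (h2 : IsCoprime u2 D) (h3 : IsCoprime u3 D) :
    ∃ x y z : ℤ, (D:ℤ) ∣ u1 * x^2 + u2 * y^2 + u3 * z^2 - c := by
  have hcop : ∀ u : ℤ, IsCoprime u D → ∀ p ∈ D.primeFactors, ¬ (p:ℤ) ∣ u := by
    intro u hu p hp hpu
    have hpp := Nat.prime_of_mem_primeFactors hp
    have : IsUnit (p:ℤ) := hu.isUnit_of_dvd' hpu (by exact_mod_cast Nat.dvd_of_mem_primeFactors hp)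
    have := Int.isUnit_iff.1 this
    have := hpp.two_le
    omega
  obtain ⟨x, y, hxy⟩ := binary_primes D.primeFactors (by
      intro p hp
      refine ⟨Nat.prime_of_mem_primeFactors hp, ?_⟩
      rintro rfl
      have := Nat.dvd_of_mem_primeFactors hp
      have := Nat.odd_iff.1 hD
      omega) u1 u2 (c - u3) (hcop _ h1) (hcop _ h2)
  obtain ⟨w, w', hw⟩ := h3
  set a := (c - u1 * x^2 - u2 * y^2) * w with ha
  have h4 := pow_one_mod D a (by
    intro p hp hpD
    obtain ⟨k, hk⟩ := hxy p (Nat.mem_primeFactors.2 ⟨hp, hpD, hD0.ne'⟩)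
    obtain ⟨l, hl⟩ : (p:ℤ) ∣ D := by exact_mod_cast hpD
    refine ⟨-k * w - w' * l, ?_⟩
    rw [ha]
    rw [hl] at hw
    linear_combination -w * hk + hw)
  obtain ⟨k, hk⟩ := hD
  refine ⟨x, y, a^(k+1), ?_⟩
  obtain ⟨l, hl⟩ := h4
  refine ⟨-w' * (c - u1 * x^2 - u2 * y^2) + u3 * a * l, ?_⟩
  have e : (a^(k+1))^2 = a * a^D := by rw [← pow_mul, ← pow_succ']; congr 1; omega
  rw [e]
  have e2 : a^D = 1 + D * l := by linarith
  rw [e2]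
  have e3 : u3 * a = (c - u1 * x^2 - u2 * y^2) - (c - u1 * x^2 - u2 * y^2) * w' * D := by
    rw [ha]; linear_combination (c - u1 * x^2 - u2 * y^2) * hw
  linear_combination e3

lemma vals_mono (a : ℕ → ℕ) {I J : Finset ℕ} (h : I ⊆ J) : vals a I ⊆ vals a J := by
  classical
  rintro n ⟨x, rfl⟩
  refine ⟨fun i => if i ∈ I then x i else 0, ?_⟩
  rw [← Finset.sum_subset h]
  · apply Finset.sum_congr rfl; intro i hi; simp [hi]
  · intro i _ hi; simp [hi]

lemma vals_add (a : ℕ → ℕ) {I J : Finset ℕ} (h : Disjoint I J) {m n : ℕ} (hm : m ∈ vals a I) (hn : n ∈ vals a J) :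
    m + n ∈ vals a (I ∪ J) := by
  classical
  obtain ⟨x, rfl⟩ := hm
  obtain ⟨y, rfl⟩ := hn
  refine ⟨fun i => if i ∈ I then x i else y i, ?_⟩
  rw [Finset.sum_union h]
  congr 1
  · apply Finset.sum_congr rfl; intro i hi; simp [hi]
  · apply Finset.sum_congr rfl; intro i hi
    simp [Finset.disjoint_right.1 h hi]

lemma vals_zero (a : ℕ → ℕ) (I : Finset ℕ) : 0 ∈ vals a I := ⟨0, by simp⟩

lemma vals_red (a : ℕ → ℕ) (I : Finset ℕ) (A n : ℕ) (hA : 0 < A) (hn : n ∈ vals a I) :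
    ∃ m ∈ vals a I, m % A = n % A ∧ m ≤ A^2 * ∑ i ∈ I, a i := by
  obtain ⟨x, rfl⟩ := hn
  refine ⟨∑ i ∈ I, a i * (x i % A)^2, ⟨fun i => x i % A, rfl⟩, ?_, ?_⟩
  · rw [Finset.sum_nat_mod, Finset.sum_nat_mod I A (fun i => a i * (x i)^2)]
    congr 1
    apply Finset.sum_congr rfl
    intro i _
    exact Nat.ModEq.mul_left _ (Nat.ModEq.pow 2 (Nat.mod_modEq _ _))
  · rw [Finset.mul_sum]
    apply Finset.sum_le_sum
    intro i _
    rw [mul_comm]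
    have := Nat.mod_lt (x i) hA
    gcongr

open Classical in
lemma exists_group (a : ℕ → ℕ) (ha : ∀ i, 0 < a i) (M : ℕ) :
    ∃ G : Finset ℕ, (∀ i ∈ G, M ≤ i) ∧ ∃ N0, ∀ N ≥ N0, ∃ j ∈ G, ∃ c < a j,
      4 * a j * ((Finset.range N).filter (fun z => z % a j = c ∧ z ∉ vals a G)).card ≤ N := by
  obtain ⟨C, hC, hdens⟩ := dens4 (fun i : Fin 4 => a (M + i)) (fun i => ha _)
  set h := 5120 * C with hh
  let I : ℕ → Finset ℕ := fun k => Finset.Ico M (M+4+k)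
  have hImono : ∀ k l, k ≤ l → I k ⊆ I l := by
    intro k l hkl; apply Finset.Ico_subset_Ico_right; omega
  refine ⟨I h, by intro i hi; simp [I] at hi; omega, ∑ k ∈ Finset.range h, (8193 * a (M+4+k) * C)^2, ?_⟩
  intro N hN
  let cnt : ℕ → ℕ := fun k => ((Finset.range N).filter (fun n => n ∈ vals a (I k))).card
  have hcm : ∀ k, cnt k ≤ cnt (k+1) := by
    intro k
    apply Finset.card_le_card
    intro n hn
    simp only [Finset.mem_filter] at hn ⊢
    exact ⟨hn.1, vals_mono a (hImono k (k+1) (by omega)) hn.2⟩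
  obtain ⟨k, hk, hke⟩ : ∃ k < h, h * (cnt (k+1) - cnt k) ≤ N := by
    by_contra hcon
    push Not at hcon
    have h1 : ∑ k ∈ Finset.range h, (cnt (k+1) - cnt k) ≤ N := by
      rw [Finset.sum_range_tsub (monotone_nat_of_le_succ hcm)]
      have : cnt h ≤ N := by
        refine (Finset.card_filter_le _ _).trans ?_
        simp
      omega
    have h2 : ∑ k ∈ Finset.range h, N < ∑ k ∈ Finset.range h, h * (cnt (k+1) - cnt k) := by
      apply Finset.sum_lt_sum_of_nonempty
      · simp; omega
      · intro k hk; exact hcon k (Finset.mem_range.1 hk)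
    rw [← Finset.mul_sum] at h2
    simp at h2
    nlinarith
  have hnf := near_full (vals a (I k)) N (a (M+4+k)) (cnt (k+1) - cnt k) C (ha _) hC ?_ ?_ hke ?_
  · obtain ⟨c, hc, hcard⟩ := hnf
    refine ⟨M+4+k, by simp [I]; omega, c, hc, le_trans ?_ hcard⟩
    refine Nat.mul_le_mul_left _ (Finset.card_le_card ?_)
    intro z hz
    simp only [Finset.mem_filter] at hz ⊢
    exact ⟨hz.1, hz.2.1, fun h3 => hz.2.2 (vals_mono a (hImono k h hk.le) h3)⟩
  · intro x
    unfold upc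
    have hsub : ((Finset.range N).filter (fun t => t ∈ vals a (I k) ∧ t + a (M+4+k) * x^2 < N ∧ t + a (M+4+k) * x^2 ∉ vals a (I k))).image (fun t => t + a (M+4+k) * x^2) ⊆
      ((Finset.range N).filter (fun n => n ∈ vals a (I (k+1)))) \ ((Finset.range N).filter (fun n => n ∈ vals a (I k))) := by
      intro t ht
      simp only [Finset.mem_image, Finset.mem_filter, Finset.mem_range, Finset.mem_sdiff] at ht ⊢
      obtain ⟨t, ⟨h1, h2, h3, h4⟩, rfl⟩ := ht
      refine ⟨⟨h3, ?_⟩, fun h => h4 h.2⟩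
      have hd : Disjoint (I k) {M+4+k} := by simp [I]
      have := vals_add a hd h2 (n := a (M+4+k) * x^2) ⟨fun _ => x, by simp⟩
      refine vals_mono a ?_ this
      intro i hi
      simp [I] at hi ⊢
      omega
    have h1 := Finset.card_le_card hsub
    rw [Finset.card_image_of_injective _ (fun a b h => by simpa using h), Finset.card_sdiff_of_subset] at h1
    · exact h1
    · intro n hn
      simp only [Finset.mem_filter] at hn ⊢
      exact ⟨hn.1, vals_mono a (hImono k (k+1) (by omega)) hn.2⟩
  · refine (hdens (N/8)).trans ?_
    gcongr with n hn
    rintro ⟨x, rfl⟩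
    refine vals_mono a (hImono 0 k (by omega)) ⟨fun i => if h : i - M < 4 then x ⟨i - M, h⟩ else 0, ?_⟩
    simp only [I]
    rw [Finset.sum_Ico_eq_sum_range]
    simp [Finset.sum_range, Fin.sum_univ_succ]
  · refine le_trans ?_ hN
    exact Finset.single_le_sum (f := fun k => (8193 * a (M+4+k) * C)^2) (fun _ _ => Nat.zero_le _) (Finset.mem_range.2 hk)

open Classical in
/-- `T` contains at least three quarters of the class `C` mod `A` below `N`. -/
def NearFull (T : Set ℕ) (N A C : ℕ) : Prop :=
  4 * A * ((Finset.range N).filter (fun z => z % A = C ∧ z ∉ T)).card ≤ N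

open Classical in
lemma NearFull.refine {T : Set ℕ} {N a c : ℕ} (h : NearFull T N a c) (ha : 0 < a) (hc : c < a) (A : ℕ) (hA : 0 < A) (haA : a ∣ A) :
    ∃ C < A, NearFull T N A C := by
  by_contra hcon
  push Not at hcon
  obtain ⟨b, rfl⟩ := haA
  have hb : 0 < b := Nat.pos_of_mul_pos_left hA
  unfold NearFull at *
  have h1 : ∀ i < b, N < 4 * (a * b) * ((Finset.range N).filter (fun z => z % (a*b) = c + a * i ∧ z ∉ T)).card := by
    intro i hi
    have := hcon (c + a * i) (by nlinarith)
    omega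
  have h2 : ∑ i ∈ Finset.range b, ((Finset.range N).filter (fun z => z % (a*b) = c + a * i ∧ z ∉ T)).card ≤
     ((Finset.range N).filter (fun z => z % a = c ∧ z ∉ T)).card := by
    rw [← Finset.card_biUnion]
    · apply Finset.card_le_card
      intro z hz
      simp only [Finset.mem_biUnion, Finset.mem_filter] at hz ⊢
      obtain ⟨i, hi, h3, h4, h5⟩ := hz
      refine ⟨h3, ?_, h5⟩
      rw [← Nat.mod_mul_right_mod z a b, h4]
      simp [Nat.mod_eq_of_lt hc]
    · intro i _ j _ hij
      rw [Function.onFun, Finset.disjoint_left]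
      intro z hz hz'
      simp only [Finset.mem_filter] at hz hz'
      apply hij
      have : a * i = a * j := by omega
      exact Nat.eq_of_mul_eq_mul_left ha this
  have h3 : ∑ i ∈ Finset.range b, N < ∑ i ∈ Finset.range b, 4 * (a * b) * ((Finset.range N).filter (fun z => z % (a*b) = c + a * i ∧ z ∉ T)).card := by
    apply Finset.sum_lt_sum_of_nonempty
    · simp; omega
    · intro i hi; exact h1 i (Finset.mem_range.1 hi)
  rw [← Finset.mul_sum] at h3
  simp at h3
  have h4 := Nat.mul_le_mul_left (4 * (a*b)) h2
  nlinarith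

open Classical in
lemma NearFull.pair {T T' : Set ℕ} {N A C C' : ℕ} (h : NearFull T N A C) (h' : NearFull T' N A C') (hC : C < A) (hC' : C' < A)
    (r : ℕ) (hr : r < N) (hr2 : N + 2 * A ≤ 2 * r) (hmod : r ≡ C + C' [MOD A]) : ∃ t ∈ T, ∃ t' ∈ T', r = t + t' := by
  by_contra hcon
  push Not at hcon
  have hA : 0 < A := by omega
  set B1 := (Finset.range N).filter (fun z => z % A = C ∧ z ∉ T)
  set B2 := (Finset.range N).filter (fun z => z % A = C' ∧ z ∉ T')
  have h1 : (Finset.range (r/A)).card ≤ (B1 ∪ B2.image (fun z => r - z)).card := by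
    apply Finset.card_le_card_of_injOn (fun i => C + A * i)
    · intro i hi
      simp only [Finset.mem_coe, Finset.mem_range] at hi
      have hle : C + A * i < r := by
        have : A * (i + 1) ≤ A * (r/A) := by gcongr; omega
        have := Nat.mul_div_le r A
        nlinarith
      have hm1 : (C + A * i) % A = C := by simp [Nat.mod_eq_of_lt hC]
      simp only [Finset.mem_coe, Finset.mem_union]
      by_cases ht : C + A * i ∈ T
      · right
        rw [Finset.mem_image]
        refine ⟨r - (C + A * i), ?_, by omega⟩
        simp only [B2, Finset.mem_filter, Finset.mem_range]
        refine ⟨by omega, ?_, fun h5 => hcon _ ht _ h5 (by omega)⟩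
        have : C + A * i + (r - (C + A * i)) ≡ C + A * i + C' [MOD A] := by
          have e : C + A * i + (r - (C + A * i)) = r := by omega
          rw [e]
          refine hmod.trans ?_
          have : C + A * i + C' = (C + C') + A * i := by ring
          rw [this]
          simp [Nat.ModEq]
        have h6 := Nat.ModEq.add_left_cancel' _ this
        rw [Nat.ModEq, Nat.mod_eq_of_lt hC'] at h6
        exact h6
      · left
        simp only [B1, Finset.mem_filter, Finset.mem_range]
        exact ⟨by omega, hm1, ht⟩
    · intro i _ j _ hij
      simp only [add_right_inj] at hij
      exact Nat.eq_of_mul_eq_mul_left hA hij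
  rw [Finset.card_range] at h1
  have h2 := h1.trans ((Finset.card_union_le _ _).trans (Nat.add_le_add_left Finset.card_image_le _))
  have h3 : 4 * A * B1.card ≤ N := h
  have h4 : 4 * A * B2.card ≤ N := h'
  have h5 := Nat.lt_mul_div_succ r hA
  have h6 := Nat.mul_le_mul_left A h2
  nlinarith

open Classical in
lemma NearFull.nonempty {T : Set ℕ} {N A C : ℕ} (h : NearFull T N A C) (hC : C < A) (hN : 2 * A ≤ N) : ∃ t ∈ T, t % A = C := by
  by_contra hcon
  push Not at hcon
  have hA : 0 < A := by omega
  set B1 := (Finset.range N).filter (fun z => z % A = C ∧ z ∉ T)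
  have h1 : (Finset.range (N/A)).card ≤ B1.card := by
    apply Finset.card_le_card_of_injOn (fun i => C + A * i)
    · intro i hi
      simp only [Finset.mem_coe, Finset.mem_range] at hi
      have hle : C + A * i < N := by
        have : A * (i + 1) ≤ A * (N/A) := by gcongr; omega
        have := Nat.mul_div_le N A
        nlinarith
      have hm1 : (C + A * i) % A = C := by simp [Nat.mod_eq_of_lt hC]
      simp only [B1, Finset.mem_coe, Finset.mem_filter, Finset.mem_range]
      exact ⟨hle, hm1, fun ht => hcon _ ht hm1⟩
    · intro i _ j _ hij
      simp only [add_right_inj] at hij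
      exact Nat.eq_of_mul_eq_mul_left hA hij
  rw [Finset.card_range] at h1
  have h3 : 4 * A * B1.card ≤ N := h
  have h5 := Nat.lt_mul_div_succ N hA
  have h6 := Nat.mul_le_mul_left A h1
  nlinarith

lemma vals_sum (a : ℕ → ℕ) (G : ℕ → Finset ℕ) (hG : ∀ k l, k ≠ l → Disjoint (G k) (G l)) (S : Finset ℕ) (w : ℕ → ℕ)
    (hw : ∀ g ∈ S, w g ∈ vals a (G g)) : ∑ g ∈ S, w g ∈ vals a (S.biUnion G) := by
  classical
  induction S using Finset.induction_on with
  | empty => simpa using vals_zero a _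
  | insert g S hg ih =>
    rw [Finset.sum_insert hg, Finset.biUnion_insert]
    apply vals_add
    · rw [Finset.disjoint_biUnion_right]
      intro k hk; apply hG; rintro rfl; exact hg hk
    · exact hw g (Finset.mem_insert_self _ _)
    · exact ih (fun k hk => hw k (Finset.mem_insert_of_mem hk))

lemma exists_groups (a : ℕ → ℕ) (ha : ∀ i, 0 < a i) (M : ℕ) :
    ∃ G : ℕ → Finset ℕ, (∀ k l, k ≠ l → Disjoint (G k) (G l)) ∧ (∀ k, ∀ i ∈ G k, M ≤ i) ∧
      ∀ k, ∃ N0, ∀ N ≥ N0, ∃ j ∈ G k, ∃ c < a j, NearFull (vals a (G k)) N (a j) c := by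
  classical
  choose g hg1 hg2 using exists_group a ha
  let m : ℕ → ℕ := fun k => Nat.rec M (fun _ Mk => max Mk ((g Mk).sup id + 1)) k
  have hm : ∀ k, m (k+1) = max (m k) ((g (m k)).sup id + 1) := fun k => rfl
  have hmono : Monotone m := monotone_nat_of_le_succ (fun k => by rw [hm]; exact le_max_left _ _)
  have hlt : ∀ k l, k < l → Disjoint (g (m k)) (g (m l)) := by
    intro k l hkl
    rw [Finset.disjoint_left]
    intro i hi hi'
    have h1 : i ≤ (g (m k)).sup id := Finset.le_sup (f := id) hi
    have h2 : (g (m k)).sup id + 1 ≤ m (k+1) := by rw [hm]; exact le_max_right _ _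
    have h3 := hmono (Nat.succ_le_of_lt hkl)
    have h4 := hg1 _ i hi'
    simp only [Nat.succ_eq_add_one] at h3
    omega
  refine ⟨fun k => g (m k), ?_, ?_, ?_⟩
  · intro k l hkl
    rcases lt_or_gt_of_ne hkl with h | h
    · exact hlt k l h
    · exact (hlt l k h).symm
  · intro k i hi
    exact (hmono (Nat.zero_le k)).trans (hg1 _ i hi)
  · intro k
    obtain ⟨N0, hN0⟩ := hg2 (m k)
    refine ⟨N0, fun N hN => ?_⟩
    obtain ⟨j, hj, c, hc, h⟩ := hN0 N hN
    exact ⟨j, hj, c, hc, h⟩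

lemma star_sqfree (a : ℕ → ℕ) (hsq : ∀ i, Squarefree (a i)) :
    ∃ (I : Finset ℕ) (Q n0 : ℕ), 0 < Q ∧ ∀ n ≥ n0, Q ∣ n → n ∈ vals a I := by
  classical
  have ha : ∀ i, 0 < a i := fun i => Nat.pos_of_ne_zero (hsq i).ne_zero
  obtain ⟨G, hGd, hG3, hG⟩ := exists_groups a ha 3
  choose N0 hN0 using hG
  set Q := 2 * (a 0 * a 1 * a 2) with hQ
  have hQ0 : 0 < Q := by have := ha 0; have := ha 1; have := ha 2; positivity
  set m := 2 * Q * Q with hm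
  set A' := ∏ g ∈ Finset.range m, ∏ j ∈ G g, a j / Nat.gcd (a j) Q with hA'
  have hquo : ∀ j, 0 < a j / Nat.gcd (a j) Q := fun j => Nat.div_pos (Nat.gcd_le_left _ (ha j)) (Nat.gcd_pos_of_pos_right _ hQ0)
  have hA'0 : 0 < A' := Finset.prod_pos (fun g _ => Finset.prod_pos (fun j _ => hquo j))
  have hcop : Nat.Coprime A' Q := by
    rw [hA', Nat.coprime_prod_left_iff]
    intro g _
    rw [Nat.coprime_prod_left_iff]
    intro j _
    apply Nat.Coprime.symm
    rw [Nat.coprime_comm]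
    by_contra hne
    obtain ⟨p, hp, hp1, hp2⟩ := Nat.Prime.not_coprime_iff_dvd.1 hne
    have hpa : p ∣ a j := hp1.trans (Nat.div_dvd_of_dvd (Nat.gcd_dvd_left _ _))
    have hpg : p ∣ Nat.gcd (a j) Q := Nat.dvd_gcd hpa hp2
    have : p * p ∣ a j := by
      have h := mul_dvd_mul hpg hp1
      rwa [Nat.mul_div_cancel' (Nat.gcd_dvd_left _ _)] at h
    have := (hsq j) p this
    exact hp.one_lt.ne' (Nat.isUnit_iff.1 this)
  set A := Q * A' with hA
  have hA0 : 0 < A := by positivity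
  have hdvd : ∀ g < m, ∀ j ∈ G g, a j ∣ A := by
    intro g hg j hj
    have h1 : a j / Nat.gcd (a j) Q ∣ A' :=
      (Finset.dvd_prod_of_mem (fun j => a j / Nat.gcd (a j) Q) hj).trans (Finset.dvd_prod_of_mem (fun g => ∏ j ∈ G g, a j / Nat.gcd (a j) Q) (Finset.mem_range.2 hg))
    have h2 := mul_dvd_mul (Nat.gcd_dvd_right (a j) Q) h1
    rwa [Nat.mul_div_cancel' (Nat.gcd_dvd_left _ _)] at h2
  set J : Finset ℕ := {0, 1, 2} with hJ
  set All := J ∪ (Finset.range m).biUnion G with hAll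
  set K := A^2 * ∑ i ∈ All, a i with hK
  refine ⟨All, Q, (∑ g ∈ Finset.range m, N0 g) + 2 * K + 2 * A + 1, hQ0, ?_⟩
  intro n hn hQn
  set N := n + 1 with hN
  have hcls : ∀ g, ∃ C, g < m → C < A ∧ NearFull (vals a (G g)) N A C := by
    intro g
    by_cases hg : g < m
    · obtain ⟨j, hj, c, hc, h⟩ := hN0 g N (by
        have := Finset.single_le_sum (f := N0) (fun _ _ => Nat.zero_le _) (Finset.mem_range.2 hg)
        omega)
      obtain ⟨C, hC, h2⟩ := h.refine (ha j) hc A hA0 (hdvd g hg j hj)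
      exact ⟨C, fun _ => ⟨hC, h2⟩⟩
    · exact ⟨0, fun h => absurd h hg⟩
  choose C hC using hcls
  obtain ⟨ρ, hρ, hfib⟩ := Finset.exists_le_card_fiber_of_mul_le_card_of_maps_to
    (s := Finset.range m) (t := Finset.range Q) (f := fun g => C g % Q) (n := 2 * Q)
    (fun g _ => Finset.mem_range.2 (Nat.mod_lt _ hQ0)) ⟨0, Finset.mem_range.2 hQ0⟩ (by simp [hm]; ring_nf; rfl)
  obtain ⟨S, hSsub, hScard⟩ := Finset.exists_subset_card_eq hfib
  have hSm : ∀ g ∈ S, g < m ∧ C g % Q = ρ := by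
    intro g hg
    have := hSsub hg
    simpa using this
  obtain ⟨g1, hg1, g2, hg2, hne⟩ := Finset.one_lt_card.1 (by omega : 1 < S.card)
  set S' := (S.erase g1).erase g2 with hS'
  have hS'card : S'.card = 2 * Q - 2 := by
    rw [hS', Finset.card_erase_of_mem (Finset.mem_erase.2 ⟨hne.symm, hg2⟩), Finset.card_erase_of_mem hg1]
    omega
  have hS'S : ∀ g ∈ S', g ∈ S ∧ g ≠ g1 ∧ g ≠ g2 := by
    intro g hg
    simp [hS'] at hg; tauto
  have hw : ∀ g, ∃ w, g ∈ S' → w ∈ vals a (G g) ∧ w % A = C g := by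
    intro g
    by_cases hg : g ∈ S'
    · have h1 := hC g (hSm g (hS'S g hg).1).1
      obtain ⟨t, ht, ht'⟩ := h1.2.nonempty h1.1 (by omega)
      exact ⟨t, fun _ => ⟨ht, ht'⟩⟩
    · exact ⟨0, fun h => absurd h hg⟩
  choose w hw using hw
  have hsum := vals_sum a G hGd S' w (fun g hg => (hw g hg).1)
  set σ := ∑ g ∈ S', w g with hσ
  -- the correction from J
  obtain ⟨x, y, z, hxyz⟩ := ternary A' hA'0 (by
      rw [← Nat.not_even_iff_odd]; intro h
      have h2 : 2 ∣ A' := h.two_dvd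
      have h3 : 2 ∣ Nat.gcd A' Q := Nat.dvd_gcd h2 ⟨_, hQ⟩
      rw [hcop] at h3; omega) (a 0 * Q^2) (a 1 * Q^2) (a 2 * Q^2) ((n:ℤ) - C g1 - C g2 - σ)
      (by
        have h : Nat.Coprime (a 0 * Q^2) A' := by
          refine Nat.Coprime.mul_left ?_ (Nat.Coprime.pow_left 2 hcop.symm)
          exact Nat.Coprime.coprime_dvd_left ⟨2 * (a 1 * a 2), by rw [hQ]; ring⟩ hcop.symm
        exact_mod_cast Nat.isCoprime_iff_coprime.2 h)
      (by
        have h : Nat.Coprime (a 1 * Q^2) A' := by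
          refine Nat.Coprime.mul_left ?_ (Nat.Coprime.pow_left 2 hcop.symm)
          exact Nat.Coprime.coprime_dvd_left ⟨2 * (a 0 * a 2), by rw [hQ]; ring⟩ hcop.symm
        exact_mod_cast Nat.isCoprime_iff_coprime.2 h)
      (by
        have h : Nat.Coprime (a 2 * Q^2) A' := by
          refine Nat.Coprime.mul_left ?_ (Nat.Coprime.pow_left 2 hcop.symm)
          exact Nat.Coprime.coprime_dvd_left ⟨2 * (a 0 * a 1), by rw [hQ]; ring⟩ hcop.symm
        exact_mod_cast Nat.isCoprime_iff_coprime.2 h)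
  set v := a 0 * (Q * x.natAbs)^2 + a 1 * (Q * y.natAbs)^2 + a 2 * (Q * z.natAbs)^2 with hv
  have hvJ : v ∈ vals a J := by
    refine ⟨fun i => if i = 0 then Q * x.natAbs else if i = 1 then Q * y.natAbs else Q * z.natAbs, ?_⟩
    simp [hJ, hv, add_assoc]
  have hvz : (v:ℤ) = a 0 * Q^2 * x^2 + a 1 * Q^2 * y^2 + a 2 * Q^2 * z^2 := by
    rw [hv]; push_cast
    simp only [mul_pow, sq_abs]; ring
  have hJG : ∀ T : Finset ℕ, Disjoint J (T.biUnion G) := by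
    intro T
    rw [Finset.disjoint_biUnion_right]
    intro k _
    rw [Finset.disjoint_right]
    intro i hi
    have := hG3 k i hi
    simp [hJ]; omega
  have hvσ := vals_add a (hJG S') hvJ hsum
  obtain ⟨u, huv, hum, huK⟩ := vals_red a _ A _ hA0 hvσ
  have hWsub : J ∪ S'.biUnion G ⊆ All := by
    rw [hAll]
    apply Finset.union_subset_union_right
    apply Finset.biUnion_subset_biUnion_of_subset_left
    intro g hg
    exact Finset.mem_range.2 (hSm g (hS'S g hg).1).1
  have huK' : u ≤ K := huK.trans (by rw [hK]; gcongr)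
  have hun : u ≤ n := by omega
  -- congruence
  have hcong : n - u ≡ C g1 + C g2 [MOD A] := by
    have hmodA : (A:ℤ) ∣ (u:ℤ) - (v + σ) := by
      have : u ≡ v + σ [MOD A] := hum
      have := (Nat.modEq_iff_dvd.1 this.symm)
      simpa using this
    have hd1 : (A':ℤ) ∣ (n:ℤ) - u - (C g1 + C g2) := by
      have h1 : (A':ℤ) ∣ (u:ℤ) - (v + σ) := (Dvd.intro_left (Q:ℤ) (by rw [hA]; push_cast; rfl)).trans hmodA
      rw [← hvz] at hxyz
      have := dvd_add hxyz h1
      rw [← dvd_neg] at this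
      obtain ⟨k, hk⟩ := this
      exact ⟨k, by linear_combination hk⟩
    have hd2 : (Q:ℤ) ∣ (n:ℤ) - u - (C g1 + C g2) := by
      have h1 : (Q:ℤ) ∣ (u:ℤ) - (v + σ) := (Dvd.intro (A':ℤ) (by rw [hA]; push_cast; rfl)).trans hmodA
      have h2 : (Q:ℤ) ∣ v := by rw [hvz]; exact ⟨a 0 * Q * x^2 + a 1 * Q * y^2 + a 2 * Q * z^2, by ring⟩
      have h3 : (Q:ℤ) ∣ n := by exact_mod_cast hQn
      have h4 : (Q:ℤ) ∣ (σ:ℤ) - (2 * Q - 2) * ρ := by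
        have e : (σ:ℤ) - (2 * Q - 2) * ρ = ∑ g ∈ S', ((w g:ℤ) - ρ) := by
          rw [Finset.sum_sub_distrib, hσ]; push_cast
          simp only [Finset.sum_const, hS'card, nsmul_eq_mul]
          rw [Nat.cast_sub (by omega)]; push_cast; ring
        rw [e]
        apply Finset.dvd_sum
        intro g hg
        have h5 := (hw g hg).2
        have h6 : w g % Q = ρ := by
          rw [← (hSm g (hS'S g hg).1).2, ← h5, hA, Nat.mod_mul_right_mod]
        rw [← h6]; push_cast
        exact Int.dvd_self_sub_emod
      have hcg : ∀ g ∈ S, (Q:ℤ) ∣ (C g:ℤ) - ρ := by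
        intro g hg
        rw [← (hSm g hg).2]; push_cast
        exact Int.dvd_self_sub_emod
      have h7 := hcg g1 hg1
      have h8 := hcg g2 hg2
      have h9 : (Q:ℤ) ∣ 2 * Q * ρ := ⟨2 * ρ, by ring⟩
      have := dvd_sub (dvd_sub (dvd_sub (dvd_sub (dvd_sub (dvd_sub h3 h1) h2) h4) h7) h8) h9
      obtain ⟨k, hk⟩ := this
      exact ⟨k, by linear_combination hk⟩
    have hd3 : (A:ℤ) ∣ (n:ℤ) - u - (C g1 + C g2) := by
      rw [hA]; push_cast
      exact IsCoprime.mul_dvd (Nat.isCoprime_iff_coprime.2 hcop.symm) hd2 hd1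
    apply Nat.ModEq.symm
    rw [Nat.modEq_iff_dvd]
    push_cast [Nat.cast_sub hun]
    exact hd3
  have c1 := hC g1 (hSm g1 hg1).1
  have c2 := hC g2 (hSm g2 hg2).1
  obtain ⟨t, ht, t', ht', htt⟩ := c1.2.pair c2.2 c1.1 c2.1 (n - u) (by omega) (by omega) hcong
  have hn' : n = u + (t + t') := by omega
  rw [hn']
  have h12 := vals_add a (hGd g1 g2 hne) ht ht'
  have hdis : Disjoint (J ∪ S'.biUnion G) (G g1 ∪ G g2) := by
    have hJ1 : ∀ k, Disjoint J (G k) := fun k => by simpa using hJG {k}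
    rw [Finset.disjoint_union_left, Finset.disjoint_union_right, Finset.disjoint_union_right, Finset.disjoint_biUnion_left, Finset.disjoint_biUnion_left]
    exact ⟨⟨hJ1 _, hJ1 _⟩, fun g hg => hGd _ _ (hS'S g hg).2.1, fun g hg => hGd _ _ (hS'S g hg).2.2⟩
  refine vals_mono a ?_ (vals_add a hdis huv h12)
  apply Finset.union_subset hWsub
  rw [hAll]
  refine Finset.union_subset ?_ ?_ <;> refine Finset.Subset.trans ?_ Finset.subset_union_right
  · exact Finset.subset_biUnion_of_mem G (Finset.mem_range.2 (hSm g1 hg1).1)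
  · exact Finset.subset_biUnion_of_mem G (Finset.mem_range.2 (hSm g2 hg2).1)

lemma star (a : ℕ → ℕ) (ha : ∀ i, 0 < a i) :
    ∃ (I : Finset ℕ) (D : ℕ), 0 < D ∧ ∀ t, D * t ∈ vals a I := by
  choose s b h hs using fun i => Nat.sq_mul_squarefree (a i)
  obtain ⟨I, Q, n0, hQ, hI⟩ := star_sqfree s (fun i => (hs i))
  have hb : ∀ i, 0 < b i := by
    intro i
    rcases Nat.eq_zero_or_pos (b i) with h0 | h0
    · have := h i; rw [h0] at this; have := ha i; simp_all
    · exact h0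
  set P := ∏ i ∈ I, b i with hP
  have hP0 : 0 < P := Finset.prod_pos (fun i _ => hb i)
  refine ⟨I, P^2 * (Q * (n0+1)), by positivity, ?_⟩
  intro t
  rcases Nat.eq_zero_or_pos t with rfl | ht
  · exact vals_zero _ _
  obtain ⟨x, hx⟩ := hI (Q * (n0+1) * t) (by
    calc n0 ≤ n0 + 1 := Nat.le_succ _
      _ ≤ Q * (n0+1) := Nat.le_mul_of_pos_left _ (by omega)
      _ ≤ Q * (n0+1) * t := Nat.le_mul_of_pos_right _ ht) (by rw [mul_assoc]; exact dvd_mul_right _ _)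
  refine ⟨fun i => P / b i * x i, ?_⟩
  rw [mul_assoc, hx, Finset.mul_sum]
  apply Finset.sum_congr rfl
  intro i hi
  have h1 : P / b i * b i = P := Nat.div_mul_cancel (Finset.dvd_prod_of_mem b hi)
  rw [← h i]
  nth_rewrite 1 [← h1]
  ring

lemma posDef_det_ne {n : ℕ} {G : Mat n} (h : PosDefInt G) : G.det ≠ 0 := by
  intro h0
  obtain ⟨v, hv, hv0⟩ := Matrix.exists_mulVec_eq_zero_iff.2 h0
  have := h.2 v hv
  rw [hv0] at this
  simp at this

lemma posDef_of_rep {n : ℕ} {G G' T : Mat n} (hG : PosDefInt G) (hs : G'.IsSymm)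
    (h : T * G' * Tᵀ = G) : PosDefInt G' := by
  refine ⟨hs, fun x hx => ?_⟩
  have hdT : T.det ≠ 0 := by
    have := posDef_det_ne hG
    rw [← h] at this
    simp only [Matrix.det_mul, Matrix.det_transpose] at this
    intro h0; rw [h0] at this; simp at this
  set y := (T.adjugate)ᵀ *ᵥ x with hy
  have h1 : Tᵀ *ᵥ y = T.det • x := by
    rw [hy, Matrix.mulVec_mulVec, ← Matrix.transpose_mul, Matrix.adjugate_mul]
    simp [Matrix.transpose_smul, Matrix.smul_mulVec]
  have hy0 : y ≠ 0 := by
    intro h0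
    rw [h0, Matrix.mulVec_zero] at h1
    rcases smul_eq_zero.1 h1.symm with h1 | h1
    · exact hdT h1
    · exact hx h1
  have h2 := hG.2 y hy0
  have h3 : y ⬝ᵥ G *ᵥ y = T.det ^ 2 * (x ⬝ᵥ G' *ᵥ x) := by
    rw [← h, ← Matrix.mulVec_mulVec, ← Matrix.mulVec_mulVec, h1, Matrix.dotProduct_mulVec, ← Matrix.mulVec_transpose, h1,
      Matrix.mulVec_smul, smul_dotProduct, dotProduct_smul, smul_eq_mul, smul_eq_mul]
    ring
  rw [h3] at h2
  exact pos_of_mul_pos_right h2 (sq_nonneg _)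

lemma isom_det {n : ℕ} {A B : Mat n} (hA : PosDefInt A) (h : Isom A B) :
    A.det.natAbs = B.det.natAbs := by
  obtain ⟨⟨T, hT⟩, ⟨S, hS⟩⟩ := h
  have h1 : B.det = T.det ^ 2 * A.det := by rw [← hT]; simp [Matrix.det_mul]; ring
  have h2 : A.det = S.det ^ 2 * B.det := by rw [← hS]; simp [Matrix.det_mul]; ring
  apply Nat.dvd_antisymm
  · rw [Int.natAbs_dvd_natAbs]; exact ⟨_, by rw [mul_comm]; exact h1⟩
  · rw [Int.natAbs_dvd_natAbs]; exact ⟨_, by rw [mul_comm]; exact h2⟩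

lemma overlattice_one {n : ℕ} {G : Mat n} (hG : PosDefInt G) (p : ℤ) (hp : p ≠ 0) (v : Fin n → ℤ) (i : Fin n)
    (hi : v i = 1) (h1 : ∀ k, p ∣ (G *ᵥ v) k) (h2 : p^2 ∣ v ⬝ᵥ G *ᵥ v) :
    ∃ G' T : Mat n, PosDefInt G' ∧ T * G' * Tᵀ = G ∧ T.det = p := by
  set U : Mat n := ((1 : Mat n).updateCol i v)ᵀ with hU
  have hUdet : U.det = 1 := by
    rw [hU, Matrix.det_transpose, ← Matrix.cramer_apply, Matrix.cramer_one]
    simpa using hi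
  have hUrow : ∀ k, U k = if k = i then v else Pi.single k 1 := by
    intro k
    ext l
    rw [hU, Matrix.transpose_apply, Matrix.updateCol_apply]
    split_ifs with h
    · rfl
    · rw [Matrix.one_apply, Pi.single_apply]
  set G1 := U * G * Uᵀ with hG1
  have hG1s : G1.IsSymm := by
    rw [Matrix.IsSymm, hG1, Matrix.transpose_mul, Matrix.transpose_mul, Matrix.transpose_transpose, hG.1.eq, Matrix.mul_assoc]
  have hG1a : ∀ k l, G1 k l = U k ⬝ᵥ G *ᵥ (U l) := by
    intro k l
    rw [hG1, Matrix.mul_assoc, Matrix.mul_apply, dotProduct]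
    apply Finset.sum_congr rfl
    intro j _
    rfl
  have hGi : ∀ k, p ∣ G1 k i := by
    intro k
    rw [hG1a, hUrow i]
    simp only [if_true]
    rw [dotProduct]
    exact Finset.dvd_sum (fun j _ => Dvd.dvd.mul_left (h1 j) _)
  have hGii : p^2 ∣ G1 i i := by
    rw [hG1a, hUrow i]; simpa using h2
  set d : Fin n → ℤ := fun k => if k = i then p else 1 with hd
  have hdiv : ∀ k l, d k * d l ∣ G1 k l := by
    intro k l
    simp only [hd]
    split_ifs with hk hl hl
    · subst hk; subst hl; rw [← sq]; exact hGii
    · subst hk; rw [mul_one, ← hG1s.apply]; exact hGi l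
    · subst hl; rw [one_mul]; exact hGi k
    · simp
  have hddet : (Matrix.diagonal d).det = p := by
    rw [Matrix.det_diagonal, hd]
    simp
  set G' : Mat n := Matrix.of fun k l => G1 k l / (d k * d l) with hG'
  have hdG : Matrix.diagonal d * G' * (Matrix.diagonal d)ᵀ = G1 := by
    ext k l
    rw [Matrix.diagonal_transpose, Matrix.mul_diagonal, Matrix.diagonal_mul, hG']
    simp only [Matrix.of_apply]
    obtain ⟨c, hc⟩ := hdiv k l
    have hne : d k * d l ≠ 0 := by
      simp only [hd]; split_ifs <;> simp [hp]
    rw [hc, Int.mul_ediv_cancel_left _ hne]; ring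
  have hT : (U⁻¹ * Matrix.diagonal d) * G' * (U⁻¹ * Matrix.diagonal d)ᵀ = G := by
    have e : (U⁻¹ * Matrix.diagonal d) * G' * (U⁻¹ * Matrix.diagonal d)ᵀ = U⁻¹ * (Matrix.diagonal d * G' * (Matrix.diagonal d)ᵀ) * (U⁻¹)ᵀ := by
      rw [Matrix.transpose_mul]; simp only [Matrix.mul_assoc]
    have hUu : IsUnit U.det := by rw [hUdet]; exact isUnit_one
    rw [e, hdG, hG1]
    have e2 : U⁻¹ * (U * G * Uᵀ) * (U⁻¹)ᵀ = (U⁻¹ * U) * G * (U⁻¹ * U)ᵀ := by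
      rw [Matrix.transpose_mul]; simp only [Matrix.mul_assoc]
    rw [e2, Matrix.nonsing_inv_mul _ hUu]; simp
  refine ⟨G', U⁻¹ * Matrix.diagonal d, posDef_of_rep hG ?_ hT, hT, ?_⟩
  · ext k l
    simp only [Matrix.transpose_apply, hG', Matrix.of_apply]
    rw [hG1s.apply, mul_comm]
  · rw [Matrix.det_mul, hddet, Matrix.det_nonsing_inv, hUdet]; simp

lemma overlattice {n : ℕ} {G : Mat n} (hG : PosDefInt G) (p : ℕ) (hp : p.Prime) (v : Fin n → ℤ)
    (hv : ¬ ∀ k, (p:ℤ) ∣ v k) (h1 : ∀ k, (p:ℤ)^2 ∣ (G *ᵥ v) k) :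
    ∃ G' T : Mat n, PosDefInt G' ∧ T * G' * Tᵀ = G ∧ T.det = p := by
  push Not at hv
  obtain ⟨i, hi⟩ := hv
  have hco : IsCoprime (v i) (p:ℤ) := ((Nat.prime_iff_prime_int.1 hp).coprime_iff_not_dvd.2 hi).symm
  obtain ⟨c, e, hce⟩ := hco
  have hpe : ∀ k, (G *ᵥ (c • v + ((p:ℤ) * e) • Pi.single i 1)) k = c * (G *ᵥ v) k + p * e * G k i := by
    intro k
    rw [Matrix.mulVec_add, Matrix.mulVec_smul, Matrix.mulVec_smul, Matrix.mulVec_single_one]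
    simp
  have h1' : ∀ k, (p:ℤ) ∣ (G *ᵥ v) k := fun k => (Dvd.intro _ (sq (p:ℤ)).symm).trans (h1 k)
  refine overlattice_one hG p (by exact_mod_cast hp.ne_zero) (c • v + ((p:ℤ) * e) • Pi.single i 1) i ?_ ?_ ?_
  · simp; linarith
  · intro k
    rw [hpe, mul_assoc]
    exact dvd_add (Dvd.dvd.mul_left (h1' k) _) (dvd_mul_right _ _)
  · rw [add_dotProduct, smul_dotProduct, smul_dotProduct, single_one_dotProduct, hpe, dotProduct]
    simp only [hpe, mul_add, Finset.sum_add_distrib, smul_eq_mul]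
    have e1 : ∑ x, v x * (p * e * G x i) = p * e * (G *ᵥ v) i := by
      rw [Matrix.mulVec, dotProduct, Finset.mul_sum]
      apply Finset.sum_congr rfl
      intro x _
      rw [hG.1.apply]; ring
    rw [e1]
    have e2 : (p:ℤ)^2 ∣ ∑ x, v x * (c * (G *ᵥ v) x) := Finset.dvd_sum (fun x _ => Dvd.dvd.mul_left (Dvd.dvd.mul_left (h1 x) _) _)
    obtain ⟨k1, hk1⟩ := e2
    obtain ⟨k2, hk2⟩ := h1 i
    rw [hk1, hk2]
    exact ⟨c * k1 + c * (p * e * k2) + p * e * c * k2 + e * e * G i i, by ring⟩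

/-- Gram matrices whose level has no fourth-power prime factor. -/
def Nice {n : ℕ} (N : Mat n) : Prop :=
  ∃ (d : ℕ) (X : Mat n), 0 < d ∧ N * X = (d:ℤ) • (1 : Mat n) ∧ X * N = (d:ℤ) • (1 : Mat n) ∧
    ∀ p : ℕ, p.Prime → ¬ p^4 ∣ d

lemma nice_or {n : ℕ} {N : Mat n} (hN : PosDefInt N) (h : ¬ Nice N) :
    ∃ (p : ℕ) (x : Fin n → ℤ), p.Prime ∧ (¬ ∀ k, (p:ℤ) ∣ x k) ∧ ∀ k, (p:ℤ)^4 ∣ (N *ᵥ x) k := by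
  classical
  have hdet := posDef_det_ne hN
  have hex : ∃ d : ℕ, 0 < d ∧ ∃ X : Mat n, N * X = (d:ℤ) • (1 : Mat n) := by
    refine ⟨N.det.natAbs, Int.natAbs_pos.2 hdet, ?_⟩
    rcases Int.natAbs_eq N.det with h | h
    · refine ⟨N.adjugate, ?_⟩
      rw [← h]; exact Matrix.mul_adjugate N
    · refine ⟨-N.adjugate, ?_⟩
      rw [Matrix.mul_neg, Matrix.mul_adjugate]
      nth_rewrite 1 [h]; simp
  obtain ⟨hd0, X, hX⟩ := Nat.find_spec hex
  set d := Nat.find hex with hd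
  have hX2 : X * N = (d:ℤ) • (1 : Mat n) := by
    have e : N * (X * N - (d:ℤ) • (1 : Mat n)) = 0 := by
      rw [Matrix.mul_sub, ← Matrix.mul_assoc, hX, Matrix.mul_smul, Matrix.smul_mul]; simp only [Matrix.one_mul, Matrix.mul_one, sub_self]
    have e2 : N.det • (X * N - (d:ℤ) • (1 : Mat n)) = 0 := by
      have : N.adjugate * (N * (X * N - (d:ℤ) • (1 : Mat n))) = 0 := by rw [e]; simp
      rw [← Matrix.mul_assoc, Matrix.adjugate_mul] at this
      simpa using this
    have e3 := (smul_eq_zero.1 e2).resolve_left hdet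
    exact sub_eq_zero.1 e3
  have : ∃ p : ℕ, p.Prime ∧ p^4 ∣ d := by
    by_contra hc
    push Not at hc
    exact h ⟨d, X, hd0, hX, hX2, hc⟩
  obtain ⟨p, hp, hpd⟩ := this
  by_cases hall : ∀ k l, (p:ℤ) ∣ X k l
  · exfalso
    choose Y hY using hall
    have hpd1 : p ∣ d := (Dvd.intro_left (p^3) (by ring)).trans hpd
    obtain ⟨d', hd'⟩ := hpd1
    have hp0 : (p:ℤ) ≠ 0 := by exact_mod_cast hp.ne_zero
    have hlt : d' < d := by
      have := hp.two_le
      have : 0 < d' := by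
        rcases Nat.eq_zero_or_pos d' with h | h
        · rw [h] at hd'; omega
        · exact h
      rw [hd']; nlinarith
    refine Nat.find_min hex hlt ⟨?_, Matrix.of Y, ?_⟩
    · rcases Nat.eq_zero_or_pos d' with h | h
      · rw [h] at hd'; omega
      · exact h
    · have hXY : X = (p:ℤ) • (Matrix.of Y) := by
        ext k l; simp [hY]
      rw [hXY, hd'] at hX
      rw [Matrix.mul_smul] at hX
      push_cast at hX
      rw [mul_smul] at hX
      exact smul_right_injective _ hp0 hX
  · push Not at hall
    obtain ⟨k, l, hkl⟩ := hall
    refine ⟨p, fun k => X k l, hp, fun h => hkl (h k), ?_⟩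
    intro m
    have : (N *ᵥ fun k => X k l) m = (N * X) m l := by
      rw [Matrix.mul_apply]; rfl
    rw [this, hX]
    rw [Matrix.smul_apply, smul_eq_mul]
    apply Dvd.dvd.mul_right
    exact_mod_cast hpd

lemma exists_nice {n : ℕ} (Nst N : Mat n) (hst : PosDefInt Nst) (hN : PosDefInt N) (hiso : ¬ Isom N Nst) :
    ∃ N' : Mat n, PosDefInt N' ∧ Represents N' N ∧ ¬ Isom N' Nst ∧ Nice N' := by
  classical
  have hex : ∃ k : ℕ, ∃ N' : Mat n, PosDefInt N' ∧ Represents N' N ∧ ¬ Isom N' Nst ∧ N'.det.natAbs = k :=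
    ⟨_, N, hN, Represents.rfl' _, hiso, rfl⟩
  obtain ⟨N', hN', hrep, hni, hk⟩ := Nat.find_spec hex
  have hmin := fun m => Nat.find_min hex (m := m)
  rw [← hk] at hmin
  refine ⟨N', hN', hrep, hni, ?_⟩
  by_contra hnice
  obtain ⟨p, x, hp, hx, hpx⟩ := nice_or hN' hnice
  have hp0 : (p:ℤ) ≠ 0 := by exact_mod_cast hp.ne_zero
  have hdrop : ∀ A B T : Mat n, PosDefInt A → PosDefInt B → T * B * Tᵀ = A → T.det = p → B.det.natAbs < A.det.natAbs := by
    intro A B T hA hB h1 h2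
    rw [← h1]
    simp only [Matrix.det_mul, Matrix.det_transpose, h2, Int.natAbs_mul, Int.natAbs_natCast]
    have := hp.two_le
    have : 0 < B.det.natAbs := Int.natAbs_pos.2 (posDef_det_ne hB)
    nlinarith [Nat.mul_le_mul this hp.two_le, Nat.mul_le_mul (Nat.mul_le_mul hp.two_le (le_refl B.det.natAbs)) hp.two_le]
  obtain ⟨N2, T, hN2, hT, hdT⟩ := overlattice hN' p hp x hx (fun k => (pow_dvd_pow _ (by norm_num)).trans (hpx k))
  have hlt := hdrop _ _ _ hN' hN2 hT hdT
  have hrep2 : Represents N2 N := Represents.trans' ⟨T, hT⟩ hrep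
  have hiso2 : Isom N2 Nst := by
    by_contra h
    exact hmin _ hlt ⟨N2, hN2, hrep2, h, rfl⟩
  -- second overlattice
  choose y hy using hpx
  have hN2x : ∀ k, (N2 *ᵥ (Tᵀ *ᵥ x)) k = (p:ℤ)^3 * (T.adjugate *ᵥ y) k := by
    intro k
    have e1 : T *ᵥ (N2 *ᵥ (Tᵀ *ᵥ x)) = ((p:ℤ)^4) • y := by
      rw [Matrix.mulVec_mulVec, Matrix.mulVec_mulVec, hT]
      ext k; simp [hy]
    have e2 : (p:ℤ) • (N2 *ᵥ (Tᵀ *ᵥ x)) = ((p:ℤ)^4) • (T.adjugate *ᵥ y) := by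
      rw [← Matrix.mulVec_smul (T.adjugate), ← e1, Matrix.mulVec_mulVec _ T.adjugate T, Matrix.adjugate_mul, hdT,
        Matrix.smul_mulVec, Matrix.one_mulVec]
    have e3 := congrFun e2 k
    simp only [Pi.smul_apply, smul_eq_mul] at e3
    apply mul_left_cancel₀ hp0
    rw [e3]; ring
  have hback : (T.adjugate)ᵀ *ᵥ (Tᵀ *ᵥ x) = (p:ℤ) • x := by
    rw [Matrix.mulVec_mulVec, ← Matrix.transpose_mul, Matrix.mul_adjugate, hdT]
    simp [Matrix.transpose_smul, Matrix.smul_mulVec]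
  have : ∃ x' : Fin n → ℤ, (¬ ∀ k, (p:ℤ) ∣ x' k) ∧ ∀ k, (p:ℤ)^2 ∣ (N2 *ᵥ x') k := by
    by_cases hd : ∀ k, (p:ℤ) ∣ (Tᵀ *ᵥ x) k
    · choose x' hx' using hd
      have hxe : Tᵀ *ᵥ x = (p:ℤ) • x' := by ext k; simp [hx']
      refine ⟨x', ?_, ?_⟩
      · intro hall
        choose x'' hx'' using hall
        have : x' = (p:ℤ) • x'' := by ext k; simp [hx'']
        rw [hxe, this, Matrix.mulVec_smul] at hback
        have h5 := smul_right_injective (M := Fin n → ℤ) hp0 hback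
        rw [Matrix.mulVec_smul] at h5
        apply hx
        intro k
        rw [← h5]
        exact ⟨_, rfl⟩
      · intro k
        have h6 := hN2x k
        rw [hxe, Matrix.mulVec_smul] at h6
        refine ⟨(T.adjugate *ᵥ y) k, mul_left_cancel₀ hp0 ?_⟩
        simp only [Pi.smul_apply, smul_eq_mul] at h6
        rw [h6]; ring
    · exact ⟨_, hd, fun k => ⟨p * (T.adjugate *ᵥ y) k, by rw [hN2x]; ring⟩⟩
  obtain ⟨x', hx', hpx'⟩ := this
  obtain ⟨N3, T3, hN3, hT3, hdT3⟩ := overlattice hN2 p hp x' hx' hpx'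
  have hlt3 := hdrop _ _ _ hN2 hN3 hT3 hdT3
  refine hmin _ (hlt3.trans hlt) ⟨N3, hN3, Represents.trans' ⟨T3, hT3⟩ hrep2, ?_, rfl⟩
  intro h
  have := isom_det hN3 h
  have := isom_det hN2 hiso2
  omega

lemma catalan_poly (k : ℕ) : ∃ c : Polynomial ℤ, (Polynomial.X : Polynomial ℤ)^k ∣ 1 + Polynomial.X * c^2 - c := by
  induction k with
  | zero => exact ⟨0, by simp⟩
  | succ k ih =>
    obtain ⟨c, r, hr⟩ := ih
    refine ⟨1 + Polynomial.X * c^2, r * (1 + Polynomial.X * c^2 + c), ?_⟩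
    rw [pow_succ]
    linear_combination (Polynomial.X * (1 + Polynomial.X * c^2 + c)) * hr

lemma aeval_comm_symm {n : ℕ} (z N : Mat n) (h : z * N = N * zᵀ) (p : Polynomial ℤ) :
    Polynomial.aeval z p * N = N * (Polynomial.aeval z p)ᵀ := by
  induction p using Polynomial.induction_on with
  | C a => rw [Polynomial.aeval_C, Algebra.algebraMap_eq_smul_one, Matrix.transpose_smul, Matrix.transpose_one, Matrix.mul_smul, Matrix.smul_mul, Matrix.one_mul, Matrix.mul_one]
  | add p q hp hq => rw [map_add, add_mul, hp, hq, Matrix.transpose_add, mul_add]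
  | monomial m a ih =>
    rw [pow_succ, ← mul_assoc, map_mul, Polynomial.aeval_X, Matrix.mul_assoc, h, ← Matrix.mul_assoc, ih,
      Matrix.mul_assoc, ← Matrix.transpose_mul]
    congr 2
    have : Commute z (Polynomial.aeval z (Polynomial.C a * Polynomial.X ^ m)) := by
      have h1 := Polynomial.aeval_X (R := ℤ) z
      rw [Commute, SemiconjBy]
      nth_rewrite 1 [← h1]
      nth_rewrite 4 [← h1]
      rw [← map_mul, ← map_mul, mul_comm]
    exact this.eq

lemma hensel {n : ℕ} (N0 X E' : Mat n) (hN0 : N0.IsSymm) (hE' : E'.IsSymm) (db dg Q κ Db : ℤ) (K : ℕ)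
    (hX : X * N0 = (db * dg) • (1 : Mat n))
    (hDb : Db ∣ Q^K) (hκ : Db ∣ κ * dg - 1) :
    ∃ T : Mat n, (∀ i j, Db ∣ (T * N0 * Tᵀ - N0) i j - 4 * db * Q * E' i j) ∧
      ∀ i, (∀ j, E' i j = 0) → ∀ j, (T * N0 * Tᵀ - N0) i j = 0 := by
  obtain ⟨c, r, hr⟩ := catalan_poly K
  set w : Mat n := (-κ) • (E' * X) with hw
  set z : Mat n := Q • w with hz
  have hzN : z * N0 = (-(Q * κ * (db * dg))) • E' := by
    rw [hz, hw, Matrix.smul_mul, Matrix.smul_mul, Matrix.mul_assoc, hX, Matrix.mul_smul, Matrix.mul_one, smul_smul, smul_smul]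
    congr 1; ring
  have hcomm : z * N0 = N0 * zᵀ := by
    have : (z * N0)ᵀ = z * N0 := by rw [hzN, Matrix.transpose_smul, hE'.eq]
    rw [← this, Matrix.transpose_mul, hN0.eq]
  set p : Polynomial ℤ := 1 - 2 * Polynomial.X * c with hp
  have hp2 : p * p - 1 = Polynomial.X * (-4 + 4 * (Polynomial.X ^ K * r)) := by
    rw [hp]; linear_combination (4 * Polynomial.X) * hr
  set T := Polynomial.aeval z p with hT
  have hTT : T * N0 * Tᵀ - N0 = z * (-4 + 4 * (z^K * Polynomial.aeval z r)) * N0 := by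
    have h1 := congrArg (Polynomial.aeval z) hp2
    simp only [map_sub, map_mul, map_one, map_add, map_pow, Polynomial.aeval_X, map_neg, map_ofNat] at h1
    rw [← h1, hT, Matrix.mul_assoc, ← aeval_comm_symm z N0 hcomm p, sub_mul, one_mul, mul_assoc]
  refine ⟨T, ?_, ?_⟩
  · intro i j
    have e : z * (-4 + 4 * (z^K * Polynomial.aeval z r)) * N0 = (-4 : ℤ) • (z * N0) + Q^K • ((4:ℤ) • (z * (w^K * Polynomial.aeval z r) * N0)) := by
      have : z^K = Q^K • w^K := by rw [hz, smul_pow]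
      have h4 : (4 : Mat n) = (4:ℤ) • (1 : Mat n) := by
        rw [zsmul_one]; norm_num
      rw [this, h4, mul_add, add_mul, mul_neg, neg_mul]
      simp only [Matrix.mul_smul, Matrix.smul_mul, Matrix.one_mul, Matrix.mul_one, neg_smul]
    rw [hTT, e, hzN]
    simp only [Matrix.add_apply, Matrix.smul_apply, smul_eq_mul]
    obtain ⟨k1, hk1⟩ := hDb
    obtain ⟨k2, hk2⟩ := hκ
    generalize (z * (w ^ K * (Polynomial.aeval z) r) * N0) i j = y
    exact ⟨k2 * (4 * db * Q * E' i j) + k1 * (4 * y), by linear_combination (4 * db * Q * E' i j) * hk2 + 4 * y * hk1⟩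
  · intro i hi j
    have hzi : ∀ j, z i j = 0 := by
      intro j
      rw [hz, hw]
      simp only [Matrix.smul_apply, Matrix.mul_apply, hi, zero_mul, Finset.sum_const_zero, smul_zero]
    rw [hTT, Matrix.mul_assoc, Matrix.mul_apply]
    simp [hzi]

lemma gram_sum {V ι : Type*} [AddCommGroup V] [Fintype ι] (B : V →ₗ[ℤ] V →ₗ[ℤ] ℤ) (f : ι → V)
    (hf : ∀ x y, x ≠ y → B (f x) (f y) = 0) (α β : ι → ℤ) :
    B (∑ x, α x • f x) (∑ x, β x • f x) = ∑ x, α x * β x * B (f x) (f x) := by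
  classical
  rw [map_sum B, LinearMap.sum_apply]
  apply Finset.sum_congr rfl
  intro x _
  rw [map_sum, Finset.sum_eq_single x]
  · simp; ring
  · intro y _ hy
    simp [hf x y hy.symm]
  · simp

/-- kernel basis is independent mod p, so it cannot be totally isotropic. -/
lemma kernel_aniso {n : ℕ} (p : ℕ) [hp : Fact p.Prime] (hp2 : p ≠ 2) (a : Fin (2*n+1) → ℤ) (ha : ∀ i, ¬ (p:ℤ) ∣ a i)
    (φ : (Fin (2*n+1) → ℤ) →ₗ[ℤ] (Fin n → ℤ)) :
    ∃ w, φ w = 0 ∧ ¬ (p:ℤ) ∣ ∑ i, a i * w i ^ 2 := by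
  by_contra hcon
  push Not at hcon
  have hpp := hp.out
  have hp0 : (p:ℤ) ≠ 0 := by exact_mod_cast hpp.ne_zero
  have hpol : ∀ w w', φ w = 0 → φ w' = 0 → (p:ℤ) ∣ ∑ i, a i * (w i * w' i) := by
    intro w w' hw hw'
    have h1 := hcon w hw
    have h2 := hcon w' hw'
    have h3 := hcon (w + w') (by rw [map_add, hw, hw', add_zero])
    have h4 : (p:ℤ) ∣ 2 * ∑ i, a i * (w i * w' i) := by
      have : 2 * ∑ i, a i * (w i * w' i) = (∑ i, a i * (w + w') i ^ 2) - (∑ i, a i * w i ^ 2) - ∑ i, a i * w' i ^ 2 := by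
        rw [Finset.mul_sum, ← Finset.sum_sub_distrib, ← Finset.sum_sub_distrib]
        apply Finset.sum_congr rfl
        intro i _
        simp only [Pi.add_apply]; ring
      rw [this]
      exact dvd_sub (dvd_sub h3 h1) h2
    rcases (Nat.prime_iff_prime_int.1 hpp).dvd_or_dvd h4 with h | h
    · exfalso
      have h5 : p ∣ 2 := by exact_mod_cast h
      exact hp2 ((Nat.prime_dvd_prime_iff_eq hpp Nat.prime_two).1 h5)
    · exact h
  set W := LinearMap.ker φ with hW
  have hr : n + 1 ≤ Module.finrank ℤ W := by
    have h1 := Submodule.finrank_quotient_add_finrank (LinearMap.ker φ)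
    have h2 := Submodule.finrank_le (LinearMap.range φ)
    rw [← LinearEquiv.finrank_eq φ.quotKerEquivRange] at h2
    rw [Module.finrank_fin_fun] at h1 h2
    rw [hW]
    omega
  set r := Module.finrank ℤ W with hrdef
  let b := Module.finBasis ℤ W
  let M : Matrix (Fin r) (Fin (2*n+1)) (ZMod p) := Matrix.of fun k i => (((b k : Fin (2*n+1) → ℤ) i : ℤ) : ZMod p)
  have hli : LinearIndependent (ZMod p) M.row := by
    rw [Fintype.linearIndependent_iff]
    intro g hg k
    choose g' hg' using fun k => ZMod.intCast_surjective (g k)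
    have h1 : ∀ i, (p:ℤ) ∣ (((∑ k, g' k • b k : W) : Fin (2*n+1) → ℤ)) i := by
      intro i
      rw [← ZMod.intCast_zmod_eq_zero_iff_dvd]
      have := congrFun hg i
      simp only [Finset.sum_apply, Pi.smul_apply, smul_eq_mul, Pi.zero_apply, Matrix.row] at this
      rw [← this]
      push_cast
      simp only [Finset.sum_apply, Pi.smul_apply, smul_eq_mul]
      push_cast
      apply Finset.sum_congr rfl
      intro k _
      rw [hg']; rfl
    choose u hu using h1
    have h2 : φ u = 0 := by
      have h3 : ((∑ k, g' k • b k : W) : Fin (2*n+1) → ℤ) = (p:ℤ) • u := by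
        ext i; rw [hu]; simp
      have h4 := (∑ k, g' k • b k : W).2
      rw [h3, hW, LinearMap.mem_ker, map_smul] at h4
      exact (smul_eq_zero.1 h4).resolve_left hp0
    have h5 : (∑ k, g' k • b k : W) = (p:ℤ) • (⟨u, h2⟩ : W) := by
      apply Subtype.ext
      ext i; rw [hu]; simp
    have h6 := congrArg (fun x => b.repr x k) h5
    simp only [map_sum, map_smul, Module.Basis.repr_self, Finsupp.coe_finsetSum, Finset.sum_apply, Finsupp.smul_apply, smul_eq_mul, Finsupp.single_apply] at h6
    simp at h6
    rw [← hg', h6]; simp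
  have hrank : M.rank = r := by rw [LinearIndependent.rank_matrix hli]; simp
  let Dg : Matrix (Fin (2*n+1)) (Fin (2*n+1)) (ZMod p) := Matrix.diagonal fun i => (a i : ZMod p)
  have hDu : IsUnit Dg.det := by
    rw [Matrix.det_diagonal, isUnit_iff_ne_zero, Finset.prod_ne_zero_iff]
    intro i _ h
    exact ha i ((ZMod.intCast_zmod_eq_zero_iff_dvd _ _).1 h)
  have hzero : M * (Dg * Mᵀ) = 0 := by
    ext k l
    rw [Matrix.mul_apply]
    have h1 := hpol (b k) (b l) (b k).2 (b l).2
    rw [← ZMod.intCast_zmod_eq_zero_iff_dvd] at h1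
    push_cast at h1
    rw [Matrix.zero_apply, ← h1]
    apply Finset.sum_congr rfl
    intro i _
    rw [Matrix.diagonal_mul]
    simp only [M, Matrix.of_apply, Matrix.transpose_apply]; ring
  have h7 := Matrix.rank_add_rank_le_card_of_mul_eq_zero hzero
  rw [Matrix.rank_mul_eq_right_of_isUnit_det _ _ hDu, Matrix.rank_transpose, hrank] at h7
  simp at h7
  omega

lemma kernel_coprime {n : ℕ} (D : ℕ) (hD : Odd D) (a : Fin (2*n+1) → ℤ) (ha : ∀ i, IsCoprime (a i) (D:ℤ))
    (φ : (Fin (2*n+1) → ℤ) →ₗ[ℤ] (Fin n → ℤ)) :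
    ∃ w, φ w = 0 ∧ IsCoprime (∑ i, a i * w i ^ 2) (D:ℤ) := by
  have key : ∀ s : Finset ℕ, (∀ p ∈ s, p.Prime ∧ p ∣ D) → ∃ w, φ w = 0 ∧ ∀ p ∈ s, ¬ (p:ℤ) ∣ ∑ i, a i * w i ^ 2 := by
    intro s
    induction s using Finset.induction_on with
    | empty => intro _; exact ⟨0, by simp⟩
    | insert p s hps ih =>
      intro hs
      obtain ⟨w, hw, hws⟩ := ih (fun q hq => hs q (Finset.mem_insert_of_mem hq))
      have hp := hs p (Finset.mem_insert_self _ _)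
      have : Fact p.Prime := ⟨hp.1⟩
      have hpi := Nat.prime_iff_prime_int.1 hp.1
      obtain ⟨w', hw', hwp⟩ := kernel_aniso p (by
        rintro rfl
        exact (Nat.not_even_iff_odd.2 hD) (even_iff_two_dvd.2 hp.2)) a (by
        intro i hi
        have h1 := (ha i).isUnit_of_dvd' hi (by exact_mod_cast hp.2)
        exact hpi.not_isUnit h1) φ
      set M : ℤ := ∏ q ∈ s, (q:ℤ) with hM
      refine ⟨(p:ℤ) • w + M • w', by rw [map_add, map_smul, map_smul, hw, hw']; simp, ?_⟩
      have hexp : ∑ i, a i * ((p:ℤ) • w + M • w') i ^ 2 = p^2 * (∑ i, a i * w i ^ 2) + (p * M) * (2 * ∑ i, a i * (w i * w' i)) + M^2 * ∑ i, a i * w' i ^ 2 := by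
        simp only [Finset.mul_sum]
        rw [← Finset.sum_add_distrib, ← Finset.sum_add_distrib]
        apply Finset.sum_congr rfl
        intro i _
        simp; ring
      intro q hq
      rw [hexp]
      rcases Finset.mem_insert.1 hq with rfl | hq
      · intro h
        rw [sq, mul_assoc, mul_assoc, add_assoc, ] at h
        have h2 := (Int.dvd_add_right (dvd_mul_right _ _)).1 h
        have h3 := (Int.dvd_add_right (dvd_mul_right _ _)).1 h2
        rcases hpi.dvd_or_dvd h3 with h4 | h4
        · have h5 := hpi.dvd_of_dvd_pow h4
          rw [hM, hpi.dvd_finsetProd_iff] at h5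
          obtain ⟨q', hq', hqq⟩ := h5
          have h6 : q ∣ q' := by exact_mod_cast hqq
          rw [(Nat.prime_dvd_prime_iff_eq hp.1 (hs q' (Finset.mem_insert_of_mem hq')).1).1 h6] at hps
          exact hps hq'
        · exact hwp h4
      · have hq1 := (hs q (Finset.mem_insert_of_mem hq)).1
        have hqi := Nat.prime_iff_prime_int.1 hq1
        have hqM : (q:ℤ) ∣ M := Finset.dvd_prod_of_mem _ hq
        intro h
        rw [add_assoc] at h
        have h2 : (q:ℤ) ∣ (p * M) * (2 * ∑ i, a i * (w i * w' i)) + M^2 * ∑ i, a i * w' i ^ 2 :=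
          dvd_add (Dvd.dvd.mul_right (Dvd.dvd.mul_left hqM _) _) (Dvd.dvd.mul_right (dvd_pow hqM (by norm_num)) _)
        have h3 := (dvd_add_left h2).1 h
        rcases hqi.dvd_or_dvd h3 with h4 | h4
        · have h5 := hqi.dvd_of_dvd_pow h4
          have h6 : q ∣ p := by exact_mod_cast h5
          rw [(Nat.prime_dvd_prime_iff_eq hq1 hp.1).1 h6] at hq
          exact hps hq
        · exact hws q hq h4
  obtain ⟨w, hw, hws⟩ := key D.primeFactors (fun p hp => ⟨Nat.prime_of_mem_primeFactors hp, Nat.dvd_of_mem_primeFactors hp⟩)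
  refine ⟨w, hw, ?_⟩
  rw [Int.isCoprime_iff_gcd_eq_one]
  by_contra hg
  obtain ⟨q, hq, hqd⟩ := Nat.exists_prime_and_dvd hg
  have hD0 : D ≠ 0 := by rintro rfl; simp at hD
  have h1 : (q:ℤ) ∣ ∑ i, a i * w i ^ 2 := (Int.natCast_dvd_natCast.2 hqd).trans (Int.gcd_dvd_left ..)
  have h2 : (q:ℤ) ∣ D := (Int.natCast_dvd_natCast.2 hqd).trans (Int.gcd_dvd_right ..)
  exact hws q (Nat.mem_primeFactors.2 ⟨hq, by exact_mod_cast h2, hD0⟩) h1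

abbrev Om (n : ℕ) := (Fin n × Fin n) ⊕ Fin n

lemma ortho_sum {V ι κ : Type*} [AddCommGroup V] [Fintype ι] [Fintype κ] (B : V →ₗ[ℤ] V →ₗ[ℤ] ℤ)
    (f : ι → V) (g : κ → V) (h : ∀ x y, B (f x) (g y) = 0) (α : ι → ℤ) (β : κ → ℤ) :
    B (∑ x, α x • f x) (∑ y, β y • g y) = 0 := by
  rw [map_sum B, LinearMap.sum_apply]
  apply Finset.sum_eq_zero
  intro x _
  rw [map_sum]
  apply Finset.sum_eq_zero
  intro y _
  simp [h]

/-- Coefficient vectors used in the decomposition of a symmetric matrix. -/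
def omv {n : ℕ} : Om n → Fin n → ℤ
  | Sum.inl (j, k) => fun i => (if i = j then 1 else 0) + (if i = k then 1 else 0)
  | Sum.inr j => fun i => if i = j then 1 else 0

def omc {n : ℕ} (h : ℤ) (A : Mat n) : Om n → ℤ
  | Sum.inl (j, k) => h * A j k
  | Sum.inr j => - ∑ k, A j k

lemma omv_omc {n : ℕ} (h D : ℤ) (hD : D ∣ 2 * h - 1) (A : Mat n) (hA : A.IsSymm) (i j : Fin n) :
    D ∣ (∑ ω, omv ω i * omv ω j * omc h A ω) - A i j := by
  have e : ∑ ω, omv ω i * omv ω j * omc h A ω = 2 * h * (if i = j then ∑ k, A i k else 0) + 2 * h * A i j - (if i = j then ∑ k, A i k else 0) := by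
    rw [Fintype.sum_sum_type, Fintype.sum_prod_type]
    simp only [omv, omc]
    have h2 : ∑ x : Fin n, (if i = x then (1:ℤ) else 0) * (if j = x then 1 else 0) * -∑ k, A x k = - (if i = j then ∑ k, A i k else 0) := by
      rw [Finset.sum_eq_single i]
      · by_cases hij : i = j
        · subst hij; simp
        · simp [hij, Ne.symm hij]
      · intro b _ hb; simp [hb.symm]
      · simp
    rw [h2, sub_eq_add_neg]
    congr 1
    have h3 : ∀ x y : Fin n, (((if i = x then (1:ℤ) else 0) + if i = y then 1 else 0) * ((if j = x then 1 else 0) + if j = y then 1 else 0) * (h * A x y)) =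
      (if i = x then (if j = x then h * A x y else 0) else 0) + (if i = x then (if j = y then h * A x y else 0) else 0)
       + (if i = y then (if j = x then h * A x y else 0) else 0) + (if i = y then (if j = y then h * A x y else 0) else 0) := by
      intro x y
      split_ifs <;> ring
    simp only [h3, Finset.sum_add_distrib]
    have s1 : ∑ x : Fin n, ∑ y : Fin n, (if i = x then (if j = x then h * A x y else 0) else 0) = h * (if i = j then ∑ k, A i k else 0) := by
      rw [Finset.sum_eq_single i]
      · by_cases hij : i = j
        · subst hij; simp [Finset.mul_sum]
        · simp [hij, Ne.symm hij]
      · intro b _ hb; simp [hb.symm]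
      · simp
    have s2 : ∑ x : Fin n, ∑ y : Fin n, (if i = x then (if j = y then h * A x y else 0) else 0) = h * A i j := by
      rw [Finset.sum_eq_single i]
      · simp
      · intro b _ hb; simp [hb.symm]
      · simp
    have s3 : ∑ x : Fin n, ∑ y : Fin n, (if i = y then (if j = x then h * A x y else 0) else 0) = h * A i j := by
      rw [Finset.sum_eq_single j]
      · simp [hA.apply]
      · intro b _ hb; simp [hb.symm]
      · simp
    have s4 : ∑ x : Fin n, ∑ y : Fin n, (if i = y then (if j = y then h * A x y else 0) else 0) = h * (if i = j then ∑ k, A i k else 0) := by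
      rw [Finset.sum_comm, Finset.sum_eq_single i]
      · by_cases hij : i = j
        · subst hij; simp [Finset.mul_sum]
          exact Finset.sum_congr rfl (fun k _ => by rw [hA.apply])
        · simp [hij, Ne.symm hij]
      · intro b _ hb; simp [hb.symm]
      · simp
    rw [s1, s2, s3, s4]; ring
  obtain ⟨k, hk⟩ := hD
  rw [e]
  generalize (if i = j then ∑ k, A i k else 0) = s
  exact ⟨k * (s + A i j), by linear_combination (s + A i j) * hk⟩

lemma omv_zero {n : ℕ} (h : ℤ) (A : Mat n) (hA : A.IsSymm) (i : Fin n) (hi : ∀ j, A i j = 0) (ω : Om n) :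
    omv ω i = 0 ∨ omc h A ω = 0 := by
  have hi' : ∀ j, A j i = 0 := fun j => by rw [hA.apply]; exact hi j
  rcases ω with ⟨j, k⟩ | j
  · simp only [omv, omc]
    by_cases h1 : i = j
    · subst h1; right; simp [hi]
    · by_cases h2 : i = k
      · subst h2; right; simp [hi']
      · left; simp [h1, h2]
  · simp only [omv, omc]
    by_cases h1 : i = j
    · subst h1; right; simp [hi]
    · left; simp [h1]

lemma good_primes {n : ℕ} {V : Type*} [AddCommGroup V] (B : V →ₗ[ℤ] V →ₗ[ℤ] ℤ)
    (D : ℕ) (hD0 : 0 < D) (hD : Odd D) (e : (Om n × Fin 3) × Fin (2*n+1) → V)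
    (hort : ∀ x y, x ≠ y → B (e x) (e y) = 0) (hco : ∀ x, IsCoprime (B (e x) (e x)) (D:ℤ))
    (v : Fin n → V) (A : Mat n) (hA : A.IsSymm) :
    ∃ z : Fin n → V, (∀ i, z i ∈ Submodule.span ℤ (Set.range e)) ∧ (∀ i j, B (z i) (v j) = 0) ∧
      (∀ i j, (D:ℤ) ∣ B (z i) (z j) - A i j) ∧ ∀ i, (∀ j, A i j = 0) → z i = 0 := by
  have hw : ∀ x : Om n × Fin 3, ∃ c : Fin (2*n+1) → ℤ, (∀ j, B (∑ i, c i • e (x,i)) (v j) = 0) ∧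
      IsCoprime (B (∑ i, c i • e (x,i)) (∑ i, c i • e (x,i))) (D:ℤ) := by
    intro x
    obtain ⟨c, hc, hc2⟩ := kernel_coprime D hD (fun i => B (e (x,i)) (e (x,i))) (fun i => hco _)
      (LinearMap.pi (fun j => (B.flip (v j)) ∘ₗ Fintype.linearCombination ℤ (fun i => e (x,i))))
    refine ⟨c, ?_, ?_⟩
    · intro j
      have := congrFun hc j
      simpa [Fintype.linearCombination_apply] using this
    · rw [gram_sum B (fun i => e (x,i)) (fun i i' hne => hort _ _ (by simpa using hne))]
      convert hc2 using 2
      ring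
  choose c hc1 hc2 using hw
  set w : Om n × Fin 3 → V := fun x => ∑ i, c x i • e (x,i) with hwdef
  have hwort : ∀ x y, x ≠ y → B (w x) (w y) = 0 := by
    intro x y hxy
    apply ortho_sum B
    intro i j
    apply hort
    simp [hxy]
  have hwspan : ∀ x, w x ∈ Submodule.span ℤ (Set.range e) := by
    intro x
    apply Submodule.sum_mem
    intro i _
    exact Submodule.smul_mem _ _ (Submodule.subset_span ⟨_, rfl⟩)
  obtain ⟨h, hh⟩ : ∃ h : ℤ, (D:ℤ) ∣ 2 * h - 1 := by
    obtain ⟨k, hk⟩ := hD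
    exact ⟨k+1, 1, by rw [hk]; push_cast; ring⟩
  have hf : ∀ ω : Om n, ∃ s : Fin 3 → ℤ, (D:ℤ) ∣ (∑ i, s i * s i * B (w (ω,i)) (w (ω,i))) - omc h A ω ∧ (omc h A ω = 0 → s = 0) := by
    intro ω
    by_cases h0 : omc h A ω = 0
    · exact ⟨0, by simp [h0]⟩
    · obtain ⟨x, y, z, hxyz⟩ := ternary D hD0 hD (B (w (ω,0)) (w (ω,0))) (B (w (ω,1)) (w (ω,1))) (B (w (ω,2)) (w (ω,2))) (omc h A ω) (hc2 _) (hc2 _) (hc2 _)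
      refine ⟨![x,y,z], ?_, fun h => absurd h h0⟩
      obtain ⟨k, hk⟩ := hxyz
      refine ⟨k, ?_⟩
      rw [← hk, Fin.sum_univ_three]
      simp; ring
  choose s hs1 hs2 using hf
  set f : Om n → V := fun ω => ∑ i, s ω i • w (ω, i) with hfdef
  have hfort : ∀ x y, x ≠ y → B (f x) (f y) = 0 := by
    intro x y hxy
    apply ortho_sum B
    intro i j
    apply hwort
    simp [hxy]
  refine ⟨fun i => ∑ ω, omv ω i • f ω, ?_, ?_, ?_, ?_⟩
  · intro i
    exact Submodule.sum_mem _ (fun ω _ => Submodule.smul_mem _ _ (Submodule.sum_mem _ (fun j _ => Submodule.smul_mem _ _ (hwspan _))))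
  · intro i j
    have hwv : ∀ x, B (w x) (v j) = 0 := fun x => hc1 x j
    have hfv : ∀ ω, B (f ω) (v j) = 0 := by
      intro ω
      simp only [hfdef, map_sum, LinearMap.sum_apply, map_smul, LinearMap.smul_apply, hwv, smul_zero, Finset.sum_const_zero]
    simp only [map_sum, LinearMap.sum_apply, map_smul, LinearMap.smul_apply, hfv, smul_zero, Finset.sum_const_zero]
  · intro i j
    rw [gram_sum B f hfort]
    have h1 := omv_omc h D hh A hA i j
    have h2 : (D:ℤ) ∣ ∑ ω, omv ω i * omv ω j * (B (f ω) (f ω) - omc h A ω) := by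
      apply Finset.dvd_sum
      intro ω _
      apply Dvd.dvd.mul_left
      rw [hfdef]
      beta_reduce
      rw [gram_sum B (fun i => w (ω,i)) (fun i i' hne => hwort _ _ (by simpa using hne))]
      exact hs1 ω
    have := dvd_add h2 h1
    simp only [mul_sub, Finset.sum_sub_distrib] at this
    simpa using this
  · intro i hi
    apply Finset.sum_eq_zero
    intro ω _
    rcases omv_zero h A hA i hi ω with h1 | h1
    · rw [h1, zero_smul]
    · simp [hfdef, hs2 ω h1]

/-- Schur complement of the upper left entry. -/
noncomputable def schur {l : ℕ} (S : Matrix (Fin (l+1)) (Fin (l+1)) ℝ) : Matrix (Fin l) (Fin l) ℝ :=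
  Matrix.of fun i j => S i.succ j.succ - S 0 i.succ * S 0 j.succ / S 0 0

/-- Reducedness of a real symmetric matrix with lower bound `m` for the first minimum. -/
def Red : (l : ℕ) → ℝ → Matrix (Fin l) (Fin l) ℝ → Prop
  | 0, _, _ => True
  | l+1, m, S => 0 < S 0 0 ∧ m ≤ 2 * S 0 0 ∧ (∀ k : Fin l, |S 0 k.succ| ≤ S 0 0) ∧ Red l (S 0 0) (schur S)

lemma schur_smul {l : ℕ} (c : ℝ) (hc : 0 < c) (S : Matrix (Fin (l+1)) (Fin (l+1)) ℝ) :
    schur (c • S) = c • schur S := by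
  ext i j
  simp only [schur, Matrix.of_apply, Matrix.smul_apply, smul_eq_mul]
  rcases eq_or_ne (S 0 0) 0 with h | h
  · rw [h]; simp
  · field_simp

lemma Red.smul {l : ℕ} {m : ℝ} {S : Matrix (Fin l) (Fin l) ℝ} (c : ℝ) (hc : 0 < c) (h : Red l m S) :
    Red l (c * m) (c • S) := by
  induction l generalizing m with
  | zero => trivial
  | succ l ih =>
    obtain ⟨h1, h2, h3, h4⟩ := h
    refine ⟨by simpa using mul_pos hc h1, ?_, ?_, ?_⟩
    · simp only [Matrix.smul_apply, smul_eq_mul]; nlinarith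
    · intro k
      simp only [Matrix.smul_apply, smul_eq_mul, abs_mul, abs_of_pos hc]
      exact mul_le_mul_of_nonneg_left (h3 k) hc.le
    · rw [schur_smul c hc]
      exact ih h4

/-- Unimodular equivalence. -/
def Uni {l : ℕ} (G G' : Mat l) : Prop := ∃ T U : Mat l, T * U = 1 ∧ T * G * Tᵀ = G'

lemma Uni.refl {l : ℕ} (G : Mat l) : Uni G G := ⟨1, 1, by simp, by simp⟩

lemma Uni.trans {l : ℕ} {A B C : Mat l} (h1 : Uni A B) (h2 : Uni B C) : Uni A C := by
  obtain ⟨T, U, h, rfl⟩ := h1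
  obtain ⟨T', U', h', rfl⟩ := h2
  refine ⟨T' * T, U * U', ?_, ?_⟩
  · rw [Matrix.mul_assoc, ← Matrix.mul_assoc T, h, Matrix.one_mul, h']
  · simp only [Matrix.transpose_mul, Matrix.mul_assoc]

lemma Uni.symm {l : ℕ} {A B : Mat l} (h1 : Uni A B) : Uni B A := by
  obtain ⟨T, U, h, rfl⟩ := h1
  have h' := mul_eq_one_comm.1 h
  refine ⟨U, T, h', ?_⟩
  have : U * (T * A * Tᵀ) * Uᵀ = (U * T) * A * (U * T)ᵀ := by simp only [Matrix.transpose_mul, Matrix.mul_assoc]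
  rw [this, h']; simp

lemma Uni.rep {l : ℕ} {A B : Mat l} (h1 : Uni A B) : Represents A B := by
  obtain ⟨T, U, h, h2⟩ := h1
  exact ⟨T, h2⟩

lemma Uni.posDef {l : ℕ} {A B : Mat l} (h1 : Uni A B) (hA : PosDefInt A) : PosDefInt B := by
  obtain ⟨T, U, h, hT⟩ := h1.symm
  refine posDef_of_rep hA ?_ hT
  obtain ⟨T, U, h, rfl⟩ := h1
  rw [Matrix.IsSymm]
  simp only [Matrix.transpose_mul, Matrix.transpose_transpose, hA.1.eq, Matrix.mul_assoc]

lemma Uni.nice {l : ℕ} {A B : Mat l} (h1 : Uni A B) (hA : Nice A) : Nice B := by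
  obtain ⟨T, U, h, rfl⟩ := h1
  obtain ⟨d, X, hd, h1, h2, h3⟩ := hA
  have h' := mul_eq_one_comm.1 h
  have ht : Tᵀ * Uᵀ = 1 := by rw [← Matrix.transpose_mul, h', Matrix.transpose_one]
  have ht' : Uᵀ * Tᵀ = 1 := by rw [← Matrix.transpose_mul, h, Matrix.transpose_one]
  refine ⟨d, Uᵀ * X * U, hd, ?_, ?_, h3⟩
  · have : T * A * Tᵀ * (Uᵀ * X * U) = T * (A * ((Tᵀ * Uᵀ) * X)) * U := by simp only [Matrix.mul_assoc]
    rw [this, ht, Matrix.one_mul, h1, Matrix.mul_smul, Matrix.smul_mul, Matrix.mul_one, h]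
  · have : Uᵀ * X * U * (T * A * Tᵀ) = Uᵀ * (X * ((U * T) * A)) * Tᵀ := by simp only [Matrix.mul_assoc]
    rw [this, h', Matrix.one_mul, h2, Matrix.mul_smul, Matrix.smul_mul, Matrix.mul_one, ht']

def schurI {l : ℕ} (G : Mat (l+1)) : Mat l :=
  Matrix.of fun i j => G 0 0 * G i.succ j.succ - G 0 i.succ * G 0 j.succ

def blk {l : ℕ} (c : Fin l → ℤ) (T : Mat l) : Mat (l+1) :=
  Matrix.of (Fin.cons (Fin.cons 1 0) (fun k => Fin.cons (c k) (T k)))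

@[simp] lemma blk_00 {l : ℕ} (c : Fin l → ℤ) (T : Mat l) : blk c T 0 0 = 1 := rfl
@[simp] lemma blk_0s {l : ℕ} (c : Fin l → ℤ) (T : Mat l) (k) : blk c T 0 (Fin.succ k) = 0 := rfl
@[simp] lemma blk_s0 {l : ℕ} (c : Fin l → ℤ) (T : Mat l) (k) : blk c T (Fin.succ k) 0 = c k := rfl
@[simp] lemma blk_ss {l : ℕ} (c : Fin l → ℤ) (T : Mat l) (k m) : blk c T (Fin.succ k) (Fin.succ m) = T k m := rfl

lemma blk_inv {l : ℕ} (c : Fin l → ℤ) (T U : Mat l) (h : T * U = 1) : blk c T * blk (- (U *ᵥ c)) U = 1 := by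
  have h2 : T *ᵥ (-(U *ᵥ c)) = - c := by rw [Matrix.mulVec_neg, Matrix.mulVec_mulVec, h, Matrix.one_mulVec]
  ext i j
  rw [Matrix.mul_apply, Fin.sum_univ_succ]
  refine Fin.cases ?_ (fun i => ?_) i <;> refine Fin.cases ?_ (fun j => ?_) j
  · simp
  · simp [Matrix.one_apply, (Fin.succ_ne_zero j).symm]
  · have := congrFun h2 i
    rw [Matrix.mulVec, dotProduct] at this
    simp only [blk_s0, blk_ss, blk_00]
    rw [this]; simp
  · have := congrFun (congrFun h i) j
    rw [Matrix.mul_apply] at this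
    simp only [blk_s0, blk_ss, blk_0s]
    rw [this]; simp [Matrix.one_apply]

lemma blk_conj {l : ℕ} (c : Fin l → ℤ) (T : Mat l) (G : Mat (l+1)) (hG : G.IsSymm) :
    (blk c T * G * (blk c T)ᵀ) 0 0 = G 0 0 ∧
    (∀ k, (blk c T * G * (blk c T)ᵀ) 0 (Fin.succ k) = c k * G 0 0 + ∑ m, T k m * G 0 (Fin.succ m)) ∧
    schurI (blk c T * G * (blk c T)ᵀ) = T * schurI G * Tᵀ := by
  have e00 : (blk c T * G * (blk c T)ᵀ) 0 0 = G 0 0 := by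
    simp [Matrix.mul_apply, Fin.sum_univ_succ]
  have e0k : ∀ k, (blk c T * G * (blk c T)ᵀ) 0 (Fin.succ k) = c k * G 0 0 + ∑ m, T k m * G 0 (Fin.succ m) := by
    intro k
    simp only [Matrix.mul_apply, Fin.sum_univ_succ, Matrix.transpose_apply, blk_00, blk_0s, blk_s0, blk_ss]
    simp
    rw [mul_comm]
    congr 1
    exact Finset.sum_congr rfl (fun _ _ => mul_comm _ _)
  refine ⟨e00, e0k, ?_⟩
  ext i j
  have hij : (blk c T * G * (blk c T)ᵀ) i.succ j.succ = c i * c j * G 0 0 + c j * ∑ m, T i m * G 0 (Fin.succ m) + c i * ∑ m, T j m * G 0 (Fin.succ m)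
     + ∑ k, ∑ m, T i m * G m.succ k.succ * T j k := by
    simp only [Matrix.mul_apply, Fin.sum_univ_succ, Matrix.transpose_apply, blk_00, blk_0s, blk_s0, blk_ss]
    simp only [add_mul, Finset.sum_add_distrib, Finset.sum_mul, Finset.mul_sum, hG.apply 0]
    have f1 : ∀ x : Fin l, T i x * G x.succ 0 * c j = c j * (T i x * G 0 x.succ) := fun x => by rw [hG.apply 0 x.succ]; ring
    have f2 : ∀ x : Fin l, c i * G 0 x.succ * T j x = c i * (T j x * G 0 x.succ) := fun x => by ring
    simp only [f1, f2]
    ring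
  have hR : (T * schurI G * Tᵀ) i j = G 0 0 * (∑ k, ∑ m, T i m * G m.succ k.succ * T j k) - (∑ m, T i m * G 0 (Fin.succ m)) * ∑ m, T j m * G 0 (Fin.succ m) := by
    simp only [Matrix.mul_apply, Matrix.transpose_apply, schurI, Matrix.of_apply]
    have hs : (∑ m, T i m * G 0 (Fin.succ m)) * (∑ m, T j m * G 0 (Fin.succ m)) = ∑ k, ∑ m, T i m * G 0 (Fin.succ m) * (T j k * G 0 (Fin.succ k)) := by
      rw [Finset.sum_mul_sum, Finset.sum_comm]
    rw [hs, Finset.mul_sum, ← Finset.sum_sub_distrib]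
    apply Finset.sum_congr rfl
    intro k _
    rw [Finset.mul_sum, Finset.sum_mul, ← Finset.sum_sub_distrib]
    apply Finset.sum_congr rfl
    intro m _
    ring
  rw [hR]
  simp only [schurI, Matrix.of_apply]
  rw [e00, e0k, e0k, hij]
  ring

lemma schurI_posDef {l : ℕ} {G : Mat (l+1)} (hG : PosDefInt G) : PosDefInt (schurI G) := by
  have h00 : 0 < G 0 0 := by
    have := hG.2 (Pi.single 0 1) (by simp)
    simpa using this
  refine ⟨?_, ?_⟩
  · ext i j
    simp only [Matrix.transpose_apply, schurI, Matrix.of_apply]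
    rw [hG.1.apply i.succ j.succ]; ring
  · intro x hx
    set g := ∑ m, x m * G 0 (Fin.succ m) with hg
    have hy := hG.2 (Fin.cons (-g) (fun k => G 0 0 * x k)) (by
      intro h
      apply hx
      ext k
      have := congrFun h k.succ
      simp at this
      rcases this with h | h
      · omega
      · exact h)
    have : (Fin.cons (-g) (fun k => G 0 0 * x k) : Fin (l+1) → ℤ) ⬝ᵥ G *ᵥ (Fin.cons (-g) (fun k => G 0 0 * x k)) = G 0 0 * (x ⬝ᵥ schurI G *ᵥ x) := by
      simp only [Matrix.mulVec, dotProduct, Fin.sum_univ_succ, Fin.cons_zero, Fin.cons_succ, schurI, Matrix.of_apply]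
      have f1 : ∑ k : Fin l, G 0 k.succ * (G 0 0 * x k) = G 0 0 * g := by
        rw [hg, Finset.mul_sum]; exact Finset.sum_congr rfl (fun _ _ => by ring)
      have f3 : ∀ i : Fin l, ∑ k, (G 0 0 * G i.succ k.succ - G 0 i.succ * G 0 k.succ) * x k = G 0 0 * ∑ k, G i.succ k.succ * x k - G 0 i.succ * g := by
        intro i
        rw [hg, Finset.mul_sum, Finset.mul_sum, ← Finset.sum_sub_distrib]; exact Finset.sum_congr rfl (fun _ _ => by ring)
      have f4 : ∀ i : Fin l, ∑ k, G i.succ k.succ * (G 0 0 * x k) = G 0 0 * ∑ k, G i.succ k.succ * x k := by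
        intro i
        rw [Finset.mul_sum]; exact Finset.sum_congr rfl (fun _ _ => by ring)
      simp only [f1, f3, f4]
      have f5 : ∑ i : Fin l, G 0 0 * x i * (G i.succ 0 * -g + G 0 0 * ∑ k, G i.succ k.succ * x k) = G 0 0 * ∑ i, x i * (G 0 0 * ∑ k, G i.succ k.succ * x k - G 0 i.succ * g) := by
        rw [Finset.mul_sum]
        exact Finset.sum_congr rfl (fun i _ => by rw [hG.1.apply 0 i.succ]; ring)
      rw [f5]; ring
    rw [this] at hy
    exact pos_of_mul_pos_right hy h00.le

lemma schur_cast {l : ℕ} (G : Mat (l+1)) (h0 : 0 < G 0 0) :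
    schur (G.map (fun x : ℤ => (x:ℝ))) = ((G 0 0 : ℝ)⁻¹) • (schurI G).map (fun x : ℤ => (x:ℝ)) := by
  have h : (G 0 0 : ℝ) ≠ 0 := by exact_mod_cast h0.ne'
  ext i j
  simp only [schur, schurI, Matrix.of_apply, Matrix.map_apply, Matrix.smul_apply, smul_eq_mul]
  push_cast
  field_simp

lemma reduction (l : ℕ) (G : Mat l) (hG : PosDefInt G) :
    ∃ G', Uni G G' ∧ Red l 0 (G'.map (fun x : ℤ => (x:ℝ))) := by
  classical
  induction l with
  | zero => exact ⟨G, Uni.refl G, trivial⟩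
  | succ l ih =>
    have h00 : ∀ {G : Mat (l+1)}, PosDefInt G → ∀ i, 0 < G i i := by
      intro G hG i
      have := hG.2 (Pi.single i 1) (by simp)
      simpa using this
    have hex : ∃ k : ℕ, ∃ G', Uni G G' ∧ G' 0 0 = k :=
      ⟨(G 0 0).toNat, G, Uni.refl G, by rw [Int.toNat_of_nonneg (h00 hG 0).le]⟩
    obtain ⟨G1, hG1, hk⟩ := Nat.find_spec hex
    have hmin : ∀ G', Uni G G' → G1 0 0 ≤ G' 0 0 := by
      intro G' hG'
      by_contra hlt
      push Not at hlt
      have hp := h00 (hG'.posDef hG) 0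
      refine Nat.find_min hex (m := (G' 0 0).toNat) ?_ ⟨G', hG', by rw [Int.toNat_of_nonneg hp.le]⟩
      omega
    have hG1p := hG1.posDef hG
    have hd := h00 hG1p 0
    obtain ⟨H, ⟨T, U, hTU, hH⟩, hHr⟩ := ih (schurI G1) (schurI_posDef hG1p)
    set g : Fin l → ℤ := fun k => ∑ m, T k m * G1 0 (Fin.succ m) with hg
    set c : Fin l → ℤ := fun k => - ((2 * g k + G1 0 0) / (2 * G1 0 0)) with hc
    have hcg : ∀ k, 2 * |c k * G1 0 0 + g k| ≤ G1 0 0 := by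
      intro k
      have h1 := Int.emod_add_mul_ediv (2 * g k + G1 0 0) (2 * G1 0 0)
      have h2 := Int.emod_nonneg (2 * g k + G1 0 0) (show 2 * G1 0 0 ≠ 0 by omega)
      have h3 := Int.emod_lt_of_pos (2 * g k + G1 0 0) (show 0 < 2 * G1 0 0 by omega)
      have h4 : 2 * (c k * G1 0 0 + g k) = (2 * g k + G1 0 0) % (2 * G1 0 0) - G1 0 0 := by
        simp only [hc]; linear_combination - h1
      have : 2 * |c k * G1 0 0 + g k| = |2 * (c k * G1 0 0 + g k)| := by rw [abs_mul]; simp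
      rw [this, h4, abs_le]
      constructor <;> linarith
    obtain ⟨e00, e0k, es⟩ := blk_conj c T G1 hG1p.1
    set G2 := blk c T * G1 * (blk c T)ᵀ with hG2
    have hU2 : Uni G G2 := hG1.trans ⟨blk c T, _, blk_inv c T U hTU, rfl⟩
    have hG2p := hU2.posDef hG
    refine ⟨G2, hU2, ?_⟩
    rw [hH] at es
    have hdR : (0:ℝ) < G2 0 0 := by rw [e00]; exact_mod_cast hd
    have hRed : Red l 0 (schur (G2.map (fun x : ℤ => (x:ℝ)))) := by
      rw [schur_cast _ (by rw [e00]; exact hd), es]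
      have := hHr.smul ((G2 0 0 : ℝ)⁻¹) (inv_pos.2 hdR)
      rwa [mul_zero] at this
    have hk2 : ∀ k : Fin l, 2 * |(G2 0 k.succ : ℝ)| ≤ G2 0 0 := by
      intro k
      have := hcg k
      rw [e00, e0k]
      exact_mod_cast this
    refine ⟨by simpa using hdR, by simpa using hdR.le, ?_, ?_⟩
    · intro k
      have := hk2 k
      simp only [Matrix.map_apply]
      have := abs_nonneg (G2 0 k.succ : ℝ)
      linarith
    · cases l with
      | zero => trivial
      | succ l =>
        refine ⟨hRed.1, ?_, hRed.2.2.1, hRed.2.2.2⟩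
        have hsw : G1 0 0 ≤ G2 1 1 := by
          have hP : Uni G2 (G2.submatrix (Equiv.swap 0 1) (Equiv.swap 0 1)) := by
            refine ⟨(Equiv.swap (0 : Fin (l+1+1)) 1).permMatrix ℤ, (Equiv.swap (0 : Fin (l+1+1)) 1).permMatrix ℤ, ?_, ?_⟩
            · rw [← Matrix.permMatrix_mul]; simp
            · rw [Matrix.transpose_permMatrix, Equiv.swap_inv]
              unfold Equiv.Perm.permMatrix
              rw [PEquiv.toMatrix_toPEquiv_mul, PEquiv.mul_toMatrix_toPEquiv, Equiv.symm_swap]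
              rfl
          have := hmin _ (hU2.trans hP)
          simpa using this
        have h1 := hk2 0
        simp only [Matrix.map_apply, schur, Matrix.of_apply]
        have h2 : (G2 0 0 : ℝ) ≤ G2 1 1 := by rw [e00]; exact_mod_cast hsw
        have h3 : (G2 0 (Fin.succ 0) : ℝ) * G2 0 (Fin.succ 0) ≤ (G2 0 0 : ℝ)^2/4 := by
          rw [← abs_mul_abs_self]
          nlinarith [abs_nonneg (G2 0 (Fin.succ 0) : ℝ)]
        have h4 : (G2 0 (Fin.succ 0) : ℝ) * G2 0 (Fin.succ 0) / G2 0 0 ≤ G2 0 0 / 4 := by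
          rw [div_le_iff₀ hdR]; nlinarith
        have h5 : (Fin.succ 0 : Fin (l+1+1)) = 1 := rfl
        rw [h5] at h4 ⊢
        linarith

lemma num_x (d q η s x : ℝ) (hd : 0 < d) (hq : 1 ≤ q) (hη0 : 0 < η) (hη : η ≤ 1/2) (hs : |s| ≤ d)
    (hx : x = q * s / ((1-η)*d)) : |x| ≤ 2 * q ∧ s = x * ((1-η)*d) / q := by
  have h1 : 0 < (1-η)*d := by apply mul_pos <;> linarith
  constructor
  · rw [hx, abs_div, abs_mul, abs_of_pos h1, abs_of_pos (by linarith : 0 < q), div_le_iff₀ h1]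
    have : q * |s| ≤ q * d := by gcongr
    nlinarith [mul_pos (by linarith : 0 < q) hd]
  · have h2 : 1 - η ≠ 0 := by linarith
    have h3 : q ≠ 0 := by linarith
    rw [hx]; field_simp

lemma num1 (d q η t s w : ℝ) (hd : 0 < d) (hq : 1 ≤ q) (hη0 : 0 < η) (hη : η ≤ 1/2) (ht : 0 ≤ t)
    (ht1 : t * q^2 ≤ (1-η)*d) (ht2 : (1-η)*d - q^2 ≤ t * q^2) (hs : |s| ≤ d)
    (hw : |w - q * s / ((1-η)*d)| ≤ 1/2) : |t * q * w - s| ≤ 2 * q^2 + d / (2*q) := by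
  obtain ⟨x, hx⟩ : ∃ x, x = q * s / ((1-η)*d) := ⟨_, rfl⟩
  obtain ⟨hx1, hx2⟩ := num_x d q η s x hd hq hη0 hη hs hx
  rw [← hx] at hw
  have hq0 : 0 < q := by linarith
  have e : t * q * w - s = t * q * (w - x) + (t * q^2 - (1-η)*d) / q * x := by
    nth_rewrite 1 [hx2]; field_simp; ring
  rw [e]
  have b1 : |t * q * (w - x)| ≤ d / (2*q) := by
    rw [abs_mul, abs_of_nonneg (by positivity : 0 ≤ t * q), le_div_iff₀ (by positivity)]
    have : t * q * |w - x| ≤ t * q * (1/2) := by gcongr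
    nlinarith
  have b2 : |(t * q^2 - (1-η)*d) / q * x| ≤ 2 * q^2 := by
    rw [abs_mul]
    have : |(t * q^2 - (1-η)*d) / q| ≤ q := by
      rw [abs_div, abs_of_pos hq0, div_le_iff₀ hq0, abs_le]
      constructor <;> nlinarith
    calc _ ≤ q * (2*q) := by gcongr
      _ = _ := by ring
  have := abs_add_le (t * q * (w - x)) ((t * q^2 - (1-η)*d) / q * x)
  linarith

lemma num2 (d q η t s w s' w' : ℝ) (hd : 0 < d) (hq : 1 ≤ q) (hη0 : 0 < η) (hη : η ≤ 1/2) (ht : 0 ≤ t)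
    (ht1 : t * q^2 ≤ (1-η)*d) (ht2 : (1-η)*d - q^2 ≤ t * q^2) (hs : |s| ≤ d) (hs' : |s'| ≤ d)
    (hw : |w - q * s / ((1-η)*d)| ≤ 1/2) (hw' : |w' - q * s' / ((1-η)*d)| ≤ 1/2) :
    |t * w * w' - s * s' / d| ≤ 2 * η * d + 4 * q^2 + 3 * d / q := by
  obtain ⟨x, hx⟩ : ∃ x, x = q * s / ((1-η)*d) := ⟨_, rfl⟩
  obtain ⟨x', hx'⟩ : ∃ x, x = q * s' / ((1-η)*d) := ⟨_, rfl⟩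
  obtain ⟨hx1, hx2⟩ := num_x d q η s x hd hq hη0 hη hs hx
  obtain ⟨hx1', hx2'⟩ := num_x d q η s' x' hd hq hη0 hη hs' hx'
  rw [← hx] at hw
  rw [← hx'] at hw'
  have hq0 : 0 < q := by linarith
  have h1η : 0 < 1 - η := by linarith
  have e : t * w * w' - s * s' / d = t * ((w-x)*x' + x*(w'-x') + (w-x)*(w'-x')) + (x * x') * ((t*q^2 - (1-η)*d) / q^2) + s * s' / d * (η / (1-η)) := by
    rw [hx2, hx2']; field_simp; ring
  have hss : |s * s' / d| ≤ d := by
    rw [abs_div, abs_of_pos hd, div_le_iff₀ hd, abs_mul]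
    gcongr
  have b3 : |s * s' / d * (η / (1-η))| ≤ 2 * η * d := by
    rw [abs_mul, abs_of_nonneg (by positivity : 0 ≤ η / (1-η))]
    have : η / (1-η) ≤ 2 * η := by rw [div_le_iff₀ h1η]; nlinarith
    calc _ ≤ d * (2 * η) := by gcongr
      _ = _ := by ring
  have b2 : |(x * x') * ((t*q^2 - (1-η)*d) / q^2)| ≤ 4 * q^2 := by
    rw [abs_mul, abs_mul]
    have : |(t * q^2 - (1-η)*d) / q^2| ≤ 1 := by
      rw [abs_div, abs_of_pos (by positivity : 0 < q^2), div_le_iff₀ (by positivity), abs_le]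
      constructor <;> nlinarith
    calc _ ≤ (2*q) * (2*q) * 1 := by gcongr
      _ = _ := by ring
  have b1 : |t * ((w-x)*x' + x*(w'-x') + (w-x)*(w'-x'))| ≤ 3 * d / q := by
    rw [abs_mul, abs_of_nonneg ht]
    have c1 : |(w-x)*x'| ≤ q := by
      rw [abs_mul]
      calc _ ≤ (1/2) * (2 * q) := by gcongr
        _ = _ := by ring
    have c2 : |x*(w'-x')| ≤ q := by
      rw [abs_mul]
      calc _ ≤ (2*q) * (1/2) := by gcongr
        _ = _ := by ring
    have c3 : |(w-x)*(w'-x')| ≤ q := by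
      rw [abs_mul]
      calc _ ≤ (1/2) * (1/2 : ℝ) := by gcongr
        _ ≤ _ := by linarith
    have c4 : |(w-x)*x' + x*(w'-x') + (w-x)*(w'-x')| ≤ 3 * q := by
      have := abs_add_le ((w-x)*x' + x*(w'-x')) ((w-x)*(w'-x'))
      have := abs_add_le ((w-x)*x') (x*(w'-x'))
      linarith
    rw [le_div_iff₀ hq0]
    calc _ ≤ t * (3 * q) * q := by gcongr
      _ = 3 * (t * q^2) := by ring
      _ ≤ _ := by nlinarith
  rw [e]
  have := abs_add_le (t * ((w-x)*x' + x*(w'-x') + (w-x)*(w'-x')) + (x * x') * ((t*q^2 - (1-η)*d) / q^2)) (s * s' / d * (η / (1-η)))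
  have := abs_add_le (t * ((w-x)*x' + x*(w'-x') + (w-x)*(w'-x'))) ((x * x') * ((t*q^2 - (1-η)*d) / q^2))
  linarith

def sqm {l : ℕ} (v : Fin l → ℤ) : Mat l := Matrix.of fun i j => v i * v j

def pad {l : ℕ} (M : Mat l) : Mat (l+1) := Matrix.of (Fin.cons 0 (fun k => Fin.cons 0 (M k)))

@[simp] lemma pad_0 {l : ℕ} (M : Mat l) (j) : pad M 0 j = 0 := rfl
@[simp] lemma pad_s0 {l : ℕ} (M : Mat l) (k) : pad M (Fin.succ k) 0 = 0 := rfl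
@[simp] lemma pad_ss {l : ℕ} (M : Mat l) (k m) : pad M (Fin.succ k) (Fin.succ m) = M k m := rfl

lemma pad_mem {l : ℕ} (A : Set (Fin l → ℤ)) (A' : Set (Fin (l+1) → ℤ)) (h : ∀ v ∈ A, (Fin.cons 0 v : Fin (l+1) → ℤ) ∈ A')
    (M : Mat l) (hM : M ∈ Submodule.span ℕ (sqm '' A)) : pad M ∈ Submodule.span ℕ (sqm '' A') := by
  induction hM using Submodule.span_induction with
  | mem x hx =>
    obtain ⟨v, hv, rfl⟩ := hx
    apply Submodule.subset_span
    refine ⟨_, h v hv, ?_⟩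
    ext i j
    refine Fin.cases ?_ (fun i => ?_) i <;> refine Fin.cases ?_ (fun j => ?_) j <;> simp [sqm]
  | zero =>
    have : pad (0 : Mat l) = 0 := by
      ext i j
      refine Fin.cases ?_ (fun i => ?_) i <;> refine Fin.cases ?_ (fun j => ?_) j <;> simp
    rw [this]; exact Submodule.zero_mem _
  | add x y _ _ hx hy =>
    have : pad (x + y) = pad x + pad y := by
      ext i j
      refine Fin.cases ?_ (fun i => ?_) i <;> refine Fin.cases ?_ (fun j => ?_) j <;> simp
    rw [this]; exact Submodule.add_mem _ hx hy
  | smul a x _ hx =>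
    have : pad (a • x) = a • pad x := by
      ext i j
      refine Fin.cases ?_ (fun i => ?_) i <;> refine Fin.cases ?_ (fun j => ?_) j <;> simp only [pad_0, pad_s0, pad_ss, Matrix.smul_apply, smul_zero]
    rw [this]; exact Submodule.smul_mem _ _ hx

def evec {l : ℕ} (k : Fin l) (s : ℤ) : Fin (l+1) → ℤ := Fin.cons 1 (Pi.single k s)

lemma cone_decomp {l : ℕ} (R : Mat (l+1)) (hR : R.IsSymm) (t : ℤ) (ω : Fin (l+1) → ℤ) (Z : Mat (l+1))
    (hZ : Z = R - t • sqm ω) :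
    R = t • sqm ω + ∑ k : Fin l, |Z 0 k.succ| • sqm (evec k (SignType.sign (Z 0 k.succ) : ℤ))
      + (Z 0 0 - ∑ k : Fin l, |Z 0 k.succ|) • sqm (Fin.cons 1 0)
      + pad (Matrix.of fun k m => Z k.succ m.succ - if k = m then |Z 0 k.succ| else 0) := by
  have hZR : ∀ i j, R i j = t * (ω i * ω j) + Z i j := by
    intro i j
    rw [hZ]
    simp only [Matrix.sub_apply, Matrix.smul_apply, smul_eq_mul, sqm, Matrix.of_apply]; ring
  have hsg : ∀ z : ℤ, |z| * (SignType.sign z : ℤ) = z := fun z => abs_mul_sign z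
  have hsg2 : ∀ z : ℤ, |z| * ((SignType.sign z : ℤ) * (SignType.sign z : ℤ)) = |z| := by
    intro z
    rw [← mul_assoc, hsg]
    exact self_mul_sign z
  have hZs : Z.IsSymm := by
    ext i j
    have := hZR i j; have := hZR j i; have := hR.apply i j
    simp only [Matrix.transpose_apply]
    linarith [mul_comm (ω i) (ω j), congrArg (fun x => t * x) (mul_comm (ω i) (ω j))]
  ext i j
  simp only [Matrix.add_apply, Matrix.sum_apply, Matrix.smul_apply, smul_eq_mul, sqm, Matrix.of_apply]
  rw [hZR i j]
  simp only [evec]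
  refine Fin.cases ?_ (fun i => ?_) i <;> refine Fin.cases ?_ (fun j => ?_) j
  · simp only [Fin.cons_zero, pad_0]; simp
  · simp only [Fin.cons_zero, Fin.cons_succ, pad_0, one_mul]
    have : ∑ k : Fin l, |Z 0 k.succ| * (Pi.single k (SignType.sign (Z 0 k.succ) : ℤ) : Fin l → ℤ) j = Z 0 j.succ := by
      rw [Finset.sum_eq_single j]
      · rw [Pi.single_eq_same, hsg]
      · intro b _ hb; rw [Pi.single_eq_of_ne (Ne.symm hb)]; simp
      · simp
    rw [this]; simp
  · simp only [Fin.cons_zero, Fin.cons_succ, pad_s0, mul_one]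
    have : ∑ k : Fin l, |Z 0 k.succ| * (Pi.single k (SignType.sign (Z 0 k.succ) : ℤ) : Fin l → ℤ) i = Z 0 i.succ := by
      rw [Finset.sum_eq_single i]
      · rw [Pi.single_eq_same, hsg]
      · intro b _ hb; rw [Pi.single_eq_of_ne (Ne.symm hb)]; simp
      · simp
    rw [this, hZs.apply 0 i.succ]; simp
  · simp only [Fin.cons_succ, pad_ss, Matrix.of_apply]
    have : ∑ k : Fin l, |Z 0 k.succ| * ((Pi.single k (SignType.sign (Z 0 k.succ) : ℤ) : Fin l → ℤ) i * (Pi.single k (SignType.sign (Z 0 k.succ) : ℤ) : Fin l → ℤ) j) = if i = j then |Z 0 i.succ| else 0 := by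
      rw [Finset.sum_eq_single i]
      · rw [Pi.single_eq_same]
        split_ifs with h
        · subst h; rw [Pi.single_eq_same, hsg2]
        · rw [Pi.single_eq_of_ne (Ne.symm h)]; simp
      · intro b _ hb; rw [Pi.single_eq_of_ne (Ne.symm hb)]; simp
      · simp
    rw [this]; simp

lemma smul_sq_mem {l : ℕ} (A : Set (Fin l → ℤ)) (t : ℤ) (ht : 0 ≤ t) (v : Fin l → ℤ) (hv : v ∈ A) :
    t • sqm v ∈ Submodule.span ℕ (sqm '' A) := by
  obtain ⟨k, rfl⟩ := Int.eq_ofNat_of_zero_le ht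
  rw [natCast_zsmul]
  exact Submodule.smul_mem _ _ (Submodule.subset_span ⟨v, hv, rfl⟩)

set_option maxHeartbeats 1600000 in
lemma cone (l : ℕ) : ∃ ε : ℝ, 0 < ε ∧ ∃ 𝒱 : Finset (Fin l → ℤ), ∀ (R : Mat l) (S : Matrix (Fin l) (Fin l) ℝ) (m : ℝ),
    R.IsSymm → S.IsSymm → Red l m S → 1 ≤ ε * m → (∀ i j, |(R i j : ℝ) - S i j| ≤ ε * m) →
    R ∈ Submodule.span ℕ (sqm '' (𝒱 : Set (Fin l → ℤ))) := by
  induction l with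
  | zero =>
    refine ⟨1, one_pos, ∅, ?_⟩
    intro R S m _ _ _ _ _
    have : R = 0 := by ext i; exact i.elim0
    rw [this]; exact Submodule.zero_mem _
  | succ l ih =>
    obtain ⟨ε', hε', 𝒱', ih⟩ := ih
    obtain ⟨η, hη⟩ : ∃ η : ℝ, η = min (ε'/8) (1/2) := ⟨_, rfl⟩
    have hη0 : 0 < η := by rw [hη]; positivity
    have hη1 : η ≤ ε'/8 := by rw [hη]; exact min_le_left _ _
    have hη2 : η ≤ 1/2 := by rw [hη]; exact min_le_right _ _
    obtain ⟨q, hq⟩ := exists_nat_gt (max 1 (max (16/ε') (2*l/η)))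
    have hq1 : (1:ℝ) < q := lt_of_le_of_lt (le_max_left _ _) hq
    have hq2 : 16/ε' < q := lt_of_le_of_lt (le_trans (le_max_left _ _) (le_max_right _ _)) hq
    have hq3 : 2*l/η < q := lt_of_le_of_lt (le_trans (le_max_right _ _) (le_max_right _ _)) hq
    have hq0 : (0:ℝ) < q := by linarith
    have hq2' : 4/(q:ℝ) ≤ ε'/4 := by
      rw [div_lt_iff₀ hε'] at hq2
      rw [div_le_div_iff₀ hq0 (by norm_num)]; linarith
    have hq3' : (l:ℝ)/(2*q) ≤ η/4 := by
      rw [div_lt_iff₀ hη0] at hq3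
      rw [div_le_div_iff₀ (by positivity) (by norm_num)]; linarith
    obtain ⟨δ, hδ⟩ : ∃ δ : ℝ, δ * (40 * (l+1) * q^2) = min ε' η := ⟨min ε' η / (40 * (l+1) * q^2), by field_simp⟩
    have hmin : 0 < min ε' η := lt_min hε' hη0
    have hδ0 : 0 < δ := by
      have : 0 < (40 * (l+1) * (q:ℝ)^2) := by positivity
      rw [← hδ] at hmin
      exact (pos_iff_pos_of_mul_pos hmin).2 this
    have hδε : δ * (40 * (l+1) * q^2) ≤ ε' := hδ ▸ min_le_left _ _
    have hδη : δ * (40 * (l+1) * q^2) ≤ η := hδ ▸ min_le_right _ _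
    have hqq : (1:ℝ) ≤ (q:ℝ)^2 := by nlinarith
    have hl0 : (0:ℝ) ≤ l := Nat.cast_nonneg l
    have hδq : 0 < δ * q^2 := by positivity
    have hlδ : 0 ≤ l * (δ * q^2) := by positivity
    have hδl : δ ≤ δ * q^2 := by nlinarith
    have f1 : 40 * (δ * q^2) + 40 * (l * (δ * q^2)) ≤ ε' := by linarith
    have f2 : 40 * (δ * q^2) + 40 * (l * (δ * q^2)) ≤ η := by linarith
    refine ⟨δ/2, by positivity, Fintype.piFinset (fun _ => Finset.Icc (-(2*q+1:ℤ)) (2*q+1)) ∪ 𝒱'.image (Fin.cons 0), ?_⟩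
    intro R S m hR hS hRed hm hRS
    obtain ⟨hd, hmd, hS0, hRed'⟩ := hRed
    obtain ⟨d, hdd⟩ : ∃ d, d = S 0 0 := ⟨_, rfl⟩
    rw [← hdd] at hd hmd hS0 hRed'
    have hδd : 1 ≤ δ * d := by nlinarith
    have hRS' : ∀ i j, |(R i j : ℝ) - S i j| ≤ δ * d := fun i j => le_trans (hRS i j) (by nlinarith)
    obtain ⟨t, ht⟩ : ∃ t : ℤ, t = ⌊(1-η)*d/q^2⌋ := ⟨_, rfl⟩
    have h1d : 0 < (1-η)*d := mul_pos (by linarith) hd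
    have ht0 : 0 ≤ t := by rw [ht]; apply Int.floor_nonneg.2; positivity
    have ht0' : (0:ℝ) ≤ t := by exact_mod_cast ht0
    have ht1 : (t:ℝ) * q^2 ≤ (1-η)*d := by
      rw [← le_div_iff₀ (by positivity), ht]; exact Int.floor_le _
    have ht2 : (1-η)*d - q^2 ≤ (t:ℝ) * q^2 := by
      have : (1-η)*d/q^2 < t + 1 := by rw [ht]; exact Int.lt_floor_add_one _
      rw [div_lt_iff₀ (by positivity)] at this
      linarith
    obtain ⟨w, hw⟩ : ∃ w : Fin l → ℤ, ∀ k, w k = round (q * S 0 k.succ / ((1-η)*d)) := ⟨_, fun _ => rfl⟩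
    have hwr : ∀ k, |(w k : ℝ) - q * S 0 k.succ / ((1-η)*d)| ≤ 1/2 := by
      intro k; rw [hw, abs_sub_comm]; exact abs_sub_round _
    have hw2 : ∀ k, |w k| ≤ 2*q+1 := by
      intro k
      have h1 := (num_x d q η (S 0 k.succ) _ hd hq1.le hη0 hη2 (hS0 k) rfl).1
      have h2 := hwr k
      have h3 := abs_add_le ((w k : ℝ) - q * S 0 k.succ / ((1-η)*d)) (q * S 0 k.succ / ((1-η)*d))
      rw [sub_add_cancel] at h3
      have : (|w k| : ℝ) ≤ 2*q+1 := by linarith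
      exact_mod_cast this
    obtain ⟨ω, hω⟩ : ∃ ω : Fin (l+1) → ℤ, ω = Fin.cons (q:ℤ) w := ⟨_, rfl⟩
    have hω0 : ω 0 = q := by rw [hω]; rfl
    have hωs : ∀ k, ω (Fin.succ k) = w k := by intro k; rw [hω]; rfl
    obtain ⟨Z, hZ⟩ : ∃ Z, Z = R - t • sqm ω := ⟨_, rfl⟩
    have hZR : ∀ i j, (Z i j : ℝ) = R i j - t * (ω i * ω j) := by
      intro i j
      rw [hZ]
      simp only [Matrix.sub_apply, Matrix.smul_apply, smul_eq_mul, sqm, Matrix.of_apply]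
      push_cast; ring
    have hZ00 : (η - δ) * d ≤ Z 0 0 := by
      rw [hZR, hω0]
      have := (abs_le.1 (hRS' 0 0)).1
      push_cast
      rw [← hdd] at this
      nlinarith
    have hZ0 : ∀ k : Fin l, |(Z 0 k.succ : ℝ)| ≤ (δ + 2*(δ * q^2) + 1/(2*q)) * d := by
      intro k
      have h1 := num1 d q η t (S 0 k.succ) (w k) hd hq1.le hη0 hη2 ht0' ht1 ht2 (hS0 k) (hwr k)
      have h2 := hRS' 0 k.succ
      have e : (Z 0 k.succ : ℝ) = (R 0 k.succ - S 0 k.succ) - (t * q * w k - S 0 k.succ) := by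
        rw [hZR, hω0, hωs]; push_cast; ring
      rw [e]
      have h3 := abs_sub (R 0 k.succ - S 0 k.succ) (t * q * w k - S 0 k.succ)
      have h4 : (q:ℝ)^2 ≤ (δ * d) * q^2 := by nlinarith
      have h5 : 1/(2*q) * d = d/(2*(q:ℝ)) := by ring
      nlinarith
    have hZs : ∀ k k' : Fin l, |(Z k.succ k'.succ : ℝ) - schur S k k'| ≤ (δ + 2*η + 4*(δ * q^2) + 3/q) * d := by
      intro k k'
      have h1 := num2 d q η t (S 0 k.succ) (w k) (S 0 k'.succ) (w k') hd hq1.le hη0 hη2 ht0' ht1 ht2 (hS0 k) (hS0 k') (hwr k) (hwr k')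
      have h2 := hRS' k.succ k'.succ
      have e : (Z k.succ k'.succ : ℝ) - schur S k k' = (R k.succ k'.succ - S k.succ k'.succ) - (t * w k * w k' - S 0 k.succ * S 0 k'.succ / d) := by
        rw [hZR, hωs, hωs]; simp only [schur, Matrix.of_apply]; rw [← hdd]; ring
      rw [e]
      have h3 := abs_sub (R k.succ k'.succ - S k.succ k'.succ) (t * w k * w k' - S 0 k.succ * S 0 k'.succ / d)
      have h4 : (q:ℝ)^2 ≤ (δ * d) * q^2 := by nlinarith
      have h5 : 3/q * d = 3 * d/(q:ℝ) := by ring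
      nlinarith
    have hZsum : 0 ≤ Z 0 0 - ∑ k : Fin l, |Z 0 k.succ| := by
      have h1 : ∑ k : Fin l, |(Z 0 k.succ : ℝ)| ≤ l * ((δ + 2*(δ * q^2) + 1/(2*q)) * d) := by
        calc _ ≤ ∑ k : Fin l, (δ + 2*(δ * q^2) + 1/(2*q)) * d := Finset.sum_le_sum fun k _ => hZ0 k
          _ = _ := by simp
      have h2 : l * ((δ + 2*(δ * q^2) + 1/(2*q)) * d) ≤ (η - δ) * d := by
        rw [← mul_assoc]
        gcongr
        have : (l:ℝ) * (1/(2*q)) = l/(2*q) := by ring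
        have : l * δ ≤ l * (δ * q^2) := by gcongr
        linarith
      have : (0:ℝ) ≤ Z 0 0 - ∑ k : Fin l, |(Z 0 k.succ : ℝ)| := by linarith
      exact_mod_cast this
    rw [cone_decomp R hR t ω Z hZ]
    have hZsym : Z.IsSymm := by
      rw [hZ]
      refine Matrix.IsSymm.sub hR (Matrix.IsSymm.smul ?_ t)
      ext i j; simp [sqm, mul_comm]
    refine Submodule.add_mem _ (Submodule.add_mem _ (Submodule.add_mem _ ?_ ?_) ?_) ?_
    · apply smul_sq_mem _ _ ht0
      simp only [Finset.coe_union, Set.mem_union, Finset.mem_coe, Fintype.mem_piFinset, Finset.mem_Icc]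
      left
      intro a
      refine Fin.cases ?_ (fun k => ?_) a
      · rw [hω0]; constructor <;> omega
      · rw [hωs]; exact abs_le.1 (hw2 k)
    · refine Submodule.sum_mem _ fun k _ => ?_
      apply smul_sq_mem _ _ (abs_nonneg _)
      simp only [Finset.coe_union, Set.mem_union, Finset.mem_coe, Fintype.mem_piFinset, Finset.mem_Icc]
      left
      intro a
      refine Fin.cases ?_ (fun k' => ?_) a
      · simp only [evec, Fin.cons_zero]; constructor <;> omega
      · simp only [evec, Fin.cons_succ]
        rcases eq_or_ne k' k with h | h
        · subst h
          rw [Pi.single_eq_same]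
          rcases lt_trichotomy (Z 0 k'.succ) 0 with h | h | h
          · rw [sign_neg h]; simp; omega
          · rw [h]; simp; omega
          · rw [sign_pos h]; simp; omega
        · rw [Pi.single_eq_of_ne h]; constructor <;> omega
    · apply smul_sq_mem _ _ hZsum
      simp only [Finset.coe_union, Set.mem_union, Finset.mem_coe, Fintype.mem_piFinset, Finset.mem_Icc]
      left
      intro a
      refine Fin.cases ?_ (fun k' => ?_) a
      · simp only [Fin.cons_zero]; constructor <;> omega
      · simp only [Fin.cons_succ, Pi.zero_apply]; constructor <;> omega
    · apply pad_mem (𝒱' : Set (Fin l → ℤ))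
      · intro v hv
        simp only [Finset.coe_union, Set.mem_union, Finset.mem_coe, Finset.mem_image]
        right; exact ⟨v, hv, rfl⟩
      · apply ih _ (schur S) d ?_ ?_ hRed' ?_ ?_
        · ext i j
          simp only [Matrix.transpose_apply, Matrix.of_apply]
          rw [hZsym.apply i.succ j.succ]
          rcases eq_or_ne i j with h | h
          · subst h; rfl
          · rw [if_neg h, if_neg (Ne.symm h)]
        · ext i j
          simp only [schur, Matrix.transpose_apply, Matrix.of_apply]
          rw [hS.apply i.succ j.succ]; ring
        · have : δ ≤ ε' := by linarith
          exact le_trans hδd (mul_le_mul_of_nonneg_right this hd.le)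
        · intro i j
          have h1 := hZs i j
          have h2 := hZ0 i
          have h3 : |((if i = j then |Z 0 i.succ| else 0 : ℤ) : ℝ)| ≤ (δ + 2*(δ * q^2) + 1/(2*q)) * d := by
            split_ifs
            · push_cast; rw [abs_abs]; exact h2
            · simp; positivity
          have e : ((Matrix.of fun k m : Fin l => Z k.succ m.succ - if k = m then |Z 0 k.succ| else 0) i j : ℝ) - schur S i j = ((Z i.succ j.succ : ℝ) - schur S i j) - ((if i = j then |Z 0 i.succ| else 0 : ℤ) : ℝ) := by
            simp only [Matrix.of_apply]; push_cast; ring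
          rw [e]
          have h4 := abs_sub ((Z i.succ j.succ : ℝ) - schur S i j) ((if i = j then |Z 0 i.succ| else 0 : ℤ) : ℝ)
          refine le_trans h4 (le_trans (add_le_add h1 h3) ?_)
          rw [← add_mul]
          gcongr
          have g1 : 3/(q:ℝ) + 1/(2*q) ≤ 4/q := by
            rw [div_add_div _ _ (by positivity) (by positivity), div_le_div_iff₀ (by positivity) hq0]
            have := pow_pos hq0 2
            linarith [sq (q:ℝ)]
          linarith

def InfForm {V : Type*} [AddCommGroup V] (B : V →ₗ[ℤ] V →ₗ[ℤ] ℤ) : Prop :=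
  ∀ F : Finset V, ∃ z, (∀ x ∈ F, B z x = 0) ∧ 0 < B z z

lemma ortho_seq {V : Type*} [AddCommGroup V] (B : V →ₗ[ℤ] V →ₗ[ℤ] ℤ) (hs : ∀ x y, B x y = B y x) (hI : InfForm B)
    (F : Finset V) : ∃ g : ℕ → V, (∀ i, ∀ x ∈ F, B (g i) x = 0) ∧ (∀ i j, i ≠ j → B (g i) (g j) = 0) ∧ ∀ i, 0 < B (g i) (g i) := by
  classical
  choose z hz1 hz2 using hI
  let G : ℕ → Finset V := fun k => Nat.rec F (fun _ S => insert (z S) S) k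
  have hG : ∀ k, G (k+1) = insert (z (G k)) (G k) := fun k => rfl
  have hmono : Monotone G := monotone_nat_of_le_succ fun k => by rw [hG]; exact Finset.subset_insert _ _
  have hlt : ∀ i j, i < j → B (z (G j)) (z (G i)) = 0 := by
    intro i j h
    apply hz1
    apply hmono (Nat.succ_le_of_lt h)
    show z (G i) ∈ G (i+1)
    rw [hG]; exact Finset.mem_insert_self _ _
  refine ⟨fun k => z (G k), ?_, ?_, fun i => hz2 _⟩
  · intro i x hx
    exact hz1 _ _ (hmono (Nat.zero_le i) hx)
  · intro i j h
    rcases lt_or_gt_of_ne h with h | h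
    · rw [hs]; exact hlt _ _ h
    · exact hlt _ _ h

lemma span_orth {V : Type*} [AddCommGroup V] (B : V →ₗ[ℤ] V →ₗ[ℤ] ℤ) (y : V) (H : Set V) (h : ∀ x ∈ H, B y x = 0)
    (x : V) (hx : x ∈ Submodule.span ℤ H) : B y x = 0 := by
  have : Submodule.span ℤ H ≤ LinearMap.ker (B y) := Submodule.span_le.2 h
  exact this hx

lemma one_form {V : Type*} [AddCommGroup V] (B : V →ₗ[ℤ] V →ₗ[ℤ] ℤ) (hs : ∀ x y, B x y = B y x) (hI : InfForm B)
    (F : Finset V) : ∃ (D : ℕ) (H : Finset V), 0 < D ∧ ∀ t : ℕ, ∃ f ∈ Submodule.span ℤ (H : Set V), B f f = D * t ∧ ∀ x ∈ F, B f x = 0 := by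
  classical
  obtain ⟨g, h1, h2, h3⟩ := ortho_seq B hs hI F
  obtain ⟨I, D, hD, h⟩ := star (fun i => (B (g i) (g i)).toNat) (fun i => by have := h3 i; beta_reduce; omega)
  refine ⟨D, I.image g, hD, fun t => ?_⟩
  obtain ⟨x, hx⟩ := h t
  refine ⟨∑ i ∈ I, (x i : ℤ) • g i, ?_, ?_, ?_⟩
  · refine Submodule.sum_mem _ fun i hi => Submodule.smul_mem _ _ (Submodule.subset_span ?_)
    exact Finset.mem_coe.2 (Finset.mem_image_of_mem _ hi)
  · have : ((D * t : ℕ) : ℤ) = ∑ i ∈ I, B (g i) (g i) * (x i)^2 := by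
      rw [hx]; push_cast
      refine Finset.sum_congr rfl fun i _ => ?_
      rw [Int.toNat_of_nonneg (h3 i).le]
    push_cast at this
    rw [this, map_sum B, LinearMap.sum_apply]
    refine Finset.sum_congr rfl fun i hi => ?_
    rw [map_sum, Finset.sum_eq_single i]
    · simp only [map_smul, LinearMap.smul_apply, smul_eq_mul]; ring
    · intro j _ hj
      simp only [map_smul, LinearMap.smul_apply, smul_eq_mul]
      rw [h2 i j hj.symm]; simp
    · intro h; exact absurd hi h
  · intro y hy
    rw [map_sum B, LinearMap.sum_apply]
    refine Finset.sum_eq_zero fun i _ => ?_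
    simp only [map_smul, LinearMap.smul_apply, smul_eq_mul]
    rw [h1 i y hy]; simp

lemma many_form {V ι : Type*} [DecidableEq ι] [AddCommGroup V] (B : V →ₗ[ℤ] V →ₗ[ℤ] ℤ) (hs : ∀ x y, B x y = B y x) (hI : InfForm B)
    (F : Finset V) (s : Finset ι) : ∃ (D : ℕ) (H : Finset V), 0 < D ∧ ∀ t : ι → ℕ, ∃ f : ι → V,
      (∀ i ∈ s, f i ∈ Submodule.span ℤ (H : Set V)) ∧ (∀ i ∈ s, B (f i) (f i) = D * t i) ∧ (∀ i ∈ s, ∀ x ∈ F, B (f i) x = 0) ∧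
      ∀ i ∈ s, ∀ j ∈ s, i ≠ j → B (f i) (f j) = 0 := by
  classical
  induction s using Finset.induction_on with
  | empty => exact ⟨1, ∅, one_pos, fun t => ⟨fun _ => 0, by simp, by simp, by simp, by simp⟩⟩
  | insert a s ha ih =>
    obtain ⟨D, H, hD, h⟩ := ih
    obtain ⟨D', H', hD', h'⟩ := one_form B hs hI (F ∪ H)
    refine ⟨D * D', H ∪ H', Nat.mul_pos hD hD', fun t => ?_⟩
    obtain ⟨f, f1, f2, f3, f4⟩ := h (fun i => D' * t i)
    obtain ⟨g, g1, g2, g3⟩ := h' (D * t a)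
    have hne : ∀ i ∈ s, i ≠ a := fun i hi h => ha (h ▸ hi)
    have hfs : ∀ i ∈ s, Function.update f a g i = f i := fun i hi => Function.update_of_ne (hne i hi) _ _
    have hfa : Function.update f a g a = g := Function.update_self _ _ _
    have horth : ∀ i ∈ s, B g (f i) = 0 := by
      intro i hi
      exact span_orth B g H (fun x hx => g3 x (Finset.mem_union_right _ hx)) _ (f1 i hi)
    refine ⟨Function.update f a g, ?_, ?_, ?_, ?_⟩
    · intro i hi
      rcases Finset.mem_insert.1 hi with rfl | hi
      · rw [hfa]; exact Submodule.span_mono (by simp) g1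
      · rw [hfs i hi]; exact Submodule.span_mono (by simp) (f1 i hi)
    · intro i hi
      rcases Finset.mem_insert.1 hi with rfl | hi
      · rw [hfa, g2]; push_cast; ring
      · rw [hfs i hi, f2 i hi]; push_cast; ring
    · intro i hi x hx
      rcases Finset.mem_insert.1 hi with rfl | hi
      · rw [hfa]; exact g3 x (Finset.mem_union_left _ hx)
      · rw [hfs i hi]; exact f3 i hi x hx
    · intro i hi j hj hij
      rcases Finset.mem_insert.1 hi with rfl | hi' <;> rcases Finset.mem_insert.1 hj with rfl | hj'
      · exact absurd rfl hij
      · rw [hfa, hfs j hj']; exact horth j hj'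
      · rw [hfa, hfs i hi', hs]; exact horth i hi'
      · rw [hfs i hi', hfs j hj']; exact f4 i hi' j hj' hij

lemma corner {α : Type*} (U : Ultrafilter α) (n : ℕ) (S : α → Matrix (Fin n) (Fin n) ℝ) (m : α → ℝ)
    (h : ∀ᶠ N in (U : Filter α), (S N).IsSymm ∧ Red n (m N) (S N)) :
    ∃ (l : ℕ) (ι : Fin l → Fin n) (K : ℝ) (S' : α → Matrix (Fin l) (Fin l) ℝ), Function.Injective ι ∧ 0 ≤ K ∧
      (∀ᶠ N in (U : Filter α), (S' N).IsSymm) ∧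
      (∀ C : ℝ, ∀ᶠ N in (U : Filter α), ∃ m', C ≤ m' ∧ Red l m' (S' N)) ∧
      (∀ᶠ N in (U : Filter α), ∀ i j, (i ∉ Set.range ι ∨ j ∉ Set.range ι) → |S N i j| ≤ K) ∧
      (∀ᶠ N in (U : Filter α), ∀ i k, |S N (ι i) (ι k) - S' N i k| ≤ K) := by
  induction n generalizing m with
  | zero =>
    refine ⟨0, id, 0, S, Function.injective_id, le_rfl, ?_, ?_, ?_, ?_⟩
    · filter_upwards [h] with N hN using hN.1
    · intro C; exact Filter.Eventually.of_forall fun N => ⟨C, le_rfl, trivial⟩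
    · exact Filter.Eventually.of_forall fun N i => i.elim0
    · exact Filter.Eventually.of_forall fun N i => i.elim0
  | succ n ih =>
    by_cases hC : ∀ C : ℝ, ∀ᶠ N in (U : Filter α), C ≤ S N 0 0
    · refine ⟨n+1, id, 0, S, Function.injective_id, le_rfl, ?_, ?_, ?_, ?_⟩
      · filter_upwards [h] with N hN using hN.1
      · intro C
        filter_upwards [h, hC C] with N hN hN'
        exact ⟨S N 0 0, hN', hN.2.1, by linarith [hN.2.1], hN.2.2.2⟩
      · exact Filter.Eventually.of_forall fun N i j hij => by simp at hij
      · exact Filter.Eventually.of_forall fun N i k => by simp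
    · push Not at hC
      obtain ⟨C, hC⟩ := hC
      obtain ⟨l, ι, K, S', hι, hK, h1, h2, h3, h4⟩ := ih (fun N => schur (S N)) (fun N => S N 0 0) (by
        filter_upwards [h] with N hN
        refine ⟨?_, hN.2.2.2.2⟩
        ext i j
        simp only [schur, Matrix.transpose_apply, Matrix.of_apply]
        rw [hN.1.apply i.succ j.succ]; ring)
      have key : ∀ᶠ N in (U : Filter α), (∀ k, |S N 0 k| ≤ |C|) ∧ (∀ k, |S N k 0| ≤ |C|) ∧ ∀ i j : Fin n, |S N 0 i.succ * S N 0 j.succ / S N 0 0| ≤ |C| := by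
        filter_upwards [h, hC] with N hN hN'
        have h0 := hN.2.1
        have hcc : S N 0 0 ≤ |C| := le_trans hN'.le (le_abs_self C)
        have hr := hN.2.2.2.1
        have a : ∀ k, |S N 0 k| ≤ |C| := by
          intro k
          refine Fin.cases ?_ (fun k => ?_) k
          · rw [abs_of_pos h0]; exact hcc
          · exact le_trans (hr k) hcc
        refine ⟨a, fun k => ?_, fun i j => ?_⟩
        · rw [hN.1.apply 0 k]; exact a k
        · rw [abs_div, abs_mul, abs_of_pos h0, div_le_iff₀ h0]
          calc _ ≤ S N 0 0 * S N 0 0 := mul_le_mul (hr i) (hr j) (abs_nonneg _) h0.le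
            _ ≤ _ := by gcongr
      have hsch : ∀ N (i j : Fin n), S N i.succ j.succ = schur (S N) i j + S N 0 i.succ * S N 0 j.succ / S N 0 0 := by
        intro N i j; simp only [schur, Matrix.of_apply]; ring
      refine ⟨l, Fin.succ ∘ ι, K + |C|, S', (Fin.succ_injective n).comp hι, by positivity, h1, h2, ?_, ?_⟩
      · filter_upwards [key, h3] with N hN hN' i j
        refine Fin.cases ?_ (fun i => ?_) i
        · intro _; linarith [hN.1 j]
        · refine Fin.cases ?_ (fun j => ?_) j
          · intro _; linarith [hN.2.1 i.succ]
          · intro hij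
            have := hN' i j (by
              rcases hij with hij | hij
              · left; rintro ⟨a, rfl⟩; exact hij ⟨a, rfl⟩
              · right; rintro ⟨a, rfl⟩; exact hij ⟨a, rfl⟩)
            rw [hsch]
            have h5 := hN.2.2 i j
            have := abs_add_le (schur (S N) i j) (S N 0 i.succ * S N 0 j.succ / S N 0 0)
            linarith
      · filter_upwards [key, h4] with N hN hN' i k
        have h6 := hN' i k
        have h5 := hN.2.2 (ι i) (ι k)
        simp only [Function.comp]
        rw [hsch]
        have := abs_add_le (schur (S N) (ι i) (ι k) - S' N i k) (S N 0 (ι i).succ * S N 0 (ι k).succ / S N 0 0)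
        have e : schur (S N) (ι i) (ι k) + S N 0 (ι i).succ * S N 0 (ι k).succ / S N 0 0 - S' N i k = (schur (S N) (ι i) (ι k) - S' N i k) + (S N 0 (ι i).succ * S N 0 (ι k).succ / S N 0 0) := by ring
        rw [e]
        linarith

lemma span_coeff {l : ℕ} (𝒱 : Finset (Fin l → ℤ)) (R : Mat l) (h : R ∈ Submodule.span ℕ (sqm '' (𝒱 : Set (Fin l → ℤ)))) :
    ∃ t : (Fin l → ℤ) → ℕ, ∀ i j, R i j = ∑ v ∈ 𝒱, (t v : ℤ) * (v i * v j) := by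
  classical
  induction h using Submodule.span_induction with
  | mem x hx =>
    obtain ⟨v, hv, rfl⟩ := hx
    refine ⟨fun u => if u = v then 1 else 0, fun i j => ?_⟩
    rw [Finset.sum_eq_single v]
    · simp [sqm]
    · intro b _ hb; simp [hb]
    · intro h; exact absurd hv h
  | zero => exact ⟨fun _ => 0, fun i j => by simp⟩
  | add x y _ _ hx hy =>
    obtain ⟨t, ht⟩ := hx
    obtain ⟨t', ht'⟩ := hy
    refine ⟨t + t', fun i j => ?_⟩
    rw [Matrix.add_apply, ht, ht', ← Finset.sum_add_distrib]
    refine Finset.sum_congr rfl fun v _ => ?_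
    simp only [Pi.add_apply]; push_cast; ring
  | smul a x _ hx =>
    obtain ⟨t, ht⟩ := hx
    refine ⟨fun v => a * t v, fun i j => ?_⟩
    rw [Matrix.smul_apply, ht, nsmul_eq_mul, Finset.mul_sum]
    refine Finset.sum_congr rfl fun v _ => ?_
    push_cast; ring

lemma split_D (Q : ℕ) (hQ : 0 < Q) : ∀ D : ℕ, 0 < D → ∃ Db Dg K : ℕ, D = Db * Dg ∧ Db ∣ Q^K ∧ Nat.Coprime Dg Q := by
  intro D
  induction D using Nat.strong_induction_on with
  | _ D ih =>
    intro hD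
    by_cases hc : Nat.Coprime D Q
    · exact ⟨1, D, 0, by simp, by simp, hc⟩
    · obtain ⟨D', hD'⟩ := Nat.gcd_dvd_left D Q
      have hg : 0 < Nat.gcd D Q := Nat.gcd_pos_of_pos_left _ hD
      have hg1 : 1 < Nat.gcd D Q := lt_of_le_of_ne hg (fun h => hc h.symm)
      have hD0 : 0 < D' := by
        rcases Nat.eq_zero_or_pos D' with h | h
        · rw [h] at hD'; omega
        · exact h
      obtain ⟨Db, Dg, K, h1, h2, h3⟩ := ih D' (by nlinarith) hD0
      refine ⟨Nat.gcd D Q * Db, Dg, K+1, ?_, ?_, h3⟩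
      · rw [mul_assoc, ← h1]; exact hD'
      · rw [pow_succ, mul_comm]
        exact Nat.mul_dvd_mul h2 (Nat.gcd_dvd_right D Q)

lemma split_d (Q d : ℕ) (hQ : 0 < Q) (hd : 0 < d) (h : ∀ p : ℕ, p.Prime → ¬ p^4 ∣ d) :
    ∃ db dg : ℕ, d = db * dg ∧ db ∣ Q^3 ∧ Nat.Coprime dg Q := by
  obtain ⟨dg, hdg⟩ := Nat.gcd_dvd_left d (Q^3)
  refine ⟨Nat.gcd d (Q^3), dg, hdg, Nat.gcd_dvd_right _ _, ?_⟩
  have hg : 0 < Nat.gcd d (Q^3) := Nat.gcd_pos_of_pos_left _ hd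
  obtain ⟨c, hc⟩ := Nat.gcd_dvd_right d (Q^3)
  have hco : Nat.Coprime dg c := by
    have := Nat.coprime_div_gcd_div_gcd hg
    nth_rewrite 1 [hdg] at this
    nth_rewrite 3 [hc] at this
    rwa [Nat.mul_div_cancel_left _ hg, Nat.mul_div_cancel_left _ hg] at this
  by_contra hn
  obtain ⟨p, hp, h1, h2⟩ := Nat.Prime.not_coprime_iff_dvd.1 hn
  have h3 : p^3 ∣ Nat.gcd d (Q^3) * c := by rw [← hc]; exact pow_dvd_pow_of_dvd h2 3
  have h4 : Nat.Coprime (p^3) c := Nat.Coprime.pow_left 3 (Nat.Coprime.coprime_dvd_left h1 hco)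
  have h5 : p^3 ∣ Nat.gcd d (Q^3) := h4.dvd_of_dvd_mul_right h3
  apply h p hp
  rw [hdg, pow_succ]
  exact Nat.mul_dvd_mul h5 h1

lemma gram_T {n : ℕ} {V : Type*} [AddCommGroup V] (B : V →ₗ[ℤ] V →ₗ[ℤ] ℤ) (v : Fin n → V) (N T : Mat n)
    (hv : ∀ i j, B (v i) (v j) = N i j) (i j : Fin n) :
    B (∑ a, T i a • v a) (∑ b, T j b • v b) = (T * N * Tᵀ) i j := by
  rw [map_sum B, LinearMap.sum_apply]
  simp only [Matrix.mul_apply, Matrix.transpose_apply, map_sum, map_smul, LinearMap.smul_apply, smul_eq_mul, hv]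
  simp only [Finset.sum_mul, Finset.mul_sum]
  rw [Finset.sum_comm]
  refine Finset.sum_congr rfl fun a _ => Finset.sum_congr rfl fun b _ => ?_
  ring

lemma local_x {n : ℕ} {V : Type*} [AddCommGroup V] (B : V →ₗ[ℤ] V →ₗ[ℤ] ℤ) (hs : ∀ x y, B x y = B y x)
    (e : (Om n × Fin 3) × Fin (2*n+1) → V) (hort : ∀ x y, x ≠ y → B (e x) (e y) = 0)
    (Q : ℕ) (hQ : 0 < Q) (hQ2 : 2 ∣ Q) (heQ : ∀ x, B (e x) (e x) ∣ (Q:ℤ))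
    (N0 N1 : Mat n) (h0 : N0.IsSymm) (h1 : N1.IsSymm) (hnice : Nice N0) (v : Fin n → V) (hv : ∀ i j, B (v i) (v j) = N0 i j)
    (D : ℕ) (hD : 0 < D) (h01 : ∀ i j, (4 * (Q:ℤ)^4) ∣ N1 i j - N0 i j) (I : Set (Fin n))
    (hI : ∀ i j, (i ∉ I ∨ j ∉ I) → N1 i j = N0 i j) :
    ∃ x : Fin n → V, (∀ i, x i ∈ Submodule.span ℤ (Set.range v ∪ Set.range e)) ∧
      (∀ i j, (D:ℤ) ∣ B (x i) (x j) - N1 i j) ∧ ∀ i j, (i ∉ I ∨ j ∉ I) → B (x i) (x j) = N1 i j := by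
  obtain ⟨Db, Dg, K, hDD, hDb, hDg⟩ := split_D Q hQ D hD
  obtain ⟨d, X, hd, _, hX, hp⟩ := hnice
  obtain ⟨db, dg, hdd, hdb, hdg⟩ := split_d Q d hQ hd hp
  have hDb0 : 0 < Db := Nat.pos_of_ne_zero (by rintro rfl; simp at hDD; omega)
  have hDg0 : 0 < Dg := Nat.pos_of_ne_zero (by rintro rfl; simp at hDD; omega)
  have hdvd : (4 * (db:ℤ) * Q) ∣ 4 * (Q:ℤ)^4 := by
    obtain ⟨c, hc⟩ := hdb
    refine ⟨c, ?_⟩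
    have : (Q:ℤ)^3 = db * c := by exact_mod_cast hc
    linear_combination 4 * (Q:ℤ) * this
  have hE : ∀ i j, ∃ E, N1 i j - N0 i j = (4 * (db:ℤ) * Q) * E := fun i j => dvd_trans hdvd (h01 i j)
  have hdb0 : 0 < db := Nat.pos_of_ne_zero (by rintro rfl; simp at hdd; omega)
  have hne : (4 * (db:ℤ) * Q) ≠ 0 := by positivity
  choose E' hE' using hE
  have hEsymm : (Matrix.of E').IsSymm := by
    ext i j
    simp only [Matrix.transpose_apply, Matrix.of_apply]
    apply mul_left_cancel₀ hne
    rw [← hE', ← hE', h0.apply i j, h1.apply i j]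
  have hcoDb : Nat.Coprime dg Db := Nat.Coprime.coprime_dvd_right hDb (Nat.Coprime.pow_right K hdg)
  have hcoDD : Nat.Coprime Db Dg := (Nat.Coprime.coprime_dvd_right hDb (Nat.Coprime.pow_right K hDg)).symm
  obtain ⟨κ, κ', hκ⟩ := Nat.isCoprime_iff_coprime.2 hcoDb
  obtain ⟨T, hT1, hT2⟩ := hensel N0 X (Matrix.of E') h0 hEsymm db dg Q κ Db K
    (by rw [hX, hdd]; push_cast; rfl) (by exact_mod_cast hDb) ⟨-κ', by linear_combination hκ⟩
  obtain ⟨G, hG⟩ : ∃ G, G = T * N0 * Tᵀ := ⟨_, rfl⟩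
  have hGs : G.IsSymm := by
    rw [hG, Matrix.IsSymm, Matrix.transpose_mul, Matrix.transpose_mul, Matrix.transpose_transpose, h0, Matrix.mul_assoc]
  rw [← hG] at hT1 hT2
  have hGN1 : ∀ i j, (Db:ℤ) ∣ G i j - N1 i j := by
    intro i j
    obtain ⟨c, hc⟩ := hT1 i j
    refine ⟨c, ?_⟩
    rw [Matrix.sub_apply, Matrix.of_apply] at hc
    linear_combination hc - hE' i j
  have hGI' : ∀ i j, i ∉ I → G i j = N1 i j := by
    intro i j hi
    have := hT2 i (fun j => by
      rw [Matrix.of_apply]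
      have h := hE' i j
      rw [hI i j (Or.inl hi), sub_self] at h
      exact (mul_eq_zero.1 h.symm).resolve_left hne) j
    rw [Matrix.sub_apply] at this
    rw [hI i j (Or.inl hi)]; linarith
  have hGI : ∀ i j, (i ∉ I ∨ j ∉ I) → G i j = N1 i j := by
    rintro i j (h | h)
    · exact hGI' i j h
    · rw [← hGs.apply i j, ← h1.apply i j]; exact hGI' j i h
  have hco2 : IsCoprime ((Db:ℤ)^2) (Dg:ℤ) := (Nat.isCoprime_iff_coprime.2 hcoDD).pow_left
  obtain ⟨μ, μ', hμ⟩ := hco2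
  have hodd : Odd Dg := by
    have : Nat.Coprime Dg 2 := Nat.Coprime.coprime_dvd_right hQ2 hDg
    exact Nat.coprime_two_right.1 this
  obtain ⟨z, hz1, hz2, hz3, hz4⟩ := good_primes B Dg hDg0 hodd e hort
    (fun x => (IsCoprime.of_isCoprime_of_dvd_left (Nat.isCoprime_iff_coprime.2 hDg.symm) (heQ x))) v
    (μ • (N1 - G)) ((h1.sub hGs).smul μ)
  have hzI : ∀ i, i ∉ I → z i = 0 := by
    intro i hi
    apply hz4
    intro j
    rw [Matrix.smul_apply, Matrix.sub_apply, hGI' i j hi, sub_self, smul_zero]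
  obtain ⟨y, hy⟩ : ∃ y : Fin n → V, ∀ i, y i = ∑ a, T i a • v a := ⟨_, fun _ => rfl⟩
  have hyy : ∀ i j, B (y i) (y j) = G i j := by
    intro i j
    rw [hy, hy, hG]; exact gram_T B v N0 T hv i j
  have hzy : ∀ i j, B (z i) (y j) = 0 := by
    intro i j
    rw [hy, map_sum]
    refine Finset.sum_eq_zero fun a _ => ?_
    rw [map_smul, hz2, smul_zero]
  have hyz : ∀ i j, B (y i) (z j) = 0 := fun i j => by rw [hs]; exact hzy j i
  have hgram : ∀ i j, B (y i + (Db:ℤ) • z i) (y j + (Db:ℤ) • z j) = G i j + (Db:ℤ)^2 * B (z i) (z j) := by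
    intro i j
    rw [map_add B, LinearMap.add_apply, map_add, map_add, map_smul B, LinearMap.smul_apply, LinearMap.smul_apply, map_smul, map_smul, hyy, hyz, hzy]
    simp only [smul_eq_mul]; ring
  refine ⟨fun i => y i + (Db:ℤ) • z i, ?_, ?_, ?_⟩
  · intro i
    refine Submodule.add_mem _ ?_ (Submodule.smul_mem _ _ (Submodule.span_mono Set.subset_union_right (hz1 i)))
    rw [hy]
    exact Submodule.sum_mem _ fun a _ => Submodule.smul_mem _ _ (Submodule.subset_span (Or.inl ⟨a, rfl⟩))
  · intro i j
    beta_reduce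
    rw [hgram, hDD]
    push_cast
    apply IsCoprime.mul_dvd (Nat.isCoprime_iff_coprime.2 hcoDD)
    · obtain ⟨c, hc⟩ := hGN1 i j
      exact ⟨c + Db * B (z i) (z j), by linear_combination hc⟩
    · obtain ⟨c, hc⟩ := hz3 i j
      rw [Matrix.smul_apply, Matrix.sub_apply, smul_eq_mul] at hc
      exact ⟨Db^2 * c - μ' * (N1 i j - G i j), by linear_combination (Db:ℤ)^2 * hc + (N1 i j - G i j) * hμ⟩
  · intro i j hij
    beta_reduce
    rw [hgram, hGI i j hij]
    rcases hij with h | h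
    · rw [hzI i h]; simp
    · rw [hzI j h]; simp

def RepV {n : ℕ} {V : Type*} [AddCommGroup V] (B : V →ₗ[ℤ] V →ₗ[ℤ] ℤ) (F : Finset V) (N : Mat n) : Prop :=
  ∃ x : Fin n → V, (∀ i, x i ∈ Submodule.span ℤ (F : Set V)) ∧ ∀ i j, B (x i) (x j) = N i j

lemma ultra_const {α β : Type*} (U : Ultrafilter α) (f : α → β) (s : Set β) (hs : s.Finite)
    (h : ∀ᶠ a in (U : Filter α), f a ∈ s) : ∃ b, ∀ᶠ a in (U : Filter α), f a = b := by
  have : ∀ᶠ a in (U : Filter α), ∃ b ∈ s, f a = b := by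
    filter_upwards [h] with a ha using ⟨_, ha, rfl⟩
  obtain ⟨b, _, hb⟩ := (Ultrafilter.eventually_exists_mem_iff hs).1 this
  exact ⟨b, hb⟩

lemma pick {n : ℕ} (U : Ultrafilter (Mat n)) (𝒯 : Set (Mat n)) (hT : ∀ᶠ N in (U : Filter (Mat n)), N ∈ 𝒯) (I : Set (Fin n)) (K : ℝ)
    (hK : ∀ᶠ N in (U : Filter (Mat n)), ∀ i j, (i ∉ I ∨ j ∉ I) → |(N i j : ℝ)| ≤ K) (q : ℕ) (hq : 0 < q) :
    ∃ N0 ∈ 𝒯, ∀ᶠ N in (U : Filter (Mat n)), (∀ i j, (q:ℤ) ∣ N i j - N0 i j) ∧ ∀ i j, (i ∉ I ∨ j ∉ I) → N i j = N0 i j := by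
  classical
  have : NeZero q := ⟨hq.ne'⟩
  obtain ⟨b, hb⟩ := ultra_const U (fun N : Mat n => fun i j => ((N i j : ℤ) : ZMod q)) Set.univ Set.finite_univ (by simp)
  obtain ⟨c, hc⟩ := ultra_const U (fun N : Mat n => fun i j => if i ∉ I ∨ j ∉ I then N i j else 0)
    (Set.pi Set.univ fun _ => Set.pi Set.univ fun _ => Set.Icc (-⌈|K|⌉) ⌈|K|⌉)
    (Set.Finite.pi fun _ => Set.Finite.pi fun _ => Set.finite_Icc _ _) (by
      filter_upwards [hK] with N hN
      intro i _ j _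
      beta_reduce
      split_ifs with h
      · have h1 := hN i j h
        have h2 : |(N i j : ℝ)| ≤ ⌈|K|⌉ := le_trans h1 (le_trans (le_abs_self K) (Int.le_ceil _))
        have h3 : |N i j| ≤ ⌈|K|⌉ := by exact_mod_cast h2
        exact abs_le.1 h3
      · have : 0 ≤ ⌈|K|⌉ := Int.ceil_nonneg (abs_nonneg _)
        constructor <;> omega)
  obtain ⟨N0, hN0, hN0b, hN0c⟩ := (hT.and (hb.and hc)).exists
  refine ⟨N0, hN0, ?_⟩
  filter_upwards [hb, hc] with N h1 h2
  constructor
  · intro i j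
    have : ((N i j : ℤ) : ZMod q) = ((N0 i j : ℤ) : ZMod q) := by
      have h3 := congrFun (congrFun (h1.trans hN0b.symm) i) j
      exact h3
    have h4 := (ZMod.intCast_eq_intCast_iff_dvd_sub _ _ _).1 this.symm
    exact h4
  · intro i j hij
    have h3 := congrFun (congrFun (h2.trans hN0c.symm) i) j
    beta_reduce at h3
    rwa [if_pos hij, if_pos hij] at h3

/-- The final adjustment: from a Gram matrix close to `N` to `N`. -/
lemma adjust {n l : ℕ} {V : Type*} [AddCommGroup V] (B : V →ₗ[ℤ] V →ₗ[ℤ] ℤ) (hs : ∀ x y, B x y = B y x)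
    (F : Finset V) (x : Fin n → V) (hx : ∀ i, x i ∈ Submodule.span ℤ (F : Set V)) (ι : Fin l → Fin n) (hι : Function.Injective ι)
    (𝒱 : Finset (Fin l → ℤ)) (D : ℕ) (f : (Fin l → ℤ) → V) (t : (Fin l → ℤ) → ℕ)
    (hf2 : ∀ i ∈ 𝒱, B (f i) (f i) = D * t i) (hf3 : ∀ i ∈ 𝒱, ∀ y ∈ F, B (f i) y = 0)
    (hf4 : ∀ i ∈ 𝒱, ∀ j ∈ 𝒱, i ≠ j → B (f i) (f j) = 0)
    (N : Mat n) (hN1 : ∀ i k, N (ι i) (ι k) - B (x (ι i)) (x (ι k)) = D * ∑ v ∈ 𝒱, (t v : ℤ) * (v i * v k))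
    (hN2 : ∀ i j, (i ∉ Set.range ι ∨ j ∉ Set.range ι) → N i j = B (x i) (x j)) (i j : Fin n) :
    B (x i + ∑ v ∈ 𝒱, Function.extend ι v 0 i • f v) (x j + ∑ v ∈ 𝒱, Function.extend ι v 0 j • f v) = N i j := by
  have hfx : ∀ v ∈ 𝒱, ∀ i, B (f v) (x i) = 0 := fun v hv i => span_orth B (f v) F (hf3 v hv) _ (hx i)
  have e1 : ∀ (c : (Fin l → ℤ) → ℤ) i, B (∑ v ∈ 𝒱, c v • f v) (x i) = 0 := by
    intro c i
    rw [map_sum B, LinearMap.sum_apply]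
    refine Finset.sum_eq_zero fun v hv => ?_
    rw [map_smul B, LinearMap.smul_apply, hfx v hv, smul_zero]
  have e2 : ∀ (c c' : (Fin l → ℤ) → ℤ), B (∑ v ∈ 𝒱, c v • f v) (∑ v ∈ 𝒱, c' v • f v) = ∑ v ∈ 𝒱, c v * c' v * (D * t v) := by
    intro c c'
    rw [map_sum B, LinearMap.sum_apply]
    refine Finset.sum_congr rfl fun v hv => ?_
    rw [map_smul B, LinearMap.smul_apply, map_sum, Finset.sum_eq_single v]
    · rw [map_smul, hf2 v hv, smul_eq_mul, smul_eq_mul]; ring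
    · intro w hw hwv
      rw [map_smul, hf4 v hv w hw hwv.symm, smul_zero]
    · intro h; exact absurd hv h
  rw [map_add B, LinearMap.add_apply, map_add, map_add, e1, e2, hs (x i) (∑ v ∈ 𝒱, Function.extend ι v 0 j • f v), e1]
  have hext : ∀ i, i ∉ Set.range ι → ∀ v : Fin l → ℤ, Function.extend ι v 0 i = 0 := by
    intro i hi v
    rw [Function.extend_apply' _ _ _ (fun ⟨a, ha⟩ => hi ⟨a, ha⟩)]; rfl
  by_cases hi : i ∈ Set.range ι
  · by_cases hj : j ∈ Set.range ι
    · obtain ⟨a, rfl⟩ := hi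
      obtain ⟨b, rfl⟩ := hj
      have h := hN1 a b
      rw [Finset.mul_sum] at h
      have : ∑ v ∈ 𝒱, Function.extend ι v 0 (ι a) * Function.extend ι v 0 (ι b) * ((D:ℤ) * t v) = ∑ v ∈ 𝒱, (D:ℤ) * ((t v : ℤ) * (v a * v b)) := by
        refine Finset.sum_congr rfl fun v hv => ?_
        rw [hι.extend_apply, hι.extend_apply]; ring
      rw [this, ← h]; ring
    · rw [hN2 i j (Or.inr hj), Finset.sum_eq_zero]
      · ring
      · intro v _; rw [hext j hj]; ring
  · rw [hN2 i j (Or.inl hi), Finset.sum_eq_zero]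
    · ring
    · intro v _; rw [hext i hi]; ring

theorem inf_case {n : ℕ} {V : Type*} [AddCommGroup V] (B : V →ₗ[ℤ] V →ₗ[ℤ] ℤ) (hs : ∀ x y, B x y = B y x) (hI : InfForm B)
    (𝒯 : Set (Mat n)) (h𝒯 : ∀ N ∈ 𝒯, N.IsSymm ∧ Nice N ∧ Red n 0 (N.map (fun x : ℤ => (x:ℝ))))
    (hrep : ∀ N ∈ 𝒯, ∃ x : Fin n → V, ∀ i j, B (x i) (x j) = N i j) :
    ∃ F : Finset V, ∀ N ∈ 𝒯, RepV B F N := by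
  classical
  by_contra hcon
  push Not at hcon
  have hmono : ∀ (F F' : Finset V) (N : Mat n), F ⊆ F' → RepV B F N → RepV B F' N := by
    rintro F F' N hF ⟨x, h1, h2⟩
    exact ⟨x, fun i => Submodule.span_mono (by exact_mod_cast hF) (h1 i), h2⟩
  have hne : (⨅ F : Finset V, Filter.principal {N | N ∈ 𝒯 ∧ ¬ RepV B F N}).NeBot := by
    apply Filter.iInf_neBot_of_directed'
    · intro F F'
      refine ⟨F ∪ F', ?_, ?_⟩
      · apply Filter.principal_mono.2
        rintro N ⟨h1, h2⟩
        exact ⟨h1, fun h => h2 (hmono _ _ _ Finset.subset_union_left h)⟩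
      · apply Filter.principal_mono.2
        rintro N ⟨h1, h2⟩
        exact ⟨h1, fun h => h2 (hmono _ _ _ Finset.subset_union_right h)⟩
    · intro F
      rw [Filter.principal_neBot_iff]
      obtain ⟨N, h1, h2⟩ := hcon F
      exact ⟨N, h1, h2⟩
  obtain ⟨U, hU⟩ := Ultrafilter.exists_le (⨅ F : Finset V, Filter.principal {N | N ∈ 𝒯 ∧ ¬ RepV B F N})
  have hbad : ∀ F : Finset V, ∀ᶠ N in (U : Filter (Mat n)), N ∈ 𝒯 ∧ ¬ RepV B F N := fun F =>
    hU (Filter.mem_iInf_of_mem F (Filter.mem_principal_self _))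
  have hUT : ∀ᶠ N in (U : Filter (Mat n)), N ∈ 𝒯 := (hbad ∅).mono fun N h => h.1
  obtain ⟨l, ι, K, S', hι, hK, c1, c2, c3, c4⟩ := corner U n (fun N => N.map (fun x : ℤ => (x:ℝ))) (fun _ => 0) (by
    filter_upwards [hUT] with N hN
    refine ⟨?_, (h𝒯 N hN).2.2⟩
    ext i j
    simp only [Matrix.transpose_apply, Matrix.map_apply]
    rw [(h𝒯 N hN).1.apply i j])
  obtain ⟨ε, hε, 𝒱, hcone⟩ := cone l
  have hpick := pick U 𝒯 hUT (Set.range ι) K (by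
    filter_upwards [c3] with N hN i j hij
    exact hN i j hij)
  -- orthogonal family
  obtain ⟨g, _, g2, g3⟩ := ortho_seq B hs hI ∅
  obtain ⟨e, he⟩ : ∃ e : (Om n × Fin 3) × Fin (2*n+1) → V, ∀ x, e x = g (Fintype.equivFin _ x) := ⟨_, fun _ => rfl⟩
  have hort : ∀ x y, x ≠ y → B (e x) (e y) = 0 := by
    intro x y hxy
    rw [he, he]
    apply g2
    intro h
    exact hxy ((Fintype.equivFin _).injective (Fin.ext h))
  have hpos : ∀ x, 0 < B (e x) (e x) := fun x => by rw [he]; exact g3 _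
  obtain ⟨Q, hQdef⟩ : ∃ Q : ℕ, Q = 2 * ∏ x, (B (e x) (e x)).toNat := ⟨_, rfl⟩
  have hQ : 0 < Q := by
    rw [hQdef]
    have : 0 < ∏ x, (B (e x) (e x)).toNat := Finset.prod_pos fun x _ => by have := hpos x; omega
    omega
  have heQ : ∀ x, B (e x) (e x) ∣ (Q:ℤ) := by
    intro x
    have h1 : (B (e x) (e x)).toNat ∣ Q := by
      rw [hQdef]; exact dvd_mul_of_dvd_right (Finset.dvd_prod_of_mem (fun x => (B (e x) (e x)).toNat) (Finset.mem_univ x)) 2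
    have h2 : (((B (e x) (e x)).toNat : ℕ) : ℤ) ∣ (Q:ℤ) := by exact_mod_cast h1
    rwa [Int.toNat_of_nonneg (hpos x).le] at h2
  obtain ⟨N0, hN0T, hN0⟩ := hpick (4 * Q^4) (by positivity)
  obtain ⟨v, hv⟩ := hrep N0 hN0T
  obtain ⟨F1, hF1⟩ : ∃ F1 : Finset V, F1 = Finset.univ.image v ∪ Finset.univ.image e := ⟨_, rfl⟩
  have hF1c : (F1 : Set V) = Set.range v ∪ Set.range e := by
    rw [hF1]; push_cast; simp
  obtain ⟨D, H, hD, hH⟩ := many_form B hs hI F1 𝒱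
  obtain ⟨N2, hN2T, hN2⟩ := hpick (4 * Q^4 * D) (by positivity)
  obtain ⟨N3, hN30, hN32⟩ := (hN0.and hN2).exists
  obtain ⟨x, hx1, hx2, hx3⟩ := local_x B hs e hort Q hQ ⟨_, hQdef⟩ heQ N0 N2 (h𝒯 N0 hN0T).1 (h𝒯 N2 hN2T).1 (h𝒯 N0 hN0T).2.1 v hv D hD
    (by
      intro i j
      obtain ⟨a, ha⟩ := hN30.1 i j
      obtain ⟨b, hb⟩ := hN32.1 i j
      push_cast at ha hb
      exact ⟨a - D * b, by linear_combination ha - hb⟩)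
    (Set.range ι) (by
      intro i j hij
      rw [← hN30.2 i j hij, hN32.2 i j hij])
  rw [← hF1c] at hx1
  obtain ⟨C, hC⟩ : ∃ C : ℝ, ∀ i j, |(B (x i) (x j) : ℝ)| ≤ C := by
    obtain ⟨C, hC⟩ := (Set.finite_range (fun p : Fin n × Fin n => |(B (x p.1) (x p.2) : ℝ)|)).bddAbove
    exact ⟨C, fun i j => hC ⟨(i,j), rfl⟩⟩
  have hgood : ∀ᶠ N in (U : Filter (Mat n)), RepV B (F1 ∪ H) N := by
    filter_upwards [hUT, hN2, c1, c2 (D * (1 + |K + C|) / ε), c4] with N hNT hN2 hS' hm hNS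
    obtain ⟨m, hm, hRed⟩ := hm
    have hDN : ∀ i j, (D:ℤ) ∣ N i j - B (x i) (x j) := by
      intro i j
      obtain ⟨a, ha⟩ := hN2.1 i j
      obtain ⟨b, hb⟩ := hx2 i j
      push_cast at ha
      exact ⟨4 * Q^4 * a - b, by linear_combination ha - hb⟩
    choose R hR using hDN
    have hDR : (0:ℝ) < D := by exact_mod_cast hD
    have hRs : (Matrix.of fun i k => R (ι i) (ι k)).IsSymm := by
      ext i k
      simp only [Matrix.transpose_apply, Matrix.of_apply]
      have hne : (D:ℤ) ≠ 0 := by positivity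
      apply mul_left_cancel₀ hne
      rw [← hR, ← hR, (h𝒯 N hNT).1.apply (ι i) (ι k), hs]
    have hmem := hcone (Matrix.of fun i k => R (ι i) (ι k)) ((1/(D:ℝ)) • S' N) ((1/(D:ℝ)) * m) hRs (hS'.smul _)
      (Red.smul _ (by positivity) hRed)
    have hm' : 1 + |K + C| ≤ ε * (1/(D:ℝ) * m) := by
      rw [div_le_iff₀ hε] at hm
      have : ε * (1/(D:ℝ) * m) = (m * ε) / D := by ring
      rw [this, le_div_iff₀ hDR]; linarith
    have hmem := hmem (by linarith [abs_nonneg (K + C)]) (by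
      intro i k
      rw [Matrix.smul_apply, Matrix.of_apply, smul_eq_mul]
      have h1 := hNS i k
      have h2 := hC (ι i) (ι k)
      have h3 : (N (ι i) (ι k) : ℝ) - B (x (ι i)) (x (ι k)) = D * R (ι i) (ι k) := by exact_mod_cast hR (ι i) (ι k)
      have h4 : (R (ι i) (ι k) : ℝ) - 1/D * S' N i k = (((N (ι i) (ι k) : ℝ) - S' N i k) - B (x (ι i)) (x (ι k))) / D := by
        rw [eq_div_iff hDR.ne']
        field_simp
        linarith
      rw [h4, abs_div, abs_of_pos hDR]
      have h5 := abs_sub ((N (ι i) (ι k) : ℝ) - S' N i k) (B (x (ι i)) (x (ι k)))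
      have h6 : (1:ℝ) ≤ D := by exact_mod_cast hD
      simp only [Matrix.map_apply] at h1
      rw [div_le_iff₀ hDR]
      have h7 := le_abs_self (K + C)
      have h8 : 0 ≤ ε * (1/(D:ℝ) * m) := by linarith [abs_nonneg (K + C)]
      nlinarith)
    obtain ⟨t, ht⟩ := span_coeff 𝒱 _ hmem
    obtain ⟨f, f1, f2, f3, f4⟩ := hH t
    refine ⟨fun i => x i + ∑ v ∈ 𝒱, Function.extend ι v 0 i • f v, ?_, ?_⟩
    · intro i
      push_cast
      refine Submodule.add_mem _ (Submodule.span_mono Set.subset_union_left (hx1 i)) ?_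
      exact Submodule.sum_mem _ fun v hv => Submodule.smul_mem _ _ (Submodule.span_mono Set.subset_union_right (f1 v hv))
    · apply adjust B hs F1 x hx1 ι hι 𝒱 D f t f2 f3 f4
      · intro i k
        rw [← ht i k, Matrix.of_apply, hR]
      · intro i j hij
        rw [hN2.2 i j hij, hx3 i j hij]
  obtain ⟨N, h1, h2⟩ := (hgood.and (hbad (F1 ∪ H))).exists
  exact h2.2 h1

lemma radical_of_null {V : Type*} [AddCommGroup V] (B : V →ₗ[ℤ] V →ₗ[ℤ] ℤ) (hs : ∀ x y, B x y = B y x)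
    (hp : ∀ x, 0 ≤ B x x) (z : V) (hz : B z z = 0) (y : V) : B z y = 0 := by
  by_contra hne
  have h1 := hp (y + (-(B y y + 1) * B z y) • z)
  rw [map_add B, LinearMap.add_apply, map_add, map_add, map_smul B, LinearMap.smul_apply, LinearMap.smul_apply, map_smul, map_smul, hz, hs y z] at h1
  simp only [smul_eq_mul] at h1
  have h2 : 1 ≤ (B z y)^2 := by
    have := sq_pos_of_ne_zero hne
    omega
  have h3 := hp y
  nlinarith

lemma fin_case {V : Type*} [AddCommGroup V] (B : V →ₗ[ℤ] V →ₗ[ℤ] ℤ) (hs : ∀ x y, B x y = B y x)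
    (hp : ∀ x, 0 ≤ B x x) (hI : ¬ InfForm B) : ∃ H : Finset V, ∀ y, ∃ y' ∈ Submodule.span ℤ (H : Set V), ∀ w, B y' w = B y w := by
  classical
  unfold InfForm at hI
  push Not at hI
  obtain ⟨F, hF⟩ := hI
  let φ : V →ₗ[ℤ] (F → ℤ) := LinearMap.pi (fun x => B.flip x.1)
  have hφ : ∀ z x, φ z x = B z x.1 := fun z x => rfl
  obtain ⟨S, hS⟩ : (LinearMap.range φ).FG := IsNoetherian.noetherian _
  have hsub : (S : Set (F → ℤ)) ⊆ φ '' Set.univ := by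
    rw [Set.image_univ]
    intro s hs'
    have : s ∈ LinearMap.range φ := by rw [← hS]; exact Submodule.subset_span hs'
    exact this
  obtain ⟨H, _, hH⟩ := Finset.subset_set_image_iff.1 hsub
  refine ⟨H, fun y => ?_⟩
  have hy : φ y ∈ Submodule.map φ (Submodule.span ℤ (H : Set V)) := by
    rw [Submodule.map_span, ← Finset.coe_image, hH, hS]
    exact ⟨y, rfl⟩
  obtain ⟨y', hy', hyy⟩ := hy
  refine ⟨y', hy', fun w => ?_⟩
  have h0 : B (y' - y) (y' - y) = 0 := by
    apply le_antisymm _ (hp _)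
    apply hF
    intro x hx
    have := congrFun hyy ⟨x, hx⟩
    rw [hφ, hφ] at this
    rw [map_sub B, LinearMap.sub_apply]
    exact sub_eq_zero.2 this
  have := radical_of_null B hs hp _ h0 w
  rw [map_sub B, LinearMap.sub_apply] at this
  exact sub_eq_zero.1 this

theorem main_V {n : ℕ} {V : Type*} [AddCommGroup V] (B : V →ₗ[ℤ] V →ₗ[ℤ] ℤ) (hs : ∀ x y, B x y = B y x)
    (hp : ∀ x, 0 ≤ B x x)
    (𝒯 : Set (Mat n)) (h𝒯 : ∀ N ∈ 𝒯, N.IsSymm ∧ Nice N ∧ Red n 0 (N.map (fun x : ℤ => (x:ℝ))))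
    (hrep : ∀ N ∈ 𝒯, ∃ x : Fin n → V, ∀ i j, B (x i) (x j) = N i j) :
    ∃ F : Finset V, ∀ N ∈ 𝒯, RepV B F N := by
  by_cases hI : InfForm B
  · exact inf_case B hs hI 𝒯 h𝒯 hrep
  · obtain ⟨H, hH⟩ := fin_case B hs hp hI
    refine ⟨H, fun N hN => ?_⟩
    obtain ⟨x, hx⟩ := hrep N hN
    choose f hf1 hf2 using hH
    refine ⟨fun i => f (x i), fun i => hf1 _, fun i j => ?_⟩
    rw [hf2, hs, hf2, hs, hx]

lemma tlt {r n : ℕ} (L : Mat r) (x : Fin n → Fin r → ℤ) (i j : Fin n) :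
    (Matrix.of x * L * (Matrix.of x)ᵀ) i j = x i ⬝ᵥ L *ᵥ x j := by
  rw [Matrix.mul_assoc]
  rfl

lemma KKO (n : ℕ) (Nst : Mat n) (hst : PosDefInt Nst) :
    ∃ s : Finset {N : Mat n // PosDefInt N ∧ ¬ Isom N Nst}, ∀ (r : ℕ) (L : Mat r), PosDefInt L → (∀ N ∈ s, Represents L N.1) →
      ∀ N : {N : Mat n // PosDefInt N ∧ ¬ Isom N Nst}, Represents L N.1 := by
  classical
  by_contra hcon
  push Not at hcon
  choose r L hL hrep hnot using hcon
  have hT : ∀ s (N : {N : Mat n // PosDefInt N ∧ ¬ Isom N Nst}), ∃ T : Matrix (Fin n) (Fin (r s)) ℤ, N ∈ s → T * L s * Tᵀ = N.1 := by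
    intro s N
    by_cases h : N ∈ s
    · obtain ⟨T, hT⟩ := hrep s N h
      exact ⟨T, fun _ => hT⟩
    · exact ⟨0, fun h' => absurd h' h⟩
  choose T hT using hT
  obtain ⟨U, hU⟩ := Ultrafilter.exists_le (Filter.atTop : Filter (Finset {N : Mat n // PosDefInt N ∧ ¬ Isom N Nst}))
  have hev : ∀ N, ∀ᶠ s in (U : Filter (Finset {N : Mat n // PosDefInt N ∧ ¬ Isom N Nst})), N ∈ s := by
    intro N
    apply hU
    filter_upwards [Filter.eventually_ge_atTop {N}] with s hs
    exact hs (Finset.mem_singleton_self N)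
  obtain ⟨row, hrow⟩ : ∃ row : ∀ s, ({N : Mat n // PosDefInt N ∧ ¬ Isom N Nst} × Fin n) → (Fin (r s) → ℤ), ∀ s a, row s a = T s a.1 a.2 :=
    ⟨fun s a => T s a.1 a.2, fun s a => rfl⟩
  let bl : ∀ s, (Fin (r s) → ℤ) →ₗ[ℤ] (Fin (r s) → ℤ) →ₗ[ℤ] ℤ := fun s => Matrix.toLinearMap₂' ℤ (L s)
  have hbl : ∀ s x y, bl s x y = x ⬝ᵥ L s *ᵥ y := fun s x y => Matrix.toLinearMap₂'_apply' _ _ _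
  have hblp : ∀ s x, 0 ≤ bl s x x := by
    intro s x
    rw [hbl]
    rcases eq_or_ne x 0 with h | h
    · rw [h]; simp
    · exact ((hL s).2 x h).le
  have hbls : ∀ s x y, bl s x y = bl s y x := by
    intro s x y
    rw [hbl, hbl, Matrix.dotProduct_mulVec, ← Matrix.mulVec_transpose, (hL s).1, dotProduct_comm]
  have hTbl : ∀ s N i j, N ∈ s → bl s (row s (N, i)) (row s (N, j)) = N.1 i j := by
    intro s N i j h
    rw [hbl, hrow, hrow, ← hT s N h]
    exact (tlt (L s) (T s N) i j).symm
  have hG : ∀ a b, ∃ g : ℤ, ∀ᶠ s in (U : Filter (Finset {N : Mat n // PosDefInt N ∧ ¬ Isom N Nst})), bl s (row s a) (row s b) = g := by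
    rintro ⟨N, i⟩ ⟨M, j⟩
    apply ultra_const U _ (Set.Icc (-(N.1 i i + M.1 j j)) (N.1 i i + M.1 j j)) (Set.finite_Icc _ _)
    filter_upwards [hev N, hev M] with s h1 h2
    have e1 := hTbl s N i i h1
    have e2 := hTbl s M j j h2
    have p1 := hblp s (row s (N,i) + row s (M,j))
    have p2 := hblp s (row s (N,i) - row s (M,j))
    rw [map_add (bl s), LinearMap.add_apply, map_add, map_add, e1, e2, hbls s (row s (M,j))] at p1
    rw [map_sub (bl s), LinearMap.sub_apply, map_sub, map_sub, e1, e2, hbls s (row s (M,j))] at p2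
    have q1 := hblp s (row s (N,i))
    have q2 := hblp s (row s (M,j))
    constructor <;> linarith
  choose G hG using hG
  let B : (({N : Mat n // PosDefInt N ∧ ¬ Isom N Nst} × Fin n) →₀ ℤ) →ₗ[ℤ] (({N : Mat n // PosDefInt N ∧ ¬ Isom N Nst} × Fin n) →₀ ℤ) →ₗ[ℤ] ℤ :=
    Finsupp.linearCombination ℤ (fun a => Finsupp.linearCombination ℤ (fun b => G a b))
  have hBG : ∀ a b c d, B (Finsupp.single a c) (Finsupp.single b d) = c * (d * G a b) := by
    intro a b c d
    simp [B, Finsupp.linearCombination_single]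
  let φ : ∀ s, (({N : Mat n // PosDefInt N ∧ ¬ Isom N Nst} × Fin n) →₀ ℤ) →ₗ[ℤ] (Fin (r s) → ℤ) := fun s =>
    Finsupp.linearCombination ℤ (row s)
  have hφ : ∀ s a c, φ s (Finsupp.single a c) = c • row s a := by
    intro s a c
    exact Finsupp.linearCombination_single ℤ c a
  have hBφ : ∀ x y, ∀ᶠ s in (U : Filter (Finset {N : Mat n // PosDefInt N ∧ ¬ Isom N Nst})), bl s (φ s x) (φ s y) = B x y := by
    intro x y
    induction x using Finsupp.induction_linear with
    | zero => exact Filter.Eventually.of_forall fun s => by rw [map_zero, map_zero, map_zero]; rfl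
    | add x x' h h' =>
      filter_upwards [h, h'] with s h h'
      rw [map_add (φ s), map_add (bl s), map_add B, LinearMap.add_apply, LinearMap.add_apply, h, h']
    | single a c =>
      induction y using Finsupp.induction_linear with
      | zero => exact Filter.Eventually.of_forall fun s => by rw [map_zero, map_zero, map_zero]
      | add y y' h h' =>
        filter_upwards [h, h'] with s h h'
        rw [map_add (φ s), map_add, map_add, h, h']
      | single b d =>
        filter_upwards [hG a b] with s h
        rw [hφ, hφ, hBG, map_smul (bl s), LinearMap.smul_apply, map_smul, h, smul_eq_mul, smul_eq_mul]
  have hs : ∀ x y, B x y = B y x := by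
    intro x y
    obtain ⟨s, h1, h2⟩ := ((hBφ x y).and (hBφ y x)).exists
    rw [← h1, ← h2, hbls]
  have hp : ∀ x, 0 ≤ B x x := by
    intro x
    obtain ⟨s, h1⟩ := (hBφ x x).exists
    rw [← h1]; exact hblp s _
  have hGN : ∀ N i j, G (N, i) (N, j) = N.1 i j := by
    intro N i j
    obtain ⟨s, h1, h2⟩ := ((hG (N,i) (N,j)).and (hev N)).exists
    rw [← h1, hTbl s N i j h2]
  obtain ⟨F, hF⟩ := main_V B hs hp {N | (PosDefInt N ∧ ¬ Isom N Nst) ∧ Nice N ∧ Red n 0 (N.map (fun x : ℤ => (x:ℝ)))}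
    (fun N hN => ⟨hN.1.1.1, hN.2.1, hN.2.2⟩) (by
      rintro N ⟨h1, h2⟩
      refine ⟨fun i => Finsupp.single (⟨N, h1⟩, i) 1, fun i j => ?_⟩
      rw [hBG, hGN]; simp)
  have hFev : ∀ᶠ s in (U : Filter (Finset {N : Mat n // PosDefInt N ∧ ¬ Isom N Nst})), ∀ x ∈ F, ∀ y ∈ F, bl s (φ s x) (φ s y) = B x y := by
    rw [Filter.eventually_all_finset]
    intro x _
    rw [Filter.eventually_all_finset]
    intro y _
    exact hBφ x y
  obtain ⟨s, hsF⟩ := hFev.exists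
  have hspan : ∀ x ∈ Submodule.span ℤ (F : Set (({N : Mat n // PosDefInt N ∧ ¬ Isom N Nst} × Fin n) →₀ ℤ)), ∀ y ∈ Submodule.span ℤ (F : Set (({N : Mat n // PosDefInt N ∧ ¬ Isom N Nst} × Fin n) →₀ ℤ)), bl s (φ s x) (φ s y) = B x y := by
    intro x hx y hy
    induction hx using Submodule.span_induction with
    | mem x hx =>
      induction hy using Submodule.span_induction with
      | mem y hy => exact hsF x hx y hy
      | zero => rw [map_zero, map_zero, map_zero]
      | add y y' _ _ h h' => rw [map_add (φ s), map_add, map_add, h, h']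
      | smul a y _ h => rw [map_smul (φ s), map_smul, map_smul, h]
    | zero => rw [map_zero, map_zero, map_zero]; rfl
    | add x x' _ _ h h' => rw [map_add (φ s), map_add (bl s), map_add B, LinearMap.add_apply, LinearMap.add_apply, h, h']
    | smul a x _ h => rw [map_smul (φ s), map_smul (bl s), map_smul B, LinearMap.smul_apply, LinearMap.smul_apply, h]
  obtain ⟨N, hN⟩ := hnot s
  apply hN
  obtain ⟨N', p1, p2, p3, p4⟩ := exists_nice Nst N.1 hst N.2.1 N.2.2
  obtain ⟨G', u1, u2⟩ := reduction n N' p1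
  have hG'iso : ¬ Isom G' Nst := fun h => p3 ⟨u1.rep.trans' h.1, h.2.trans' u1.symm.rep⟩
  obtain ⟨x, x1, x2⟩ := hF G' ⟨⟨u1.posDef p1, hG'iso⟩, u1.nice p4, u2⟩
  have hLG : Represents (L s) G' := by
    refine ⟨Matrix.of fun i => φ s (x i), ?_⟩
    ext i j
    rw [tlt, ← hbl, hspan _ (x1 i) _ (x1 j), x2]
  exact (hLG.trans' u1.symm.rep).trans' p2

lemma repCls_iff {m n : ℕ} (L : QLat m) (M : QLat n) : RepCls L (cls M) ↔ Represents L.1 M.1 := by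
  constructor
  · rintro ⟨N, h1, h2⟩
    have h3 : Isom N.1 M.1 := Quotient.exact h1
    exact h2.trans' h3.1
  · intro h
    exact ⟨M, rfl, h⟩

/-- `{cls N}` is an `n`-exceptional set if and only if every
`Φ_n`-universality criterion set contains `cls N`. -/
theorem singleton_exceptional_iff (n : ℕ) (N : QLat n) :
    (∃ (r : ℕ) (L : QLat r), ExcSet n L = {cls N}) ↔
      ∀ X : Set (Cls n), CritSet n X → cls N ∈ X := by
  constructor
  · rintro ⟨r, L, hL⟩ X ⟨_, hX⟩
    by_contra hN
    have h1 : ∀ c ∈ X, RepCls L c := by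
      intro c hc
      by_contra h
      have : c ∈ ExcSet n L := h
      rw [hL] at this
      rw [Set.mem_singleton_iff.1 this] at hc
      exact hN hc
    have h2 : cls N ∈ ExcSet n L := by rw [hL]; rfl
    exact h2 (hX r L h1 _)
  · intro h
    obtain ⟨s, hs⟩ := KKO n N.1 N.2
    let f : {M : Mat n // PosDefInt M ∧ ¬ Isom M N.1} → Cls n := fun M => cls ⟨M.1, M.2.1⟩
    have hnot : ¬ CritSet n (f '' (s : Set _)) := by
      intro hc
      obtain ⟨M, _, hM⟩ := h _ hc
      have : Isom M.1 N.1 := Quotient.exact hM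
      exact M.2.2 this
    have hnot' : ¬ ∀ (r : ℕ) (L : QLat r), (∀ c ∈ f '' (s : Set _), RepCls L c) → ∀ c : Cls n, RepCls L c :=
      fun hc => hnot ⟨s.finite_toSet.image f, hc⟩
    push Not at hnot'
    obtain ⟨r, L, hL, c, hc⟩ := hnot'
    have hall := hs r L.1 L.2 (fun M hM => (repCls_iff L ⟨M.1, M.2.1⟩).1 (hL _ ⟨M, hM, rfl⟩))
    have hsub : ∀ c : Cls n, ¬ RepCls L c → c = cls N := by
      intro c hc
      obtain ⟨M, rfl⟩ := Quotient.exists_rep c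
      by_contra hne
      have hiso : ¬ Isom M.1 N.1 := fun hi => hne (Quotient.sound hi)
      exact hc ((repCls_iff L M).2 (hall ⟨M.1, M.2, hiso⟩))
    refine ⟨r, L, Set.eq_singleton_iff_unique_mem.2 ⟨?_, fun c hc => hsub c hc⟩⟩
    rw [← hsub c hc]; exact hc
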